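/- arXiv:2011.03220 — 2 statements merged into one kernel-verified Lean document; each statement's English description precedes it below -/
import Mathlib

section
/- For every n ≥ 1 and every 1 < p < ∞ there exists a constant C = C(n,p) > 0 such that the following holds: if u : ℝⁿ → ℝ is smooth and solves the Poisson equation Δu = f on ℝⁿ with u ∈ L^p(ℝⁿ) and f ∈ L^p(ℝⁿ), then |∇u| ∈ L^p(ℝⁿ) and ‖∇u‖_{L^p} ≤ C ( ‖u‖_{L^p} + ‖f‖_{L^p} ). -/
open MeasureTheory

/-- Partial derivative `∂ᵢ u` of a function on `ℝⁿ = EuclideanSpace ℝ (Fin n)`. -/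
noncomputable def pd {n : ℕ} (u : EuclideanSpace ℝ (Fin n) → ℝ) (i : Fin n)
    (x : EuclideanSpace ℝ (Fin n)) : ℝ :=
  fderiv ℝ u x (EuclideanSpace.single i 1)

/-- Second partial derivative `∂ᵢ∂ⱼ u`. -/
noncomputable def pd2 {n : ℕ} (u : EuclideanSpace ℝ (Fin n) → ℝ) (i j : Fin n)
    (x : EuclideanSpace ℝ (Fin n)) : ℝ :=
  pd (pd u j) i x

/-- Laplacian `Δu = ∑ᵢ ∂ᵢ² u`. -/
noncomputable def lap {n : ℕ} (u : EuclideanSpace ℝ (Fin n) → ℝ)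
    (x : EuclideanSpace ℝ (Fin n)) : ℝ :=
  ∑ i : Fin n, pd2 u i i x

/-- Euclidean norm of the gradient, `|∇u|(x) = (∑ᵢ (∂ᵢu)²)^{1/2}`. -/
noncomputable def gradNorm {n : ℕ} (u : EuclideanSpace ℝ (Fin n) → ℝ)
    (x : EuclideanSpace ℝ (Fin n)) : ℝ :=
  Real.sqrt (∑ i : Fin n, pd u i x ^ 2)

/-- Hilbert–Schmidt norm of the Hessian, `|Hess u|(x) = (∑_{i,j} (∂ᵢ∂ⱼu)²)^{1/2}`. -/
noncomputable def hessNorm {n : ℕ} (u : EuclideanSpace ℝ (Fin n) → ℝ)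
    (x : EuclideanSpace ℝ (Fin n)) : ℝ :=
  Real.sqrt (∑ i : Fin n, ∑ j : Fin n, pd2 u i j x ^ 2)

/-- `L^p` norm with respect to Lebesgue measure on `ℝⁿ`:  `(∫ |f|^p)^{1/p}`. -/
noncomputable def lpNorm {n : ℕ} (p : ℝ) (f : EuclideanSpace ℝ (Fin n) → ℝ) : ℝ :=
  (∫ x, |f x| ^ p) ^ (1 / p)


abbrev EE (n : ℕ) := EuclideanSpace ℝ (Fin n)

lemma pd_contDiff {n : ℕ} {u : EE n → ℝ} (hu : ContDiff ℝ (⊤ : ℕ∞) u) (i : Fin n) :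
    ContDiff ℝ (⊤ : ℕ∞) (pd u i) := by
  have h : ContDiff ℝ (⊤ : ℕ∞) (fderiv ℝ u) := hu.fderiv_right (by simp)
  exact h.clm_apply contDiff_const

lemma pd_comm {n : ℕ} {u : EE n → ℝ} (hu : ContDiff ℝ (⊤ : ℕ∞) u) (i j : Fin n) :
    pd (pd u i) j = pd (pd u j) i := by
  have h : ContDiff ℝ (⊤ : ℕ∞) (fderiv ℝ u) := hu.fderiv_right (by simp)
  have hd : Differentiable ℝ (fderiv ℝ u) := h.differentiable (by simp)
  have key : ∀ (a b : Fin n) (x : EE n), pd (pd u a) b x =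
      fderiv ℝ (fderiv ℝ u) x (EuclideanSpace.single b 1) (EuclideanSpace.single a 1) := by
    intro a b x
    have : HasFDerivAt (pd u a) ((fderiv ℝ (fderiv ℝ u) x).flip (EuclideanSpace.single a 1)) x := by
      have := (hd x).hasFDerivAt.clm_apply
        (hasFDerivAt_const (EuclideanSpace.single a (1:ℝ)) x)
      rw [ContinuousLinearMap.comp_zero, zero_add] at this
      exact this
    unfold pd at *
    rw [this.fderiv]; rfl
  funext x
  rw [key, key]
  have hs : IsSymmSndFDerivAt ℝ u x := hu.contDiffAt.isSymmSndFDerivAt (by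
    simp only [minSmoothness_of_isRCLikeNormedField]; exact WithTop.coe_le_coe.2 (le_top : (2 : ℕ∞) ≤ ⊤))
  exact hs _ _

lemma lap_contDiff {n : ℕ} {u : EE n → ℝ} (hu : ContDiff ℝ (⊤ : ℕ∞) u) :
    ContDiff ℝ (⊤ : ℕ∞) (lap u) := by
  have : lap u = fun x => ∑ i, pd (pd u i) i x := rfl
  rw [this]
  exact ContDiff.sum fun i _ => pd_contDiff (pd_contDiff hu i) i

lemma lap_pd {n : ℕ} {u : EE n → ℝ} (hu : ContDiff ℝ (⊤ : ℕ∞) u) (i : Fin n) (x : EE n) :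
    lap (pd u i) x = pd (lap u) i x := by
  have h1 : lap u = fun x => ∑ i, pd (pd u i) i x := rfl
  have : pd (lap u) i x = ∑ j, pd (pd (pd u j) j) i x := by
    rw [h1]
    unfold pd
    rw [fderiv_fun_sum]
    · simp
    · intro j _
      exact (pd_contDiff (pd_contDiff hu j) j).differentiable (by simp) x
  rw [this]
  unfold lap pd2
  refine Finset.sum_congr rfl fun j _ => ?_
  rw [pd_comm hu i j, pd_comm (pd_contDiff hu j) i j]

lemma pd_comp {n : ℕ} {b : EE n → ℝ} (hb : ContDiff ℝ (⊤ : ℕ∞) b) (x : EE n) (r : ℝ) (j : Fin n)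
    (y : EE n) : pd (fun y => b (x + r • y)) j y = r * pd b j (x + r • y) := by
  have h1 : HasFDerivAt (fun y : EE n => x + r • y) (r • ContinuousLinearMap.id ℝ (EE n)) y :=
    ((hasFDerivAt_id y).const_smul r).const_add x
  have h2 := ((hb.differentiable (by simp)) (x + r • y)).hasFDerivAt.comp y h1
  unfold pd
  have h3 := h2.fderiv
  simp only [Function.comp_def] at h3
  rw [h3]; simp

lemma ibp {n : ℕ} {a b : EE n → ℝ} (ha : ContDiff ℝ (⊤ : ℕ∞) a) (hc : HasCompactSupport a)
    (hb : ContDiff ℝ (⊤ : ℕ∞) b) (i : Fin n) :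
    ∫ y, pd a i y * b y = - ∫ y, a y * pd b i y := by
  have hcd : HasCompactSupport (pd a i) := hc.fderiv_apply (𝕜 := ℝ) _
  have := integral_mul_fderiv_eq_neg_fderiv_mul_of_integrable (μ := (volume : Measure (EE n)))
    (f := a) (g := b) (v := EuclideanSpace.single i (1:ℝ)) (𝕜 := ℝ) ?_ ?_ ?_
    (fun x _ => ha.differentiable (by simp) x) (fun x _ => hb.differentiable (by simp) x)
  · unfold pd; rw [this]; simp
  · exact ((pd_contDiff ha i).continuous.mul hb.continuous).integrable_of_hasCompactSupport
      (hcd.mul_right)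
  · exact (ha.continuous.mul (pd_contDiff hb i).continuous).integrable_of_hasCompactSupport
      (hc.mul_right)
  · exact (ha.continuous.mul hb.continuous).integrable_of_hasCompactSupport
      (hc.mul_right)

lemma Lp_avg {n : ℕ} {Z : Type*} [MeasurableSpace Z] (ν : Measure Z) [IsFiniteMeasure ν]
    (T : Z → EE n) (hT : Measurable T) (g : EE n → ENNReal) (hg : Measurable g) (p : ℝ)
    (hp : 1 < p) :
    ∫⁻ x, (∫⁻ z, g (x + T z) ∂ν) ^ p ≤ ν Set.univ ^ p * ∫⁻ x, g x ^ p := by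
  have hpq := Real.HolderConjugate.conjExponent hp
  set q := p.conjExponent
  have hm : Measurable fun w : EE n × Z => g (w.1 + T w.2) :=
    hg.comp (measurable_fst.add (hT.comp measurable_snd))
  have h1 : ∀ x, (∫⁻ z, g (x + T z) ∂ν) ^ p ≤ ν Set.univ ^ (p - 1) * ∫⁻ z, g (x + T z) ^ p ∂ν := by
    intro x
    have hx : Measurable fun z => g (x + T z) := hg.comp (hT.const_add x)
    have := ENNReal.lintegral_mul_le_Lp_mul_Lq ν hpq hx.aemeasurable
      (aemeasurable_const (b := (1:ENNReal)))
    simp only [Pi.mul_apply, mul_one, ENNReal.one_rpow, lintegral_const, one_mul] at this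
    calc _ ≤ _ := ENNReal.rpow_le_rpow this (by linarith)
      _ = _ := by
        rw [ENNReal.mul_rpow_of_nonneg _ _ (by linarith), ← ENNReal.rpow_mul, ← ENNReal.rpow_mul,
          mul_comm]
        congr 1
        · congr 1
          have := hpq.sub_one_mul_conj
          have := hpq.symm.pos
          field_simp
          linarith
        · rw [one_div, inv_mul_cancel₀ (by linarith), ENNReal.rpow_one]
  calc _ ≤ ∫⁻ x, ν Set.univ ^ (p - 1) * ∫⁻ z, g (x + T z) ^ p ∂ν := lintegral_mono h1
    _ = ν Set.univ ^ (p - 1) * ∫⁻ x, ∫⁻ z, g (x + T z) ^ p ∂ν :=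
        lintegral_const_mul _ (hm.pow_const p).lintegral_prod_right'
    _ = ν Set.univ ^ (p - 1) * ∫⁻ z, (∫⁻ x, g (x + T z) ^ p) ∂ν := by
        rw [lintegral_lintegral_swap]
        exact (hm.pow_const p).aemeasurable
    _ = ν Set.univ ^ (p - 1) * (ν Set.univ * ∫⁻ x, g x ^ p) := by
        congr 1
        rw [mul_comm, ← lintegral_const]
        congr 1; funext z
        exact lintegral_add_right_eq_self (fun x => g x ^ p) (T z)
    _ = _ := by
        rw [← mul_assoc]
        congr 1
        nth_rewrite 2 [← ENNReal.rpow_one (ν Set.univ)]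
        rw [← ENNReal.rpow_add_of_nonneg _ _ (by linarith) (by linarith)]
        congr 1; ring

lemma exists_kernel (n : ℕ) (hn : 1 ≤ n) : ∃ η ψ : EE n → ℝ,
    ContDiff ℝ (⊤ : ℕ∞) η ∧ ContDiff ℝ (⊤ : ℕ∞) ψ ∧ HasCompactSupport η ∧ HasCompactSupport ψ ∧
    (∀ i y, pd ψ i y = - (y i * η y)) ∧ 0 < ∫ y, η y := by
  set G : ℝ → ℝ := fun s => Real.smoothTransition (2 - s) with hG
  have hGc : ContDiff ℝ (⊤ : ℕ∞) G :=
    Real.smoothTransition.contDiff.comp (contDiff_const.sub contDiff_id)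
  have hGd : Differentiable ℝ G := hGc.differentiable (by simp)
  have hdc : ContDiff ℝ (⊤ : ℕ∞) (deriv G) := by
    have : ContDiff ℝ ((⊤ : ℕ∞) + 1 : WithTop ℕ∞) G := by simpa using hGc
    exact (contDiff_succ_iff_deriv.1 this).2.2
  have hanti : Antitone G := fun a b h => Real.smoothTransition.monotone (by linarith)
  have hd0 : ∀ s, deriv G s ≤ 0 := fun s => hanti.deriv_nonpos
  have hdz : ∀ s, 2 < s → deriv G s = 0 := by
    intro s hs
    have : G =ᶠ[nhds s] fun _ => 0 := by
      filter_upwards [lt_mem_nhds hs] with t ht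
      exact Real.smoothTransition.zero_of_nonpos (by linarith)
    rw [this.deriv_eq]; simp
  obtain ⟨s, hs, hsd⟩ : ∃ s ∈ Set.Ioo (1:ℝ) 2, deriv G s = -1 := by
    obtain ⟨s, hs, h⟩ := exists_deriv_eq_slope G (by norm_num : (1:ℝ) < 2)
      hGc.continuous.continuousOn hGd.differentiableOn
    refine ⟨s, hs, ?_⟩
    rw [h]
    simp only [hG]
    norm_num
  have hsq : ContDiff ℝ (⊤ : ℕ∞) (fun y : EE n => ‖y‖ ^ 2) := contDiff_norm_sq ℝ
  have hηc : ContDiff ℝ (⊤ : ℕ∞) (fun y : EE n => -2 * deriv G (‖y‖ ^ 2)) :=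
    contDiff_const.mul (hdc.comp hsq)
  have hηs : HasCompactSupport (fun y : EE n => -2 * deriv G (‖y‖ ^ 2)) := by
    refine HasCompactSupport.intro (isCompact_closedBall (0 : EE n) 2) fun y hy => ?_
    have : 2 < ‖y‖ := by simpa using hy
    rw [hdz _ (by nlinarith)]; simp
  refine ⟨fun y => -2 * deriv G (‖y‖ ^ 2), fun y => G (‖y‖ ^ 2), hηc, hGc.comp hsq, hηs, ?_, ?_, ?_⟩
  · refine HasCompactSupport.intro (isCompact_closedBall (0 : EE n) 2) fun y hy => ?_
    have : 2 < ‖y‖ := by simpa using hy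
    exact Real.smoothTransition.zero_of_nonpos (by nlinarith)
  · intro i y
    have h1 : HasFDerivAt (fun y : EE n => ‖y‖ ^ 2) (2 • innerSL ℝ y) y :=
      (hasStrictFDerivAt_norm_sq y).hasFDerivAt
    have h2 := (hGd (‖y‖ ^ 2)).hasDerivAt.comp_hasFDerivAt y h1
    have h3 := h2.fderiv
    simp only [Function.comp_def] at h3
    unfold pd
    rw [h3]
    simp [EuclideanSpace.inner_single_right]
    ring
  · refine hηc.continuous.integral_pos_of_hasCompactSupport_nonneg_nonzero hηs
      (fun y => ?_) (x := EuclideanSpace.single (⟨0, hn⟩ : Fin n) (Real.sqrt s)) ?_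
    · have := hd0 (‖y‖ ^ 2)
      simp only [Pi.zero_apply]
      linarith
    · have : ‖EuclideanSpace.single (⟨0, hn⟩ : Fin n) (Real.sqrt s)‖ ^ 2 = s := by
        rw [PiLp.norm_single, Real.norm_eq_abs, sq_abs, Real.sq_sqrt (by linarith [hs.1])]
      rw [this, hsd]; norm_num

lemma fderiv_eq_sum {n : ℕ} (v : EE n → ℝ) (z y : EE n) :
    fderiv ℝ v z y = ∑ j, y j * pd v j z := by
  unfold pd
  conv_lhs => rw [show y = ∑ j, y j • EuclideanSpace.single j (1:ℝ) by
    simpa using ((EuclideanSpace.basisFun (Fin n) ℝ).sum_repr y).symm]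
  simp

lemma rep {n : ℕ} {η ψ : EE n → ℝ} (hη : ContDiff ℝ (⊤ : ℕ∞) η) (hψ : ContDiff ℝ (⊤ : ℕ∞) ψ)
    (hηs : HasCompactSupport η) (hψs : HasCompactSupport ψ)
    (hk : ∀ i y, pd ψ i y = - (y i * η y)) {u : EE n → ℝ} (hu : ContDiff ℝ (⊤ : ℕ∞) u)
    (i : Fin n) (x : EE n) :
    (∫ y, η y) * pd u i x = - (∫ y, pd η i y * u (x + y)) +
      ∫ r in (0:ℝ)..1, ∫ y, pd ψ i y * lap u (x + r • y) := by
  set v := pd u i with hv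
  have hvc : ContDiff ℝ (⊤ : ℕ∞) v := pd_contDiff hu i
  have haff : ∀ r : ℝ, ContDiff ℝ (⊤ : ℕ∞) (fun y : EE n => x + r • y) := fun r =>
    contDiff_const.add (contDiff_id.const_smul r)
  -- boundary term
  have e1 : ∫ y, pd η i y * u (x + y) = - ∫ y, η y * v (x + y) := by
    have h := ibp hη hηs (hu.comp (haff 1)) i
    have h2 : ∀ y, pd (u ∘ fun y : EE n => x + (1:ℝ) • y) i y = v (x + y) := by
      intro y
      have := pd_comp hu x 1 i y
      simpa [Function.comp_def] using this
    simp only [h2] at h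
    simpa using h
  -- interior term
  have e2 : ∀ r : ℝ, ∫ y, η y * fderiv ℝ v (x + r • y) y
      = - ∫ y, pd ψ i y * lap u (x + r • y) := by
    intro r
    have hint : ∀ j, Integrable (fun y => pd ψ j y * pd v j (x + r • y)) := fun j =>
      ((pd_contDiff hψ j).continuous.mul
        ((pd_contDiff hvc j).comp (haff r)).continuous).integrable_of_hasCompactSupport
        (HasCompactSupport.mul_right (hψs.fderiv_apply (𝕜 := ℝ) _))
    have hint2 : ∀ j, Integrable (fun y => ψ y * (r * pd (pd v j) j (x + r • y))) := fun j =>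
      (hψ.continuous.mul (continuous_const.mul
        ((pd_contDiff (pd_contDiff hvc j) j).comp (haff r)).continuous)).integrable_of_hasCompactSupport
        hψs.mul_right
    calc ∫ y, η y * fderiv ℝ v (x + r • y) y
        = ∫ y, ∑ j, - (pd ψ j y * pd v j (x + r • y)) := by
          congr 1; funext y
          rw [fderiv_eq_sum, Finset.mul_sum]
          refine Finset.sum_congr rfl fun j _ => ?_
          rw [hk]; ring
      _ = ∑ j, - ∫ y, pd ψ j y * pd v j (x + r • y) := by
          rw [integral_finsetSum _ fun j _ => (hint j).fun_neg]
          simp only [integral_neg]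
      _ = ∑ j, ∫ y, ψ y * (r * pd (pd v j) j (x + r • y)) := by
          refine Finset.sum_congr rfl fun j _ => ?_
          have h := ibp hψ hψs ((pd_contDiff hvc j).comp (haff r)) j
          simp only [Function.comp_def, pd_comp (pd_contDiff hvc j)] at h
          rw [h, neg_neg]
      _ = ∫ y, ψ y * (r * pd (lap u) i (x + r • y)) := by
          rw [← integral_finsetSum _ fun j _ => hint2 j]
          congr 1; funext y
          rw [← lap_pd hu]
          unfold lap pd2
          rw [Finset.mul_sum, Finset.mul_sum]
      _ = _ := by
          have h := ibp hψ hψs ((lap_contDiff hu).comp (haff r)) i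
          simp only [Function.comp_def, pd_comp (lap_contDiff hu)] at h
          rw [h, neg_neg]
  -- fundamental theorem of calculus
  have hfc : Continuous fun w : EE n × ℝ => fderiv ℝ v (x + w.2 • w.1) w.1 := by
    have h1 : Continuous (fderiv ℝ v) := hvc.continuous_fderiv (by simp)
    exact (h1.comp (by fun_prop)).clm_apply continuous_fst
  have e3 : ∀ y, ∫ r in (0:ℝ)..1, η y * fderiv ℝ v (x + r • y) y = η y * v (x + y) - η y * v x := by
    intro y
    rw [intervalIntegral.integral_const_mul, ← mul_sub]
    congr 1
    have : ∀ r ∈ Set.uIcc (0:ℝ) 1, HasDerivAt (fun r : ℝ => v (x + r • y))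
        (fderiv ℝ v (x + r • y) y) r := by
      intro r _
      have h1 : HasDerivAt (fun r : ℝ => x + r • y) y r := by
        simpa using ((hasDerivAt_id r).smul_const y).const_add x
      exact ((hvc.differentiable (by simp)) (x + r • y)).hasFDerivAt.comp_hasDerivAt r h1
    rw [intervalIntegral.integral_eq_sub_of_hasDerivAt this]
    · simp
    · exact (hfc.comp (by fun_prop : Continuous fun r : ℝ => (y, r))).intervalIntegrable _ _
  have e4 : ∫ y, ∫ r in (0:ℝ)..1, η y * fderiv ℝ v (x + r • y) y =
      ∫ r in (0:ℝ)..1, ∫ y, η y * fderiv ℝ v (x + r • y) y := by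
    simp only [intervalIntegral.integral_of_le zero_le_one]
    rw [integral_integral_swap]
    have hK : IsCompact (tsupport η ×ˢ Set.Icc (0:ℝ) 1) := hηs.isCompact.prod isCompact_Icc
    have hc : Continuous (Function.uncurry fun (y : EE n) (r : ℝ) =>
        η y * fderiv ℝ v (x + r • y) y) := (hη.continuous.comp continuous_fst).mul hfc
    have h1 := hc.continuousOn.integrableOn_compact (μ := (volume : Measure (EE n × ℝ))) hK
    have h2 : IntegrableOn (Function.uncurry fun (y : EE n) (r : ℝ) =>
        η y * fderiv ℝ v (x + r • y) y) (Set.univ ×ˢ Set.Ioc (0:ℝ) 1)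
        (volume : Measure (EE n × ℝ)) := by
      refine h1.of_forall_sdiff_eq_zero (MeasurableSet.univ.prod measurableSet_Ioc) ?_
      rintro ⟨y, r⟩ ⟨⟨_, hr⟩, hn⟩
      have : y ∉ tsupport η := fun hy => hn ⟨hy, Set.Ioc_subset_Icc_self hr⟩
      simp [Function.uncurry, image_eq_zero_of_notMem_tsupport this]
    rw [IntegrableOn, Measure.volume_eq_prod, ← Measure.prod_restrict, Measure.restrict_univ] at h2
    exact h2
  simp only [e3, e2] at e4
  rw [integral_sub, integral_mul_const, intervalIntegral.integral_neg] at e4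
  · rw [e1]; linarith
  · exact (hη.continuous.mul (hvc.continuous.comp (by fun_prop :
      Continuous fun y : EE n => x + y))).integrable_of_hasCompactSupport hηs.mul_right
  · exact (hη.continuous.mul continuous_const).integrable_of_hasCompactSupport hηs.mul_right

lemma term_bound {n : ℕ} {k g : EE n → ℝ} {B : Set (EE n)} (hB : MeasurableSet B) {M : ℝ}
    (hM : ∀ y, |k y| ≤ M) (hk : ∀ y, y ∉ B → k y = 0) :
    ‖∫ y, k y * g y‖ₑ ≤ ENNReal.ofReal M * ∫⁻ y in B, ‖g y‖ₑ := by
  calc ‖∫ y, k y * g y‖ₑ ≤ ∫⁻ y, ‖k y * g y‖ₑ := enorm_integral_le_lintegral_enorm _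
    _ ≤ ∫⁻ y, B.indicator (fun y => ENNReal.ofReal M * ‖g y‖ₑ) y := by
      refine lintegral_mono fun y => ?_
      by_cases hy : y ∈ B
      · rw [Set.indicator_of_mem hy, enorm_mul]
        gcongr
        rw [← ofReal_norm]
        exact ENNReal.ofReal_le_ofReal (hM y)
      · simp [hk y hy]
    _ = _ := by
      rw [lintegral_indicator hB, lintegral_const_mul' _ _ ENNReal.ofReal_ne_top]

lemma pointwise_bound (n : ℕ) (hn : 1 ≤ n) : ∃ (K : ℝ) (B : Set (EE n)), IsCompact B ∧
    ∀ u : EE n → ℝ, ContDiff ℝ (⊤ : ℕ∞) u → ∀ i x,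
      ‖pd u i x‖ₑ ≤ ENNReal.ofReal K * ((∫⁻ y in B, ‖u (x + y)‖ₑ) +
        ∫⁻ w in Set.Ioc (0:ℝ) 1 ×ˢ B, ‖lap u (x + w.1 • w.2)‖ₑ) := by
  obtain ⟨η, ψ, hη, hψ, hηs, hψs, hk, hc⟩ := exists_kernel n hn
  have bd : ∀ a : EE n → ℝ, ContDiff ℝ (⊤ : ℕ∞) a → HasCompactSupport a →
      ∃ M : ℝ, ∀ i y, |pd a i y| ≤ M := by
    intro a ha has
    have : ∀ i, ∃ M : ℝ, ∀ y, |pd a i y| ≤ M := fun i => by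
      obtain ⟨M, hM⟩ := (HasCompactSupport.fderiv_apply (𝕜 := ℝ) has
        (EuclideanSpace.single i (1:ℝ))).exists_bound_of_continuous (pd_contDiff ha i).continuous
      exact ⟨M, hM⟩
    choose M hM using this
    refine ⟨∑ i, |M i|, fun i y => ((hM i y).trans (le_abs_self _)).trans ?_⟩
    exact Finset.single_le_sum (f := fun i => |M i|) (fun j _ => abs_nonneg _) (Finset.mem_univ i)
  obtain ⟨M₁, hM₁⟩ := bd η hη hηs
  obtain ⟨M₂, hM₂⟩ := bd ψ hψ hψs
  set M := max M₁ M₂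
  set c := ∫ y, η y with hcdef
  have hB : IsCompact (tsupport η ∪ tsupport ψ) := hηs.isCompact.union hψs.isCompact
  set B := tsupport η ∪ tsupport ψ
  have z1 : ∀ i y, y ∉ B → pd η i y = 0 := fun i y hy => by
    unfold pd
    rw [fderiv_of_notMem_tsupport ℝ (fun h => hy (Or.inl h))]; rfl
  have z2 : ∀ i y, y ∉ B → pd ψ i y = 0 := fun i y hy => by
    unfold pd
    rw [fderiv_of_notMem_tsupport ℝ (fun h => hy (Or.inr h))]; rfl
  refine ⟨M / c, B, hB, fun u hu i x => ?_⟩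
  have hr := rep hη hψ hηs hψs hk hu i x
  rw [← hcdef] at hr
  have hlc : Continuous (lap u) := (lap_contDiff hu).continuous
  have key : ‖c * pd u i x‖ₑ ≤ ENNReal.ofReal M * ((∫⁻ y in B, ‖u (x + y)‖ₑ) +
        ∫⁻ w in Set.Ioc (0:ℝ) 1 ×ˢ B, ‖lap u (x + w.1 • w.2)‖ₑ) := by
    rw [hr, mul_add]
    refine (enorm_add_le _ _).trans (add_le_add ?_ ?_)
    · rw [enorm_neg]
      exact term_bound hB.measurableSet (fun y => (hM₁ i y).trans (le_max_left _ _)) (z1 i)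
    · rw [intervalIntegral.integral_of_le zero_le_one]
      refine (enorm_integral_le_lintegral_enorm _).trans ?_
      calc _ ≤ ∫⁻ r in Set.Ioc (0:ℝ) 1, ENNReal.ofReal M * ∫⁻ y in B, ‖lap u (x + r • y)‖ₑ :=
            lintegral_mono fun r => term_bound hB.measurableSet
              (fun y => (hM₂ i y).trans (le_max_right _ _)) (z2 i)
        _ = ENNReal.ofReal M * ∫⁻ r in Set.Ioc (0:ℝ) 1, ∫⁻ y in B, ‖lap u (x + r • y)‖ₑ :=
            lintegral_const_mul' _ _ ENNReal.ofReal_ne_top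
        _ = _ := by
            rw [Measure.volume_eq_prod, ← Measure.prod_restrict, lintegral_prod]
            exact (Continuous.measurable (by fun_prop)).aemeasurable
  have h2 : pd u i x = c⁻¹ * (c * pd u i x) := by
    rw [← mul_assoc, inv_mul_cancel₀ hc.ne', one_mul]
  rw [h2, enorm_mul, div_eq_inv_mul, ENNReal.ofReal_mul (inv_pos.2 hc).le, mul_assoc]
  rw [Real.enorm_eq_ofReal (inv_pos.2 hc).le]
  gcongr

lemma lintegral_bound (n : ℕ) (hn : 1 ≤ n) (p : ℝ) (hp : 1 < p) : ∃ C : NNReal,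
    ∀ u : EE n → ℝ, ContDiff ℝ (⊤ : ℕ∞) u →
      ∫⁻ x, ‖gradNorm u x‖ₑ ^ p ≤ C * ((∫⁻ x, ‖u x‖ₑ ^ p) + ∫⁻ x, ‖lap u x‖ₑ ^ p) := by
  obtain ⟨K, B, hB, h⟩ := pointwise_bound n hn
  have hp0 : 0 ≤ p := by linarith
  set K' : ENNReal := n * ENNReal.ofReal K with hK'
  have hK't : K' ≠ ⊤ := ENNReal.mul_ne_top (by simp) ENNReal.ofReal_ne_top
  set ν₁ : Measure (EE n) := volume.restrict B with hν₁
  set ν₂ : Measure (ℝ × EE n) := volume.restrict (Set.Ioc (0:ℝ) 1 ×ˢ B) with hν₂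
  have : IsFiniteMeasure ν₁ := isFiniteMeasure_restrict.2 hB.measure_lt_top.ne
  have : IsFiniteMeasure ν₂ := isFiniteMeasure_restrict.2 <| ne_of_lt <|
    (measure_mono (Set.prod_mono Set.Ioc_subset_Icc_self subset_rfl)).trans_lt
      ((isCompact_Icc (a := (0:ℝ)) (b := 1)).prod hB).measure_lt_top
  set D : ENNReal := K' ^ p * 2 ^ (p - 1) * (ν₁ Set.univ ^ p + ν₂ Set.univ ^ p) with hD
  have hDt : D ≠ ⊤ := by
    refine ENNReal.mul_ne_top (ENNReal.mul_ne_top (ENNReal.rpow_ne_top_of_nonneg hp0 hK't)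
      (ENNReal.rpow_ne_top_of_nonneg (by linarith) (by simp))) (ENNReal.add_ne_top.2 ⟨?_, ?_⟩)
    · exact ENNReal.rpow_ne_top_of_nonneg hp0 (measure_ne_top _ _)
    · exact ENNReal.rpow_ne_top_of_nonneg hp0 (measure_ne_top _ _)
  refine ⟨D.toNNReal, fun u hu => ?_⟩
  rw [ENNReal.coe_toNNReal hDt]
  have hlc : Continuous (lap u) := (lap_contDiff hu).continuous
  have huc : Continuous u := hu.continuous
  set A₁ : EE n → ENNReal := fun x => ∫⁻ y, ‖u (x + y)‖ₑ ∂ν₁ with hA₁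
  set A₂ : EE n → ENNReal := fun x => ∫⁻ w, ‖lap u (x + w.1 • w.2)‖ₑ ∂ν₂ with hA₂
  have hA₁m : Measurable A₁ := by
    refine Measurable.lintegral_prod_right' (f := fun w : EE n × EE n => ‖u (w.1 + w.2)‖ₑ) ?_
    exact Continuous.measurable (by fun_prop)
  have h1 : ∀ x, ‖gradNorm u x‖ₑ ≤ K' * (A₁ x + A₂ x) := by
    intro x
    have hg : gradNorm u x ≤ ∑ i, |pd u i x| := by
      unfold gradNorm
      refine Real.sqrt_le_iff.2 ⟨Finset.sum_nonneg fun i _ => abs_nonneg _, ?_⟩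
      simp only [← sq_abs (pd u _ x)]
      exact Finset.sum_sq_le_sq_sum_of_nonneg fun i _ => abs_nonneg _
    calc ‖gradNorm u x‖ₑ ≤ ENNReal.ofReal (∑ i, |pd u i x|) := by
          rw [Real.enorm_eq_ofReal (show 0 ≤ gradNorm u x from Real.sqrt_nonneg _)]
          exact ENNReal.ofReal_le_ofReal hg
      _ = ∑ i, ‖pd u i x‖ₑ := by
          rw [ENNReal.ofReal_sum_of_nonneg fun i _ => abs_nonneg _]
          simp only [Real.enorm_eq_ofReal_abs]
      _ ≤ ∑ i : Fin n, ENNReal.ofReal K * (A₁ x + A₂ x) := Finset.sum_le_sum fun i _ => h u hu i x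
      _ = _ := by simp [hK', mul_assoc]
  have b1 := Lp_avg ν₁ id measurable_id (fun x => ‖u x‖ₑ) huc.enorm.measurable p hp
  have b2 := Lp_avg ν₂ (fun w => w.1 • w.2) (Continuous.measurable (by fun_prop))
    (fun x => ‖lap u x‖ₑ) hlc.enorm.measurable p hp
  calc ∫⁻ x, ‖gradNorm u x‖ₑ ^ p
      ≤ ∫⁻ x, K' ^ p * 2 ^ (p - 1) * (A₁ x ^ p + A₂ x ^ p) := by
        refine lintegral_mono fun x => ?_
        calc _ ≤ (K' * (A₁ x + A₂ x)) ^ p := ENNReal.rpow_le_rpow (h1 x) hp0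
          _ = K' ^ p * (A₁ x + A₂ x) ^ p := ENNReal.mul_rpow_of_nonneg _ _ hp0
          _ ≤ K' ^ p * (2 ^ (p - 1) * (A₁ x ^ p + A₂ x ^ p)) := by
            gcongr
            exact ENNReal.rpow_add_le_mul_rpow_add_rpow _ _ hp.le
          _ = _ := (mul_assoc _ _ _).symm
    _ = K' ^ p * 2 ^ (p - 1) * ((∫⁻ x, A₁ x ^ p) + ∫⁻ x, A₂ x ^ p) := by
        rw [lintegral_const_mul', lintegral_add_left (hA₁m.pow_const p)]
        exact ENNReal.mul_ne_top (ENNReal.rpow_ne_top_of_nonneg hp0 hK't)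
          (ENNReal.rpow_ne_top_of_nonneg (by linarith) (by simp))
    _ ≤ K' ^ p * 2 ^ (p - 1) * (ν₁ Set.univ ^ p * (∫⁻ x, ‖u x‖ₑ ^ p) +
          ν₂ Set.univ ^ p * ∫⁻ x, ‖lap u x‖ₑ ^ p) := by
        gcongr
        exact b1
    _ ≤ _ := by
        rw [hD, mul_assoc _ (ν₁ Set.univ ^ p + ν₂ Set.univ ^ p), add_mul]
        gcongr
        · exact le_self_add
        · exact le_add_self
/-- `L^p` gradient estimate: for `n ≥ 1` and `1 < p < ∞` there is `C = C(n,p) > 0`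
such that every smooth solution of `Δu = f` with `u, f ∈ L^p(ℝⁿ)` satisfies
`|∇u| ∈ L^p` and `‖∇u‖_p ≤ C(‖u‖_p + ‖f‖_p)`. -/
theorem Lp_gradient_estimate_poisson (n : ℕ) (hn : 1 ≤ n) (p : ℝ) (hp : 1 < p) :
    ∃ C : ℝ, 0 < C ∧ ∀ u f : EuclideanSpace ℝ (Fin n) → ℝ,
      ContDiff ℝ (⊤ : ℕ∞) u → (∀ x, lap u x = f x) →
      Integrable (fun x => |u x| ^ p) → Integrable (fun x => |f x| ^ p) →
      Integrable (fun x => |gradNorm u x| ^ p) ∧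
        lpNorm p (gradNorm u) ≤ C * (lpNorm p u + lpNorm p f) := by
  obtain ⟨C, hC⟩ := lintegral_bound n hn p hp
  have hp0 : 0 < p := by linarith
  refine ⟨(C : ℝ) ^ (1 / p) + 1, by positivity, fun u f hu huf hui hfi => ?_⟩
  obtain rfl : lap u = f := funext huf
  have h := hC u hu
  have conv : ∀ g : EE n → ℝ, ∀ x, ‖g x‖ₑ ^ p = ENNReal.ofReal (|g x| ^ p) := by
    intro g x
    rw [Real.enorm_eq_ofReal_abs, ENNReal.ofReal_rpow_of_nonneg (abs_nonneg _) hp0.le]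
  have nn : ∀ g : EE n → ℝ, 0 ≤ᵐ[volume] fun x => |g x| ^ p := fun g =>
    Filter.Eventually.of_forall fun x => by positivity
  have n0 : ∀ g : EE n → ℝ, 0 ≤ ∫ x, |g x| ^ p := fun g => integral_nonneg_of_ae (nn g)
  simp only [conv] at h
  rw [← ofReal_integral_eq_lintegral_ofReal hui (nn u),
    ← ofReal_integral_eq_lintegral_ofReal hfi (nn _), ← ENNReal.ofReal_add (n0 _) (n0 _),
    ← ENNReal.ofReal_coe_nnreal, ← ENNReal.ofReal_mul C.coe_nonneg] at h
  have hgc : Continuous (gradNorm u) := by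
    unfold gradNorm
    exact Real.continuous_sqrt.comp
      (continuous_finsetSum _ fun i _ => (pd_contDiff hu i).continuous.pow 2)
  have hgi : Integrable (fun x => |gradNorm u x| ^ p) := by
    refine ⟨(hgc.abs.rpow_const fun _ => Or.inr hp0.le).aestronglyMeasurable, ?_⟩
    rw [hasFiniteIntegral_iff_ofReal (nn _)]
    exact h.trans_lt ENNReal.ofReal_lt_top
  refine ⟨hgi, ?_⟩
  rw [← ofReal_integral_eq_lintegral_ofReal hgi (nn _), ENNReal.ofReal_le_ofReal_iff
    (mul_nonneg C.coe_nonneg (add_nonneg (n0 _) (n0 _)))] at h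
  have hq : 0 ≤ 1 / p := by positivity
  have hq1 : 1 / p ≤ 1 := by rw [div_le_one hp0]; exact hp.le
  unfold _root_.lpNorm
  calc _ ≤ ((C : ℝ) * ((∫ x, |u x| ^ p) + ∫ x, |lap u x| ^ p)) ^ (1 / p) :=
        Real.rpow_le_rpow (n0 _) h hq
    _ = (C : ℝ) ^ (1 / p) * ((∫ x, |u x| ^ p) + ∫ x, |lap u x| ^ p) ^ (1 / p) :=
        Real.mul_rpow C.coe_nonneg (add_nonneg (n0 _) (n0 _))
    _ ≤ ((C : ℝ) ^ (1 / p) + 1) *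
        ((∫ x, |u x| ^ p) ^ (1 / p) + (∫ x, |lap u x| ^ p) ^ (1 / p)) := by
        have hs := Real.rpow_nonneg (n0 u) (1 / p)
        have hs' := Real.rpow_nonneg (n0 (lap u)) (1 / p)
        gcongr
        · linarith
        · exact Real.rpow_add_le_add_rpow (n0 _) (n0 _) hq hq1
end

section
/- For every n ≥ 1 and every 1 < p < ∞ there exists a constant C = C(n,p) > 0 such that the following global W^{2,p} regularity holds: if u : ℝⁿ → ℝ is smooth and solves the Poisson equation Δu = f on ℝⁿ with u ∈ L^p(ℝⁿ) and f ∈ L^p(ℝⁿ), then |∇u| ∈ L^p(ℝⁿ), |Hess u| ∈ L^p(ℝⁿ), and ‖∇u‖_{L^p} + ‖Hess u‖_{L^p} ≤ C ( ‖u‖_{L^p} + ‖f‖_{L^p} ). -/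
open MeasureTheory

def Tst {n : ℕ} (f : EuclideanSpace ℝ (Fin n) → ℝ) : Prop :=
  ContDiff ℝ (⊤ : ℕ∞) f ∧ HasCompactSupport f

section prelim
variable {n : ℕ}

lemma smooth_pd {f : EuclideanSpace ℝ (Fin n) → ℝ} (hf : ContDiff ℝ (⊤ : ℕ∞) f) (i : Fin n) :
    ContDiff ℝ (⊤ : ℕ∞) (pd f i) := by
  unfold pd
  exact (hf.fderiv_right (m := (⊤ : ℕ∞)) (by norm_cast)).clm_apply contDiff_const

lemma smooth_pd2 {f : EuclideanSpace ℝ (Fin n) → ℝ} (hf : ContDiff ℝ (⊤ : ℕ∞) f) (i j : Fin n) :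
    ContDiff ℝ (⊤ : ℕ∞) (pd2 f i j) := smooth_pd (smooth_pd hf j) i

lemma smooth_lap {f : EuclideanSpace ℝ (Fin n) → ℝ} (hf : ContDiff ℝ (⊤ : ℕ∞) f) :
    ContDiff ℝ (⊤ : ℕ∞) (lap f) := by
  unfold lap
  exact ContDiff.sum fun i _ => smooth_pd2 hf i i

lemma Tst.pd {f : EuclideanSpace ℝ (Fin n) → ℝ} (hf : Tst f) (i : Fin n) : Tst (pd f i) := by
  refine ⟨smooth_pd hf.1 i, ?_⟩
  unfold _root_.pd
  exact hf.2.fderiv_apply ℝ _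

lemma Tst.pd2 {f : EuclideanSpace ℝ (Fin n) → ℝ} (hf : Tst f) (i j : Fin n) : Tst (pd2 f i j) :=
  (hf.pd j).pd i

lemma Tst.lap {f : EuclideanSpace ℝ (Fin n) → ℝ} (hf : Tst f) : Tst (lap f) := by
  refine ⟨smooth_lap hf.1, ?_⟩
  have : ∀ s : Finset (Fin n), HasCompactSupport (fun x => ∑ i ∈ s, _root_.pd2 f i i x) := by
    intro s
    classical
    induction s using Finset.induction_on with
    | empty => simpa using! (HasCompactSupport.zero : HasCompactSupport (0 : EuclideanSpace ℝ (Fin n) → ℝ))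
    | insert a s ha ih =>
      simp only [Finset.sum_insert ha]
      exact (hf.pd2 a a).2.add ih
  exact this _

lemma Tst.cont {f : EuclideanSpace ℝ (Fin n) → ℝ} (hf : Tst f) : Continuous f := hf.1.continuous

lemma Tst.diff {f : EuclideanSpace ℝ (Fin n) → ℝ} (hf : Tst f) : Differentiable ℝ f :=
  hf.1.differentiable (by norm_num)

lemma Tst.bdd {f : EuclideanSpace ℝ (Fin n) → ℝ} (hf : Tst f) : ∃ C, ∀ x, ‖f x‖ ≤ C :=
  hf.2.exists_bound_of_continuous hf.cont

lemma Tst.integrable {f : EuclideanSpace ℝ (Fin n) → ℝ} (hf : Tst f) : Integrable f :=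
  hf.cont.integrable_of_hasCompactSupport hf.2

lemma cs_abs_rpow {f : EuclideanSpace ℝ (Fin n) → ℝ} (hf : HasCompactSupport f) {p : ℝ}
    (hp : 0 < p) : HasCompactSupport (fun x => |f x| ^ p) := by
  refine hf.comp_left (g := fun y : ℝ => |y| ^ p) ?_
  simp [Real.zero_rpow hp.ne']

lemma cont_abs_rpow {X : Type*} [TopologicalSpace X] {f : X → ℝ} (hf : Continuous f) {p : ℝ}
    (hp : 0 < p) : Continuous (fun x => |f x| ^ p) :=
  hf.abs.rpow_const fun _ => Or.inr hp.le

lemma Tst.integrable_rpow {f : EuclideanSpace ℝ (Fin n) → ℝ} (hf : Tst f) {p : ℝ}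
    (hp : 0 < p) : Integrable (fun x => |f x| ^ p) :=
  (cont_abs_rpow hf.cont hp).integrable_of_hasCompactSupport (cs_abs_rpow hf.2 hp)

lemma Tst.shift {f : EuclideanSpace ℝ (Fin n) → ℝ} (hf : Tst f) (y : EuclideanSpace ℝ (Fin n)) :
    Tst (fun x => f (x + y)) :=
  ⟨hf.1.comp (contDiff_id.add contDiff_const), hf.2.comp_homeomorph (Homeomorph.addRight y)⟩

lemma pd_shift (f : EuclideanSpace ℝ (Fin n) → ℝ) (y : EuclideanSpace ℝ (Fin n)) (i : Fin n) :
    pd (fun x => f (x + y)) i = fun x => pd f i (x + y) := by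
  funext x
  simp only [pd, fderiv_comp_add_right]

lemma lap_shift (f : EuclideanSpace ℝ (Fin n) → ℝ) (y : EuclideanSpace ℝ (Fin n)) :
    lap (fun x => f (x + y)) = fun x => lap f (x + y) := by
  funext x
  simp only [lap, pd2, pd_shift]

lemma ibp_cs {χ v : EuclideanSpace ℝ (Fin n) → ℝ} (hχ : Tst χ) (i : Fin n)
    (hv : Differentiable ℝ v) (hv' : Continuous (pd v i)) :
    ∫ x, χ x * pd v i x = - ∫ x, pd χ i x * v x := by
  have := integral_mul_fderiv_eq_neg_fderiv_mul_of_integrable (μ := (volume : Measure (EuclideanSpace ℝ (Fin n))))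
    (f := χ) (g := v) (v := EuclideanSpace.single i 1) ?_ ?_ ?_ (fun x _ => hχ.diff x) (fun x _ => hv x)
  · exact this
  · exact ((hχ.pd i).cont.mul hv.continuous).integrable_of_hasCompactSupport ((hχ.pd i).2.mul_right)
  · exact (hχ.cont.mul hv').integrable_of_hasCompactSupport (hχ.2.mul_right)
  · exact (hχ.cont.mul hv.continuous).integrable_of_hasCompactSupport (hχ.2.mul_right)

lemma ibp_pd2 {χ v : EuclideanSpace ℝ (Fin n) → ℝ} (hχ : Tst χ) (i j : Fin n)
    (hv : ContDiff ℝ (⊤ : ℕ∞) v) :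
    ∫ x, χ x * pd2 v i j x = ∫ x, pd2 χ j i x * v x := by
  have h1 := ibp_cs hχ i ((smooth_pd hv j).differentiable (by norm_num)) (smooth_pd2 hv i j).continuous
  have h2 := ibp_cs (hχ.pd i) j (hv.differentiable (by norm_num)) (smooth_pd hv j).continuous
  have h1' : ∫ x, χ x * pd2 v i j x = - ∫ x, pd χ i x * pd v j x := h1
  rw [h1', h2, neg_neg]; rfl

lemma ibp_lap {χ v : EuclideanSpace ℝ (Fin n) → ℝ} (hχ : Tst χ)
    (hv : ContDiff ℝ (⊤ : ℕ∞) v) :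
    ∫ x, χ x * lap v x = ∫ x, lap χ x * v x := by
  simp only [lap, Finset.mul_sum, Finset.sum_mul]
  rw [integral_finsetSum, integral_finsetSum]
  · exact Finset.sum_congr rfl fun i _ => ibp_pd2 hχ i i hv
  · intro i _
    exact ((hχ.pd2 i i).cont.mul hv.continuous).integrable_of_hasCompactSupport ((hχ.pd2 i i).2.mul_right)
  · intro i _
    exact (hχ.cont.mul (smooth_pd2 hv i i).continuous).integrable_of_hasCompactSupport (hχ.2.mul_right)

/-- averaging operator -/
noncomputable def Av (μ : Measure (EuclideanSpace ℝ (Fin n))) (ψ : EuclideanSpace ℝ (Fin n) → ℝ)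
    (x : EuclideanSpace ℝ (Fin n)) : ℝ := ∫ y, ψ (x + y) ∂μ

variable {μ : Measure (EuclideanSpace ℝ (Fin n))} [IsProbabilityMeasure μ]

lemma integrable_of_bdd {X : Type*} [MeasurableSpace X] [TopologicalSpace X] [OpensMeasurableSpace X]
    {ν : Measure X} [IsFiniteMeasure ν] {ψ : X → ℝ} (hc : Continuous ψ) {C : ℝ}
    (hb : ∀ x, ‖ψ x‖ ≤ C) : Integrable ψ ν :=
  Integrable.of_bound hc.measurable.aestronglyMeasurable C (Filter.Eventually.of_forall hb)

lemma Av_cont {ψ : EuclideanSpace ℝ (Fin n) → ℝ} (hc : Continuous ψ) {C : ℝ}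
    (hb : ∀ x, ‖ψ x‖ ≤ C) : Continuous (Av μ ψ) := by
  unfold Av
  refine continuous_of_dominated (bound := fun _ => C) ?_ ?_ (integrable_const _) ?_
  · intro x; exact (hc.comp (continuous_const.add continuous_id)).aestronglyMeasurable
  · intro x; exact Filter.Eventually.of_forall fun y => hb _
  · exact Filter.Eventually.of_forall fun y => hc.comp (continuous_id.add continuous_const)

lemma Av_bdd {ψ : EuclideanSpace ℝ (Fin n) → ℝ} {C : ℝ}
    (hb : ∀ x, ‖ψ x‖ ≤ C) (x) : ‖Av μ ψ x‖ ≤ C := by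
  unfold Av
  have := norm_integral_le_of_norm_le_const (μ := μ) (f := fun y => ψ (x + y)) (C := C)
    (Filter.Eventually.of_forall fun y => hb _)
  simpa using this

lemma Av_hasFDerivAt {ψ : EuclideanSpace ℝ (Fin n) → ℝ} (hψ : Tst ψ) (x) :
    HasFDerivAt (Av μ ψ) (∫ y, fderiv ℝ ψ (x + y) ∂μ) x ∧
      Integrable (fun y => fderiv ℝ ψ (x + y)) μ := by
  have hcf : Continuous (fderiv ℝ ψ) := hψ.1.continuous_fderiv (by norm_num)
  obtain ⟨C, hC⟩ := (hψ.2.fderiv ℝ).exists_bound_of_continuous hcf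
  obtain ⟨D, hD⟩ := hψ.bdd
  have hint : Integrable (fun y => fderiv ℝ ψ (x + y)) μ :=
    Integrable.of_bound (hcf.comp (continuous_const.add continuous_id)).aestronglyMeasurable C
      (Filter.Eventually.of_forall fun _ => hC _)
  refine ⟨?_, hint⟩
  unfold Av
  refine hasFDerivAt_integral_of_dominated_of_fderiv_le (bound := fun _ => C)
    (F' := fun x y => fderiv ℝ ψ (x + y)) Filter.univ_mem ?_ ?_ ?_ ?_ (integrable_const _) ?_
  · exact Filter.Eventually.of_forall fun x =>
      (hψ.cont.comp (continuous_const.add continuous_id)).aestronglyMeasurable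
  · exact integrable_of_bdd (hψ.cont.comp (continuous_const.add continuous_id)) (C := D) fun _ => hD _
  · exact hint.1
  · exact Filter.Eventually.of_forall fun y x _ => hC _
  · refine Filter.Eventually.of_forall fun y x _ => ?_
    have := (hψ.diff (x + y)).hasFDerivAt
    exact (hasFDerivAt_comp_add_right (𝕜 := ℝ) (f := ψ) (x := x) y).2 this

lemma Av_diff {ψ : EuclideanSpace ℝ (Fin n) → ℝ} (hψ : Tst ψ) : Differentiable ℝ (Av μ ψ) :=
  fun x => (Av_hasFDerivAt hψ x).1.differentiableAt

lemma pd_Av {ψ : EuclideanSpace ℝ (Fin n) → ℝ} (hψ : Tst ψ) (i : Fin n) :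
    pd (Av μ ψ) i = Av μ (pd ψ i) := by
  funext x
  have h := Av_hasFDerivAt (μ := μ) hψ x
  unfold pd
  rw [h.1.fderiv, ContinuousLinearMap.integral_apply h.2]
  rfl

lemma int_shift {F : EuclideanSpace ℝ (Fin n) → ℝ} (hc : Continuous F) (hF : Integrable F) :
    Integrable (fun z : EuclideanSpace ℝ (Fin n) × EuclideanSpace ℝ (Fin n) => F (z.1 + z.2))
      (volume.prod μ) := by
  have hm : AEStronglyMeasurable (fun z : EuclideanSpace ℝ (Fin n) × EuclideanSpace ℝ (Fin n) =>
      F (z.1 + z.2)) (volume.prod μ) :=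
    (hc.comp (continuous_fst.add continuous_snd)).aestronglyMeasurable
  rw [integrable_prod_iff' hm]
  refine ⟨Filter.Eventually.of_forall fun y => hF.comp_add_right y, ?_⟩
  have : (fun y : EuclideanSpace ℝ (Fin n) => ∫ x, ‖F (x + y)‖) = fun _ => ∫ x, ‖F x‖ := by
    funext y
    exact integral_add_right_eq_self (fun x => ‖F x‖) y
  simp only [this]
  exact integrable_const _

lemma integral_int_shift {F : EuclideanSpace ℝ (Fin n) → ℝ} (hc : Continuous F) (hF : Integrable F) :
    ∫ x, (∫ y, F (x + y) ∂μ) = ∫ x, F x := by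
  rw [integral_integral_swap (f := fun x y => F (x + y)) (int_shift hc hF)]
  simp only [integral_add_right_eq_self]
  simp

lemma Av_rpow_le {ψ : EuclideanSpace ℝ (Fin n) → ℝ} (hψ : Tst ψ) {p : ℝ} (hp : 1 ≤ p) (x) :
    |Av μ ψ x| ^ p ≤ ∫ y, |ψ (x + y)| ^ p ∂μ := by
  obtain ⟨D, hD⟩ := hψ.bdd
  have hcx : Continuous fun y => ψ (x + y) := hψ.cont.comp (continuous_const.add continuous_id)
  have h1 : |Av μ ψ x| ≤ ∫ y, |ψ (x + y)| ∂μ := abs_integral_le_integral_abs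
  have h2 := (convexOn_rpow hp).map_integral_le (μ := μ) (f := fun y => |ψ (x + y)|)
    (by exact (continuous_id.rpow_const fun _ => Or.inr (by linarith)).continuousOn) isClosed_Ici
    (Filter.Eventually.of_forall fun y => Set.mem_Ici.2 (abs_nonneg _))
    (integrable_of_bdd hcx.abs (C := D) fun y => by simpa using hD (x + y))
    (integrable_of_bdd (cont_abs_rpow hcx (by linarith)) (C := D ^ p) fun y => by
      simp only [Function.comp, Real.norm_eq_abs]
      rw [abs_of_nonneg (by positivity)]
      exact Real.rpow_le_rpow (abs_nonneg _) (hD _) (by linarith))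
  exact (Real.rpow_le_rpow (abs_nonneg _) h1 (by linarith)).trans h2

lemma Av_Lp {ψ : EuclideanSpace ℝ (Fin n) → ℝ} (hψ : Tst ψ) {p : ℝ} (hp : 1 ≤ p) :
    Integrable (fun x => |Av μ ψ x| ^ p) ∧ ∫ x, |Av μ ψ x| ^ p ≤ ∫ x, |ψ x| ^ p := by
  have hp0 : 0 < p := by linarith
  obtain ⟨D, hD⟩ := hψ.bdd
  have hcp := cont_abs_rpow hψ.cont hp0
  have hI := (int_shift (μ := μ) hcp (hψ.integrable_rpow hp0)).integral_prod_left
  have hI1 : Integrable (fun x => |Av μ ψ x| ^ p) := by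
    refine hI.mono' (cont_abs_rpow (Av_cont hψ.cont hD) hp0).aestronglyMeasurable
      (Filter.Eventually.of_forall fun x => ?_)
    rw [Real.norm_eq_abs, abs_of_nonneg (by positivity)]
    exact Av_rpow_le hψ hp x
  refine ⟨hI1, ?_⟩
  rw [← integral_int_shift (μ := μ) hcp (hψ.integrable_rpow hp0)]
  exact integral_mono hI1 hI fun x => Av_rpow_le hψ hp x

lemma int_mul_shift {u ψ : EuclideanSpace ℝ (Fin n) → ℝ} (hu : Continuous u) {p q : ℝ}
    (hpq : p.HolderConjugate q)
    (hup : Integrable fun x => |u x| ^ p) (hψ : Tst ψ) :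
    Integrable (fun z : EuclideanSpace ℝ (Fin n) × EuclideanSpace ℝ (Fin n) => u z.1 * ψ (z.1 + z.2))
      (volume.prod μ) := by
  have h1 : Integrable (fun z : EuclideanSpace ℝ (Fin n) × EuclideanSpace ℝ (Fin n) => |u z.1| ^ p)
    (volume.prod μ) := by
    simpa using hup.mul_prod (integrable_const (1 : ℝ) (μ := μ))
  have h2 := int_shift (μ := μ) (cont_abs_rpow hψ.cont hpq.symm.pos) (hψ.integrable_rpow hpq.symm.pos)
  refine ((h1.div_const p).add (h2.div_const q)).mono' ?_ (Filter.Eventually.of_forall fun z => ?_)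
  · exact ((hu.comp continuous_fst).mul (hψ.cont.comp (continuous_fst.add continuous_snd))).aestronglyMeasurable
  · rw [Real.norm_eq_abs, abs_mul]
    have := Real.young_inequality_of_nonneg (abs_nonneg (u z.1)) (abs_nonneg (ψ (z.1 + z.2))) hpq
    simpa using this

lemma Av_dual {u : EuclideanSpace ℝ (Fin n) → ℝ} (hu : ContDiff ℝ (⊤ : ℕ∞) u) {p q : ℝ}
    (hpq : p.HolderConjugate q)
    (hup : Integrable fun x => |u x| ^ p) (hfp : Integrable fun x => |lap u x| ^ p)
    {ψ : EuclideanSpace ℝ (Fin n) → ℝ} (hψ : Tst ψ) :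
    ∫ x, u x * Av μ (lap ψ) x = ∫ x, lap u x * Av μ ψ x := by
  have e1 := integral_integral_swap (f := fun x y => u x * lap ψ (x + y)) (int_mul_shift (μ := μ) hu.continuous hpq hup hψ.lap)
  have e2 := integral_integral_swap (f := fun x y => lap u x * ψ (x + y)) (int_mul_shift (μ := μ) (smooth_lap hu).continuous hpq hfp hψ)
  simp only [Av, ← integral_const_mul]
  rw [e1, e2]
  congr 1
  funext y
  have := ibp_lap (hψ.shift y) hu
  rw [lap_shift] at this
  simp only [mul_comm (u _), mul_comm (lap u _)]
  exact this.symm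

end prelim

section gauss
variable {n : ℕ}

lemma gauss_int {b : ℝ} (hb : 0 < b) :
    Integrable fun z : EuclideanSpace ℝ (Fin n) => Real.exp (-b * ‖z‖ ^ 2) := by
  have := GaussianFourier.integrable_cexp_neg_mul_sq_norm_add (V := EuclideanSpace ℝ (Fin n))
    (b := (b : ℂ)) (by simpa using hb) 0 0
  refine this.norm.congr (Filter.Eventually.of_forall fun z => ?_)
  simp only [zero_mul, add_zero, Complex.norm_exp]
  norm_cast

noncomputable def gc (n : ℕ) : ℝ := (∫ z : EuclideanSpace ℝ (Fin n), Real.exp (-(1/2) * ‖z‖ ^ 2))⁻¹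

lemma gc_pos (n : ℕ) : 0 < gc n := by
  unfold gc
  rw [inv_pos, GaussianFourier.integral_rexp_neg_mul_sq_norm (by norm_num)]
  positivity

noncomputable def gd (z : EuclideanSpace ℝ (Fin n)) : ℝ := gc n * Real.exp (-(1/2) * ‖z‖ ^ 2)

lemma gd_pos (z : EuclideanSpace ℝ (Fin n)) : 0 < gd z := mul_pos (gc_pos n) (Real.exp_pos _)

lemma gd_cont : Continuous (gd (n := n)) := by unfold gd; fun_prop

lemma gd_int : Integrable (gd (n := n)) := (gauss_int (by norm_num)).const_mul _

lemma gd_int_norm : Integrable fun z : EuclideanSpace ℝ (Fin n) => ‖z‖ * gd z := by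
  refine ((gauss_int (n := n) (b := 1/4) (by norm_num)).const_mul (gc n)).mono'
    (continuous_norm.mul gd_cont).aestronglyMeasurable (Filter.Eventually.of_forall fun z => ?_)
  rw [Real.norm_of_nonneg (mul_nonneg (norm_nonneg _) (gd_pos z).le)]
  unfold gd
  have h1 : ‖z‖ ≤ Real.exp (1/4 * ‖z‖ ^ 2) := by
    have := Real.add_one_le_exp (1/4 * ‖z‖ ^ 2)
    nlinarith [sq_nonneg (‖z‖ / 2 - 1)]
  have h2 : Real.exp (-(1/4) * ‖z‖ ^ 2) = Real.exp (1/4 * ‖z‖ ^ 2) * Real.exp (-(1/2) * ‖z‖ ^ 2) := by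
    rw [← Real.exp_add]; congr 1; ring
  rw [h2]
  have := (gc_pos n).le
  have h3 := (Real.exp_pos (-(1/2) * ‖z‖ ^ 2)).le
  calc ‖z‖ * (gc n * Real.exp (-(1/2) * ‖z‖ ^ 2)) = gc n * (‖z‖ * Real.exp (-(1/2) * ‖z‖ ^ 2)) := by ring
    _ ≤ _ := by gcongr

noncomputable def gm (n : ℕ) : Measure (EuclideanSpace ℝ (Fin n)) :=
  volume.withDensity fun z => ENNReal.ofReal (gd z)

lemma integral_gm (F : EuclideanSpace ℝ (Fin n) → ℝ) : ∫ z, F z ∂(gm n) = ∫ z, gd z * F z := by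
  unfold gm
  rw [integral_withDensity_eq_integral_toReal_smul (by exact gd_cont.measurable.ennreal_ofReal)
    (Filter.Eventually.of_forall fun z => ENNReal.ofReal_lt_top)]
  congr 1; funext z
  rw [ENNReal.toReal_ofReal (gd_pos z).le, smul_eq_mul]

instance gm_prob : IsProbabilityMeasure (gm n) := by
  constructor
  unfold gm
  rw [withDensity_apply _ MeasurableSet.univ, Measure.restrict_univ,
    ← ofReal_integral_eq_lintegral_ofReal gd_int (Filter.Eventually.of_forall fun z => (gd_pos z).le)]
  unfold gd
  rw [integral_const_mul, gc, inv_mul_cancel₀, ENNReal.ofReal_one]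
  have := gc_pos n
  unfold gc at this
  exact (inv_pos.1 this).ne'

lemma gm_int_norm : Integrable (fun z : EuclideanSpace ℝ (Fin n) => ‖z‖) (gm n) := by
  unfold gm
  rw [integrable_withDensity_iff_integrable_smul' (by exact gd_cont.measurable.ennreal_ofReal)
    (Filter.Eventually.of_forall fun z => ENNReal.ofReal_lt_top)]
  refine gd_int_norm.congr (Filter.Eventually.of_forall fun z => ?_)
  simp only [ENNReal.toReal_ofReal (gd_pos z).le, smul_eq_mul, mul_comm]

lemma gd_deriv (z : EuclideanSpace ℝ (Fin n)) (i : Fin n) :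
    DifferentiableAt ℝ gd z ∧ pd gd i z = - (z i * gd z) := by
  have h1 : HasFDerivAt (fun z : EuclideanSpace ℝ (Fin n) => ‖z‖ ^ 2) (2 • innerSL ℝ z) z :=
    (hasStrictFDerivAt_norm_sq z).hasFDerivAt
  have h2 := ((h1.const_mul (-(1/2) : ℝ)).exp).const_mul (gc n)
  refine ⟨h2.differentiableAt, ?_⟩
  unfold pd
  have h3 : HasFDerivAt (gd (n := n)) _ z := h2
  rw [h3.fderiv]
  simp [gd, EuclideanSpace.inner_single_right]
  ring

lemma stein {F : EuclideanSpace ℝ (Fin n) → ℝ} (i : Fin n) (hF : Differentiable ℝ F) {C : ℝ}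
    (hC : ∀ x, ‖F x‖ ≤ C) (hF' : Continuous (pd F i)) {D : ℝ} (hD : ∀ x, ‖pd F i x‖ ≤ D) :
    ∫ z, z i * F z ∂(gm n) = ∫ z, pd F i z ∂(gm n) := by
  have hgc : Continuous (pd (gd (n := n)) i) := by
    have : pd (gd (n := n)) i = fun z => - (z i * gd z) := by funext z; exact (gd_deriv z i).2
    rw [this]
    have := gd_cont (n := n)
    fun_prop
  have := integral_mul_fderiv_eq_neg_fderiv_mul_of_integrable
    (μ := (volume : Measure (EuclideanSpace ℝ (Fin n))))
    (f := gd) (g := F) (v := EuclideanSpace.single i 1) ?_ ?_ ?_ (fun x _ => (gd_deriv x i).1) (fun x _ => hF x)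
  · rw [integral_gm, integral_gm]
    refine Eq.trans ?_ this.symm
    rw [← integral_neg]
    congr 1; funext z
    have := (gd_deriv z i).2
    unfold pd at this
    rw [this]; ring
  · refine Integrable.mul_bdd (f := fun x => pd gd i x) (c := C) ?_ hF.continuous.aestronglyMeasurable
      (Filter.Eventually.of_forall hC)
    refine gd_int_norm.mono' hgc.aestronglyMeasurable (Filter.Eventually.of_forall fun z => ?_)
    rw [(gd_deriv z i).2, norm_neg, norm_mul, Real.norm_of_nonneg (gd_pos z).le]
    exact mul_le_mul_of_nonneg_right (PiLp.norm_apply_le z i) (gd_pos z).le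
  · exact gd_int.mul_bdd (c := D) hF'.aestronglyMeasurable (Filter.Eventually.of_forall hD)
  · exact gd_int.mul_bdd (c := C) hF.continuous.aestronglyMeasurable (Filter.Eventually.of_forall hC)

/-- law of `ρ z` -/
noncomputable def gam (n : ℕ) (ρ : ℝ) : Measure (EuclideanSpace ℝ (Fin n)) :=
  (gm n).map fun z => ρ • z

instance gam_prob (ρ : ℝ) : IsProbabilityMeasure (gam n ρ) :=
  Measure.isProbabilityMeasure_map (by fun_prop)

lemma integral_gam {F : EuclideanSpace ℝ (Fin n) → ℝ} (hF : Continuous F) (ρ : ℝ) :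
    ∫ y, F y ∂(gam n ρ) = ∫ z, F (ρ • z) ∂(gm n) := by
  unfold gam
  rw [integral_map (by fun_prop) hF.aestronglyMeasurable]

noncomputable def He (ρ : ℝ) (f : EuclideanSpace ℝ (Fin n) → ℝ) : EuclideanSpace ℝ (Fin n) → ℝ :=
  Av (gam n ρ) f

lemma He_eq {f : EuclideanSpace ℝ (Fin n) → ℝ} (hf : Continuous f) (ρ : ℝ) (x) :
    He ρ f x = ∫ z, f (x + ρ • z) ∂(gm n) := by
  unfold He Av
  rw [integral_gam (F := fun y => f (x + y)) (by fun_prop)]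

lemma He_cont {f : EuclideanSpace ℝ (Fin n) → ℝ} (hf : Continuous f) {C : ℝ} (hC : ∀ x, ‖f x‖ ≤ C) :
    Continuous fun z : ℝ × EuclideanSpace ℝ (Fin n) => He z.1 f z.2 := by
  simp only [He_eq hf]
  refine continuous_of_dominated (bound := fun _ => C) ?_ ?_ (integrable_const _) ?_
  · intro x; exact (hf.comp (by fun_prop)).aestronglyMeasurable
  · intro x; exact Filter.Eventually.of_forall fun y => hC _
  · exact Filter.Eventually.of_forall fun y => hf.comp (by fun_prop)

lemma gam_neg {F : EuclideanSpace ℝ (Fin n) → ℝ} (hF : Continuous F) (ρ : ℝ) :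
    ∫ y, F (-y) ∂(gam n ρ) = ∫ y, F y ∂(gam n ρ) := by
  rw [integral_gam hF, integral_gam (F := fun y => F (-y)) (by fun_prop), integral_gm, integral_gm,
    ← integral_neg_eq_self]
  congr 1; funext z; simp [gd]

lemma int_sym {h φ : EuclideanSpace ℝ (Fin n) → ℝ} (hh : Tst h) (hφ : Continuous φ) {C : ℝ}
    (hC : ∀ x, ‖φ x‖ ≤ C) (μ : Measure (EuclideanSpace ℝ (Fin n))) [IsProbabilityMeasure μ] :
    Integrable (fun z : EuclideanSpace ℝ (Fin n) × EuclideanSpace ℝ (Fin n) => h z.1 * φ (z.1 + z.2))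
      (volume.prod μ) ∧
    Integrable (fun z : EuclideanSpace ℝ (Fin n) × EuclideanSpace ℝ (Fin n) => h (z.1 + z.2) * φ z.1)
      (volume.prod μ) := by
  constructor
  · refine Integrable.mul_bdd (f := fun z : EuclideanSpace ℝ (Fin n) × EuclideanSpace ℝ (Fin n) => h z.1)
      (c := C) ?_ (hφ.comp (continuous_fst.add continuous_snd)).aestronglyMeasurable
      (Filter.Eventually.of_forall fun z => hC _)
    simpa using hh.integrable.mul_prod (integrable_const (1 : ℝ) (μ := μ))
  · exact (int_shift (μ := μ) hh.cont hh.integrable).mul_bdd (c := C)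
      (hφ.comp continuous_fst).aestronglyMeasurable (Filter.Eventually.of_forall fun z => hC _)

lemma He_symm {h φ : EuclideanSpace ℝ (Fin n) → ℝ} (hh : Tst h) (hφ : Continuous φ) {C : ℝ}
    (hC : ∀ x, ‖φ x‖ ≤ C) (ρ : ℝ) : ∫ x, h x * He ρ φ x = ∫ x, He ρ h x * φ x := by
  have hi := int_sym hh hφ hC (gam n ρ)
  unfold He Av
  simp only [← integral_const_mul, ← integral_mul_const]
  rw [integral_integral_swap (f := fun x y => h x * φ (x + y)) hi.1,
    integral_integral_swap (f := fun x y => h (x + y) * φ x) hi.2]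
  have hcont : Continuous fun y => ∫ x, h (x + y) * φ x := by
    have : (fun y => ∫ x, h (x + y) * φ x) = fun y => ∫ x, h x * φ (x - y) := by
      funext y
      rw [← integral_add_right_eq_self (fun x => h x * φ (x - y)) y]
      simp
    rw [this]
    refine continuous_of_dominated (bound := fun x => ‖h x‖ * C) ?_ ?_ (hh.integrable.norm.mul_const C) ?_
    · intro y; exact (hh.cont.mul (hφ.comp (by fun_prop))).aestronglyMeasurable
    · intro y; refine Filter.Eventually.of_forall fun x => ?_
      rw [norm_mul]; exact mul_le_mul_of_nonneg_left (hC _) (norm_nonneg _)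
    · exact Filter.Eventually.of_forall fun x => continuous_const.mul (hφ.comp (by fun_prop))
  rw [← gam_neg hcont]
  congr 1; funext y
  rw [← integral_add_right_eq_self (fun x => h (x + -y) * φ x) y]
  simp

/-- derivative in ρ -/
lemma fderiv_coord (f : EuclideanSpace ℝ (Fin n) → ℝ) (x z) :
    fderiv ℝ f x z = ∑ i, z i * pd f i x := by
  have : z = ∑ i, z i • EuclideanSpace.single i (1 : ℝ) := by
    ext j
    simp [Finset.sum_apply, Pi.single_apply]
  conv_lhs => rw [this]
  simp only [map_sum, map_smul, smul_eq_mul, pd]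

lemma gauss_ibp {f : EuclideanSpace ℝ (Fin n) → ℝ} (hf : Tst f) (ρ : ℝ) (x) :
    ∫ z, fderiv ℝ f (x + ρ • z) z ∂(gm n) = ρ * He ρ (lap f) x := by
  rw [He_eq hf.lap.cont]
  have hint : ∀ i : Fin n, Integrable (fun z : EuclideanSpace ℝ (Fin n) => z i * pd f i (x + ρ • z)) (gm n) := by
    intro i
    obtain ⟨C, hC⟩ := (hf.pd i).bdd
    have hz : Integrable (fun z : EuclideanSpace ℝ (Fin n) => z i) (gm n) :=
      gm_int_norm.mono' (by fun_prop) (Filter.Eventually.of_forall fun z => PiLp.norm_apply_le z i)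
    exact hz.mul_bdd (c := C) ((hf.pd i).cont.comp (f := fun z => x + ρ • z) (by fun_prop)).aestronglyMeasurable
      (Filter.Eventually.of_forall fun z => hC _)
  simp only [fderiv_coord]
  rw [integral_finsetSum _ fun i _ => hint i, ← integral_const_mul]
  simp only [lap, Finset.mul_sum]
  rw [integral_finsetSum]
  · refine Finset.sum_congr rfl fun i _ => ?_
    obtain ⟨C, hC⟩ := (hf.pd i).bdd
    obtain ⟨D, hD⟩ := (hf.pd2 i i).bdd
    have hder : ∀ z, HasFDerivAt (fun z => pd f i (x + ρ • z)) (ρ • fderiv ℝ (pd f i) (x + ρ • z)) z := by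
      intro z
      have h1 : HasFDerivAt (fun z : EuclideanSpace ℝ (Fin n) => x + ρ • z)
          (ρ • ContinuousLinearMap.id ℝ _) z :=
        ((hasFDerivAt_id z).const_smul ρ).const_add x
      have h2 := ((hf.pd i).diff (x + ρ • z)).hasFDerivAt.comp z h1
      convert! h2 using 1
      ext v; simp
    have hpd : pd (fun z => pd f i (x + ρ • z)) i = fun z => ρ * pd2 f i i (x + ρ • z) := by
      funext z
      have := (hder z).fderiv
      unfold pd at this ⊢
      rw [this]; rfl
    have := stein (F := fun z => pd f i (x + ρ • z)) i (fun z => (hder z).differentiableAt)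
      (C := C) (fun z => hC _) (by
        rw [hpd]; exact continuous_const.mul ((hf.pd2 i i).cont.comp (by fun_prop)))
      (D := |ρ| * D) (by
        intro z; rw [hpd, norm_mul]; exact mul_le_mul_of_nonneg_left (hD _) (abs_nonneg _))
    rw [this, hpd]
  · intro i _
    obtain ⟨D, hD⟩ := (hf.pd2 i i).bdd
    exact (integrable_of_bdd ((hf.pd2 i i).cont.comp (by fun_prop)) (C := D) fun z => hD _).const_mul ρ

lemma ray_deriv {f : EuclideanSpace ℝ (Fin n) → ℝ} (hf : Tst f) (x z) (ρ : ℝ) :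
    HasDerivAt (fun ρ : ℝ => f (x + ρ • z)) (fderiv ℝ f (x + ρ • z) z) ρ := by
  have h1 : HasDerivAt (fun ρ : ℝ => x + ρ • z) z ρ := by
    simpa using ((hasDerivAt_id ρ).smul_const z).const_add x
  exact (hf.diff (x + ρ • z)).hasFDerivAt.comp_hasDerivAt ρ h1

lemma gen_deriv {Ω : Type*} [MeasurableSpace Ω] [TopologicalSpace Ω] [OpensMeasurableSpace Ω]
    {P : Measure Ω} [IsProbabilityMeasure P] {Z : Ω → EuclideanSpace ℝ (Fin n)} (hZ : Continuous Z)
    (hZi : Integrable (fun ω => ‖Z ω‖) P) [SecondCountableTopology Ω]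
    {f : EuclideanSpace ℝ (Fin n) → ℝ} (hf : Tst f) (ρ : ℝ) (x) :
    Integrable (fun ω => fderiv ℝ f (x + ρ • Z ω) (Z ω)) P ∧
    HasDerivAt (fun ρ => ∫ ω, f (x + ρ • Z ω) ∂P) (∫ ω, fderiv ℝ f (x + ρ • Z ω) (Z ω) ∂P) ρ := by
  have hcf : Continuous (fderiv ℝ f) := hf.1.continuous_fderiv (by norm_num)
  obtain ⟨C, hC⟩ := (hf.2.fderiv ℝ).exists_bound_of_continuous hcf
  obtain ⟨D, hD⟩ := hf.bdd
  refine hasDerivAt_integral_of_dominated_loc_of_deriv_le (bound := fun ω => C * ‖Z ω‖)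
    (F' := fun ρ ω => fderiv ℝ f (x + ρ • Z ω) (Z ω)) Filter.univ_mem ?_ ?_ ?_ ?_ (hZi.const_mul C) ?_
  · exact Filter.Eventually.of_forall fun ρ => (hf.cont.comp (by fun_prop)).aestronglyMeasurable
  · exact integrable_of_bdd (hf.cont.comp (by fun_prop)) (C := D) fun _ => hD _
  · exact ((hcf.comp (by fun_prop)).clm_apply hZ).aestronglyMeasurable
  · refine Filter.Eventually.of_forall fun ω ρ _ => ?_
    exact (ContinuousLinearMap.le_opNorm _ _).trans (mul_le_mul_of_nonneg_right (hC _) (norm_nonneg _))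
  · exact Filter.Eventually.of_forall fun ω ρ _ => ray_deriv hf x (Z ω) ρ

lemma He_deriv {f : EuclideanSpace ℝ (Fin n) → ℝ} (hf : Tst f) (ρ : ℝ) (x) :
    HasDerivAt (fun ρ => He ρ f x) (ρ * He ρ (lap f) x) ρ := by
  have := (gen_deriv (P := gm n) (Z := fun z => z) continuous_id gm_int_norm hf ρ x).2
  simp only [He_eq hf.cont]
  rwa [gauss_ibp hf] at this

lemma HeHe_eq {f : EuclideanSpace ℝ (Fin n) → ℝ} (hf : Tst f) (ρ : ℝ) (x) :
    He ρ (He ρ f) x = ∫ ω : EuclideanSpace ℝ (Fin n) × EuclideanSpace ℝ (Fin n),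
      f (x + ρ • (ω.1 + ω.2)) ∂((gm n).prod (gm n)) := by
  obtain ⟨D, hD⟩ := hf.bdd
  rw [He_eq (f := He ρ f) (Av_cont hf.cont hD), integral_prod]
  · congr 1; funext z
    rw [He_eq hf.cont]
    simp only [smul_add, add_assoc]
  · exact integrable_of_bdd (hf.cont.comp (by fun_prop)) (C := D) fun _ => hD _

lemma HeHe_deriv {f : EuclideanSpace ℝ (Fin n) → ℝ} (hf : Tst f) (ρ : ℝ) (x) :
    HasDerivAt (fun ρ => He ρ (He ρ f) x) (2 * ρ * He ρ (He ρ (lap f)) x) ρ := by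
  have hcf : Continuous (fderiv ℝ f) := hf.1.continuous_fderiv (by norm_num)
  obtain ⟨C, hC⟩ := (hf.2.fderiv ℝ).exists_bound_of_continuous hcf
  have hn1 : Integrable (fun ω : EuclideanSpace ℝ (Fin n) × EuclideanSpace ℝ (Fin n) => ‖ω.1‖)
      ((gm n).prod (gm n)) := by
    simpa using gm_int_norm.mul_prod (integrable_const (1 : ℝ) (μ := gm n))
  have hn2 : Integrable (fun ω : EuclideanSpace ℝ (Fin n) × EuclideanSpace ℝ (Fin n) => ‖ω.2‖)
      ((gm n).prod (gm n)) := by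
    simpa using (integrable_const (1 : ℝ) (μ := gm n)).mul_prod gm_int_norm
  have hn : Integrable (fun ω : EuclideanSpace ℝ (Fin n) × EuclideanSpace ℝ (Fin n) => ‖ω.1 + ω.2‖)
      ((gm n).prod (gm n)) :=
    (hn1.add hn2).mono' (by fun_prop) (Filter.Eventually.of_forall fun ω => by
      simpa using norm_add_le ω.1 ω.2)
  have h1 := (gen_deriv (P := (gm n).prod (gm n)) (Z := fun ω => ω.1 + ω.2) (by fun_prop) hn hf ρ x).2
  simp only [HeHe_eq hf]
  convert! h1 using 1
  simp only [map_add]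
  have b : ∀ v w : EuclideanSpace ℝ (Fin n), ‖fderiv ℝ f v w‖ ≤ C * ‖w‖ := fun v w =>
    (ContinuousLinearMap.le_opNorm _ _).trans (mul_le_mul_of_nonneg_right (hC _) (norm_nonneg _))
  have i1 : Integrable (fun ω : EuclideanSpace ℝ (Fin n) × EuclideanSpace ℝ (Fin n) =>
      fderiv ℝ f (x + ρ • (ω.1 + ω.2)) ω.1) ((gm n).prod (gm n)) :=
    (hn1.const_mul C).mono' ((hcf.comp (by fun_prop)).clm_apply continuous_fst).aestronglyMeasurable
      (Filter.Eventually.of_forall fun ω => b _ _)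
  have i2 : Integrable (fun ω : EuclideanSpace ℝ (Fin n) × EuclideanSpace ℝ (Fin n) =>
      fderiv ℝ f (x + ρ • (ω.1 + ω.2)) ω.2) ((gm n).prod (gm n)) :=
    (hn2.const_mul C).mono' ((hcf.comp (by fun_prop)).clm_apply continuous_snd).aestronglyMeasurable
      (Filter.Eventually.of_forall fun ω => b _ _)
  rw [integral_add i1 i2, integral_prod _ i2, integral_prod_symm _ i1]
  have key : ∀ y, ∫ z, fderiv ℝ f (x + ρ • (y + z)) z ∂(gm n) = ρ * He ρ (lap f) (x + ρ • y) := by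
    intro y
    rw [← gauss_ibp hf]
    simp only [smul_add, add_assoc]
  have key' : ∀ y, ∫ z, fderiv ℝ f (x + ρ • (z + y)) z ∂(gm n) = ρ * He ρ (lap f) (x + ρ • y) := by
    intro y
    rw [← key]
    simp only [add_comm]
  obtain ⟨D, hD⟩ := hf.lap.bdd
  simp only [key, key', integral_const_mul]
  rw [He_eq (f := He ρ (lap f)) (Av_cont hf.lap.cont hD)]
  ring

end gauss

section bellman

def quad : Set (ℝ × ℝ) := {z | 0 < z.1 ∧ 0 < z.2}

noncomputable def bg (s : ℝ) : ℝ := s ^ 2 / (1 + s ^ 2)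
noncomputable def bg1 (s : ℝ) : ℝ := 2 * s / (1 + s ^ 2) ^ 2
noncomputable def bg2 (s : ℝ) : ℝ := (2 - 6 * s ^ 2) / (1 + s ^ 2) ^ 3

lemma bg_d (s : ℝ) : HasDerivAt bg (bg1 s) s := by
  have h0 : (1 + s ^ 2) ≠ 0 := by positivity
  have h1 : HasDerivAt (fun s : ℝ => s ^ 2) (2 * s) s := by simpa using hasDerivAt_pow 2 s
  have := h1.div (h1.const_add 1) h0
  convert! this using 1
  unfold bg1; field_simp; ring

lemma bg1_d (s : ℝ) : HasDerivAt bg1 (bg2 s) s := by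
  have h0 : (1 + s ^ 2) ≠ 0 := by positivity
  have h1 : HasDerivAt (fun s : ℝ => s ^ 2) (2 * s) s := by simpa using hasDerivAt_pow 2 s
  have h2 := (h1.const_add 1).pow 2
  have h3 : HasDerivAt (fun s : ℝ => 2 * s) 2 s := by simpa using (hasDerivAt_id s).const_mul 2
  have := h3.div h2 (pow_ne_zero 2 h0)
  convert! this using 1
  unfold bg2; simp; field_simp; ring

lemma bg2_cont : Continuous bg2 := by
  unfold bg2
  refine Continuous.div (by fun_prop) (by fun_prop) fun s => by positivity

lemma bg_bounds {s : ℝ} (hs : 0 < s) : 0 ≤ bg s ∧ bg s ≤ 1 ∧ 0 ≤ bg1 s ∧ bg1 s ≤ 2 ∧ |s * bg2 s| ≤ 8 ∧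
    s * bg1 s ≤ 2 ∧ -8 ≤ s ^ 2 * bg2 s ∧ -6 ≤ bg2 s := by
  unfold bg bg1 bg2
  have hp1 : 0 < 1 + s ^ 2 := by positivity
  refine ⟨by positivity, ?_, by positivity, ?_, ?_, ?_, ?_, ?_⟩
  · rw [div_le_one hp1]; linarith
  · rw [div_le_iff₀ (by positivity)]; nlinarith [sq_nonneg (s - 1), pow_pos hs 2, pow_pos hs 4]
  · rw [mul_div_assoc', abs_div, abs_of_pos (by positivity : 0 < (1 + s ^ 2) ^ 3), div_le_iff₀ (by positivity), abs_le]
    constructor <;> nlinarith [sq_nonneg (s - 1), pow_pos hs 2, pow_pos hs 4, pow_pos hs 3, pow_pos hs 6, mul_nonneg hs.le (sq_nonneg (s-1))]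
  · rw [mul_div_assoc', div_le_iff₀ (by positivity)]; nlinarith [pow_pos hs 2, pow_pos hs 4]
  · rw [mul_div_assoc', le_div_iff₀ (by positivity)]
    nlinarith [pow_pos hs 2, pow_pos hs 4, pow_pos hs 6]
  · rw [le_div_iff₀ (by positivity)]
    nlinarith [pow_pos hs 2, pow_pos hs 4, pow_pos hs 6]

lemma bg2_small {s : ℝ} (hs : 0 < s) (hs2 : s ≤ 1/2) : 1/4 ≤ bg2 s := by
  unfold bg2
  rw [le_div_iff₀ (by positivity)]
  have h : s ^ 2 ≤ 1/4 := by nlinarith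
  nlinarith [pow_pos hs 2, pow_pos hs 4, pow_pos hs 6, pow_le_pow_left₀ (by positivity) h 3, pow_le_pow_left₀ (by positivity) h 2]

lemma hasF_comp {f g : ℝ → ℝ} {a b c d : ℝ} (hf : HasDerivAt f c a) (hg : HasDerivAt g d b) :
    HasFDerivAt (fun z : ℝ × ℝ => f z.1) (c • ContinuousLinearMap.fst ℝ ℝ ℝ) (a, b) ∧
    HasFDerivAt (fun z : ℝ × ℝ => g z.2) (d • ContinuousLinearMap.snd ℝ ℝ ℝ) (a, b) := by
  constructor
  · exact hf.comp_hasFDerivAt (a, b) (hasFDerivAt_fst (𝕜 := ℝ) (p := ((a, b) : ℝ × ℝ)))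
  · exact hg.comp_hasFDerivAt (a, b) (hasFDerivAt_snd (𝕜 := ℝ) (p := ((a, b) : ℝ × ℝ)))

lemma s_deriv {q a b : ℝ} (hb : 0 < b) :
    HasFDerivAt (fun z : ℝ × ℝ => z.1 * z.2 ^ (1 - q))
      (b ^ (1 - q) • ContinuousLinearMap.fst ℝ ℝ ℝ + (a * ((1 - q) * b ^ (-q))) • ContinuousLinearMap.snd ℝ ℝ ℝ) (a, b) := by
  have h2 := (hasF_comp (hasDerivAt_id a) (Real.hasDerivAt_rpow_const (x := b) (p := 1 - q) (Or.inl hb.ne'))).2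
  have h1 := (hasF_comp (hasDerivAt_id a) (hasDerivAt_id b)).1
  have := h1.mul h2
  convert! this using 1
  have e : (1 - q - 1) = -q := by ring
  ext <;> simp [e]

lemma hess_alg {τ A B C : ℝ} (hτ : 0 < τ) (hA : 1/4 ≤ A) (hB : |B| ≤ 10) (hC : 801 ≤ C) (x y : ℝ) :
    τ * x ^ 2 + τ⁻¹ * y ^ 2 ≤ 8 * (τ * A * x ^ 2 + 2 * B * x * y + τ⁻¹ * C * y ^ 2) := by
  have hxy : -(τ * x ^ 2 / 8 + 800 * (τ⁻¹ * y ^ 2)) ≤ 2 * B * x * y := by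
    have h1 : |2 * B * x * y| ≤ 20 * (|x| * |y|) := by
      rw [abs_mul, abs_mul, abs_mul, abs_two]
      have h0 := mul_nonneg (abs_nonneg x) (abs_nonneg y)
      have := mul_le_mul_of_nonneg_right hB h0
      linarith
    have h2 : 20 * (|x| * |y|) ≤ τ * x ^ 2 / 8 + 800 * (τ⁻¹ * y ^ 2) := by
      rw [← sq_abs x, ← sq_abs y]
      have h3 : 0 ≤ τ⁻¹ * (τ * |x| - 80 * |y|) ^ 2 := by positivity
      have h4 : τ⁻¹ * (τ * |x| - 80 * |y|) ^ 2 = τ * |x| ^ 2 - 160 * (|x| * |y|) + 6400 * (τ⁻¹ * |y| ^ 2) := by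
        field_simp; ring
      linarith
    have := neg_abs_le (2 * B * x * y)
    linarith
  have hx : 0 ≤ τ * x ^ 2 := by positivity
  have hy : 0 ≤ τ⁻¹ * y ^ 2 := by positivity
  have hA2 := mul_le_mul_of_nonneg_left hA hx
  have hC2 := mul_le_mul_of_nonneg_left hC hy
  linarith

set_option maxHeartbeats 1000000 in
theorem bellman {p q : ℝ} (hpq : p.HolderConjugate q) (hp : 2 ≤ p) :
    ∃ (M : ℝ) (Q Qa Qb Qaa Qab Qbb : ℝ × ℝ → ℝ), 0 < M ∧
      (ContinuousOn Qaa quad ∧ ContinuousOn Qab quad ∧ ContinuousOn Qbb quad) ∧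
      (∀ z ∈ quad, HasFDerivAt Q (Qa z • ContinuousLinearMap.fst ℝ ℝ ℝ + Qb z • ContinuousLinearMap.snd ℝ ℝ ℝ) z) ∧
      (∀ z ∈ quad, HasFDerivAt Qa (Qaa z • ContinuousLinearMap.fst ℝ ℝ ℝ + Qab z • ContinuousLinearMap.snd ℝ ℝ ℝ) z) ∧
      (∀ z ∈ quad, HasFDerivAt Qb (Qab z • ContinuousLinearMap.fst ℝ ℝ ℝ + Qbb z • ContinuousLinearMap.snd ℝ ℝ ℝ) z) ∧
      (∀ z ∈ quad, 0 ≤ Q z ∧ Q z ≤ M * (z.1 ^ p + z.2 ^ q)) ∧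
      (∀ z ∈ quad, ∃ τ : ℝ, 0 < τ ∧ ∀ x y : ℝ, τ * x ^ 2 + τ⁻¹ * y ^ 2 ≤
        8 * (Qaa z * x ^ 2 + 2 * Qab z * x * y + Qbb z * y ^ 2)) := by
  have hq1 : 1 < q := hpq.symm.lt
  have hpq1 : (p - 1) * (q - 1) = 1 := by linear_combination hpq.mul_eq_add
  have hq2 : q ≤ 2 := by nlinarith
  obtain ⟨K, hK0, hK1, hK2⟩ : ∃ K : ℝ, 0 ≤ K ∧ 7 ≤ K * p * (p - 1) * (1/2 : ℝ) ^ (p - 2) ∧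
      813 ≤ K * q * (q - 1) := by
    have h1 : 0 < p * (p - 1) * (1/2 : ℝ) ^ (p - 2) := by
      have : 0 < p - 1 := by linarith
      positivity
    have h2 : 0 < q * (q - 1) := by
      have : 0 < q - 1 := by linarith
      positivity
    refine ⟨7 / (p * (p - 1) * (1/2 : ℝ) ^ (p - 2)) + 813 / (q * (q - 1)), by positivity, ?_, ?_⟩
    · have : (0:ℝ) ≤ 813 / (q * (q - 1)) := by positivity
      have e : 7 / (p * (p - 1) * (1/2 : ℝ) ^ (p - 2)) * (p * (p - 1) * (1/2 : ℝ) ^ (p - 2)) = 7 := div_mul_cancel₀ _ h1.ne'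
      nlinarith
    · have : (0:ℝ) ≤ 7 / (p * (p - 1) * (1/2 : ℝ) ^ (p - 2)) := by positivity
      have e : 813 / (q * (q - 1)) * (q * (q - 1)) = 813 := div_mul_cancel₀ _ h2.ne'
      nlinarith
  let s : ℝ × ℝ → ℝ := fun z => z.1 * z.2 ^ (1 - q)
  have hs : ∀ z, s z = z.1 * z.2 ^ (1 - q) := fun _ => rfl
  have hspos : ∀ z ∈ quad, 0 < s z := fun z hz => mul_pos hz.1 (Real.rpow_pos_of_pos hz.2 _)
  have hsc : ContinuousOn s quad := by
    intro z hz
    obtain ⟨a, b⟩ := z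
    exact (s_deriv (a := a) hz.2).continuousAt.continuousWithinAt
  refine ⟨K + 1, fun z => K * (z.1 ^ p + z.2 ^ q) + z.2 ^ q * bg (s z),
    fun z => K * (p * z.1 ^ (p - 1)) + z.2 * bg1 (s z),
    fun z => K * (q * z.2 ^ (q - 1)) + (q * z.2 ^ (q - 1) * bg (s z) - (q - 1) * (z.1 * bg1 (s z))),
    fun z => K * (p * ((p - 1) * z.1 ^ (p - 2))) + z.2 * (bg2 (s z) * z.2 ^ (1 - q)),
    fun z => bg1 (s z) - (q - 1) * (s z * bg2 (s z)),
    fun z => z.2 ^ (q - 2) * (K * q * (q - 1) + (q * (q - 1) * bg (s z) - q * (q - 1) * (s z * bg1 (s z))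
      + (q - 1) ^ 2 * (s z ^ 2 * bg2 (s z)))), by linarith, ?_, ?_, ?_, ?_, ?_, ?_⟩
  · have hb2 : ContinuousOn (fun z => bg2 (s z)) quad := bg2_cont.comp_continuousOn hsc
    have hb1 : ContinuousOn (fun z => bg1 (s z)) quad :=
      (continuous_iff_continuousAt.2 fun s => (bg1_d s).continuousAt).comp_continuousOn hsc
    have hb0 : ContinuousOn (fun z => bg (s z)) quad :=
      (continuous_iff_continuousAt.2 fun s => (bg_d s).continuousAt).comp_continuousOn hsc
    have r1 : ∀ r : ℝ, ContinuousOn (fun z : ℝ × ℝ => z.1 ^ r) quad := fun r =>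
      continuousOn_fst.rpow_const fun z hz => Or.inl hz.1.ne'
    have r2 : ∀ r : ℝ, ContinuousOn (fun z : ℝ × ℝ => z.2 ^ r) quad := fun r =>
      continuousOn_snd.rpow_const fun z hz => Or.inl hz.2.ne'
    have r3 : ContinuousOn (fun z : ℝ × ℝ => z.2) quad := continuousOn_snd
    refine ⟨?_, ?_, ?_⟩
    · exact (continuousOn_const.mul (continuousOn_const.mul (continuousOn_const.mul (r1 _)))).add
        (r3.mul (hb2.mul (r2 _)))
    · exact hb1.sub (continuousOn_const.mul (hsc.mul hb2))
    · exact (r2 _).mul (continuousOn_const.add (((continuousOn_const.mul hb0).sub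
        (continuousOn_const.mul (hsc.mul hb1))).add (continuousOn_const.mul ((hsc.pow 2).mul hb2))))
  · rintro ⟨a, b⟩ ⟨ha, hb⟩
    simp only at ha hb
    have h1 := hasF_comp (Real.hasDerivAt_rpow_const (x := a) (p := p) (Or.inl ha.ne'))
      (Real.hasDerivAt_rpow_const (x := b) (p := q) (Or.inl hb.ne'))
    have h2 := (bg_d (s (a, b))).comp_hasFDerivAt (a, b) (s_deriv (q := q) (a := a) hb)
    have h3 := ((h1.1.add h1.2).const_mul K).add (h1.2.mul h2)
    convert! h3 using 1
    have e1 : b ^ q * b ^ (1 - q) = b := by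
      rw [← Real.rpow_add hb]; simp
    have e2 : b ^ q * b ^ (-q) = 1 := by
      rw [← Real.rpow_add hb]; simp
    ext
    · simp [s] 
      linear_combination (- bg1 (s (a, b))) * e1
    · simp [s]
      linear_combination (- bg1 (s (a, b)) * a * (1 - q)) * e2
  · rintro ⟨a, b⟩ ⟨ha, hb⟩
    simp only at ha hb
    have h1 := hasF_comp (Real.hasDerivAt_rpow_const (x := a) (p := p - 1) (Or.inl ha.ne'))
      (hasDerivAt_id b)
    have h2 := (bg1_d (s (a, b))).comp_hasFDerivAt (a, b) (s_deriv (q := q) (a := a) hb)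
    have h3 := ((h1.1.const_mul p).const_mul K).add (h1.2.mul h2)
    convert! h3 using 1
    have e1 : p - 1 - 1 = p - 2 := by ring
    have e2 : b * b ^ (-q) = b ^ (1 - q) := by
      nth_rewrite 1 [← Real.rpow_one b]
      rw [← Real.rpow_add hb]; congr 1
    ext
    · simp [s, e1]
    · simp [s]
      linear_combination (- bg2 (s (a, b)) * a * (1 - q)) * e2
  · rintro ⟨a, b⟩ ⟨ha, hb⟩
    simp only at ha hb
    have h1 := hasF_comp (hasDerivAt_id a)
      (Real.hasDerivAt_rpow_const (x := b) (p := q - 1) (Or.inl hb.ne'))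
    have h2 := (bg_d (s (a, b))).comp_hasFDerivAt (a, b) (s_deriv (q := q) (a := a) hb)
    have h2' := (bg1_d (s (a, b))).comp_hasFDerivAt (a, b) (s_deriv (q := q) (a := a) hb)
    have h3 := ((h1.2.const_mul q).const_mul K).add (((h1.2.const_mul q).mul h2).sub
      ((h1.1.mul h2').const_mul (q - 1)))
    convert! h3 using 1
    have e1 : q - 1 - 1 = q - 2 := by ring
    have e2 : b ^ (q - 1) * b ^ (1 - q) = 1 := by
      rw [← Real.rpow_add hb]; simp
    have e3 : b ^ (q - 2) * b ^ (1 - q) = b ^ (q - 1) * b ^ (-q) := by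
      rw [← Real.rpow_add hb, ← Real.rpow_add hb]; congr 1; ring
    have e4 : b ^ (q - 2) * b ^ (1 - q) * b ^ (1 - q) = b ^ (-q) := by
      rw [← Real.rpow_add hb, ← Real.rpow_add hb]; congr 1; ring
    ext
    · simp [s]
      linear_combination (- bg1 (s (a, b)) * q) * e2
    · simp [s, e1]
      linear_combination (- bg1 (s (a, b)) * q * (q - 1) * a) * e3 + ((q - 1) ^ 2 * a ^ 2 * bg2 (s (a, b))) * e4
  · rintro ⟨a, b⟩ ⟨ha, hb⟩
    simp only at ha hb
    have hsp := hspos (a, b) ⟨ha, hb⟩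
    obtain ⟨g0, g1, -⟩ := bg_bounds hsp
    have ha' := Real.rpow_pos_of_pos ha p
    have hb' := Real.rpow_pos_of_pos hb q
    constructor
    · positivity
    · simp only
      nlinarith
  · rintro ⟨a, b⟩ ⟨ha, hb⟩
    simp only at ha hb
    have hsp := hspos (a, b) ⟨ha, hb⟩
    refine ⟨b ^ (2 - q), Real.rpow_pos_of_pos hb _, fun x y => ?_⟩
    have ey : b ^ (q - 2) = (b ^ (2 - q))⁻¹ := by
      rw [← Real.rpow_neg hb.le]; congr 1; ring
    have e1 : b * b ^ (1 - q) = b ^ (2 - q) := by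
      nth_rewrite 1 [← Real.rpow_one b]
      rw [← Real.rpow_add hb]; congr 1; ring
    have e2 : a ^ (p - 2) = b ^ (2 - q) * (s (a, b)) ^ (p - 2) := by
      rw [hs]
      simp only
      rw [Real.mul_rpow ha.le (by positivity), ← Real.rpow_mul hb.le, mul_left_comm, ← Real.rpow_add hb]
      have : 2 - q + (1 - q) * (p - 2) = 0 := by linear_combination - hpq1
      rw [this]; simp
    simp only [ey, e2]
    set σ := s (a, b)
    have hτ : 0 < b ^ (2 - q) := Real.rpow_pos_of_pos hb _
    set τ := b ^ (2 - q)
    obtain ⟨g0, g1, g2, g3, g4, g5, g6, g7⟩ := bg_bounds hsp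
    have hA : 1/4 ≤ K * (p * ((p - 1) * σ ^ (p - 2))) + bg2 σ := by
      rcases le_total σ (1/2) with h | h
      · have := bg2_small hsp h
        have h' : 0 ≤ K * (p * ((p - 1) * σ ^ (p - 2))) := by
          have : 0 ≤ p - 1 := by linarith
          positivity
        linarith
      · have h1 : (1/2 : ℝ) ^ (p - 2) ≤ σ ^ (p - 2) :=
          Real.rpow_le_rpow (by norm_num) h (by linarith)
        have h2 : K * p * (p - 1) * (1/2 : ℝ) ^ (p - 2) ≤ K * p * (p - 1) * σ ^ (p - 2) :=
          mul_le_mul_of_nonneg_left h1 (mul_nonneg (mul_nonneg hK0 (by linarith)) (by linarith))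
        nlinarith
    set A := K * (p * ((p - 1) * σ ^ (p - 2))) + bg2 σ
    have hAe : K * (p * ((p - 1) * (τ * σ ^ (p - 2)))) + b * (bg2 σ * b ^ (1 - q)) = τ * A := by
      simp only [A, ← e1]; ring
    have hB : |bg1 σ - (q - 1) * (σ * bg2 σ)| ≤ 10 := by
      have h1 := abs_sub (bg1 σ) ((q - 1) * (σ * bg2 σ))
      rw [abs_of_nonneg g2, abs_mul, abs_of_pos (by linarith : 0 < q - 1)] at h1
      have h2 : (q - 1) * |σ * bg2 σ| ≤ 1 * 8 := mul_le_mul (by linarith) g4 (abs_nonneg _) (by norm_num)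
      linarith
    set B := bg1 σ - (q - 1) * (σ * bg2 σ)
    have hC : 801 ≤ K * q * (q - 1) + (q * (q - 1) * bg σ - q * (q - 1) * (σ * bg1 σ)
      + (q - 1) ^ 2 * (σ ^ 2 * bg2 σ)) := by
      have h1 : 0 ≤ q * (q - 1) * bg σ := mul_nonneg (mul_nonneg (by linarith) (by linarith)) g0
      have h2 : q * (q - 1) * (σ * bg1 σ) ≤ 2 * 2 :=
        mul_le_mul (by nlinarith) g5 (by positivity) (by norm_num)
      have h3 : -8 ≤ (q - 1) ^ 2 * (σ ^ 2 * bg2 σ) := by nlinarith [sq_nonneg (q - 1)]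
      linarith
    set C := K * q * (q - 1) + (q * (q - 1) * bg σ - q * (q - 1) * (σ * bg1 σ)
      + (q - 1) ^ 2 * (σ ^ 2 * bg2 σ))
    rw [hAe]
    exact hess_alg hτ hA hB hC x y

end bellman

section embed
variable {n : ℕ}

lemma chain_pd {Q : ℝ × ℝ → ℝ} {a b : ℝ} {U W : EuclideanSpace ℝ (Fin n) → ℝ} {x}
    (hQ : HasFDerivAt Q (a • ContinuousLinearMap.fst ℝ ℝ ℝ + b • ContinuousLinearMap.snd ℝ ℝ ℝ) (U x, W x))
    (hU : DifferentiableAt ℝ U x) (hW : DifferentiableAt ℝ W x) :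
    DifferentiableAt ℝ (fun x => Q (U x, W x)) x ∧
      ∀ i, pd (fun x => Q (U x, W x)) i x = a * pd U i x + b * pd W i x := by
  have h := HasFDerivAt.comp x hQ (hU.hasFDerivAt.prodMk hW.hasFDerivAt)
  refine ⟨h.differentiableAt, fun i => ?_⟩
  have h' : fderiv ℝ (fun x => Q (U x, W x)) x = _ := h.fderiv
  unfold pd
  rw [h']; simp

lemma pd_mul {U W : EuclideanSpace ℝ (Fin n) → ℝ} {x}
    (hU : DifferentiableAt ℝ U x) (hW : DifferentiableAt ℝ W x) (i) :
    pd (fun x => U x * W x) i x = U x * pd W i x + pd U i x * W x := by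
  unfold pd
  rw [fderiv_fun_mul hU hW]; simp; ring

lemma pd_add {U W : EuclideanSpace ℝ (Fin n) → ℝ} {x}
    (hU : DifferentiableAt ℝ U x) (hW : DifferentiableAt ℝ W x) (i) :
    pd (fun x => U x + W x) i x = pd U i x + pd W i x := by
  unfold pd
  rw [fderiv_fun_add hU hW]; simp

/-- integration by parts for the Bellman function of the flow at a fixed time -/
lemma claim2 {Q Qa Qb Qaa Qab Qbb : ℝ × ℝ → ℝ}
    (hc : ContinuousOn Qaa quad ∧ ContinuousOn Qab quad ∧ ContinuousOn Qbb quad)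
    (h1 : ∀ z ∈ quad, HasFDerivAt Q (Qa z • ContinuousLinearMap.fst ℝ ℝ ℝ + Qb z • ContinuousLinearMap.snd ℝ ℝ ℝ) z)
    (h2 : ∀ z ∈ quad, HasFDerivAt Qa (Qaa z • ContinuousLinearMap.fst ℝ ℝ ℝ + Qab z • ContinuousLinearMap.snd ℝ ℝ ℝ) z)
    (h3 : ∀ z ∈ quad, HasFDerivAt Qb (Qab z • ContinuousLinearMap.fst ℝ ℝ ℝ + Qbb z • ContinuousLinearMap.snd ℝ ℝ ℝ) z)
    {U W χ : EuclideanSpace ℝ (Fin n) → ℝ} (hχ : Tst χ) (i : Fin n)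
    (hz : ∀ x, (U x, W x) ∈ quad)
    (hU : Differentiable ℝ U) (hW : Differentiable ℝ W)
    (hU1 : Differentiable ℝ (pd U i)) (hW1 : Differentiable ℝ (pd W i))
    (hU2 : Continuous (pd2 U i i)) (hW2 : Continuous (pd2 W i i)) :
    ∫ x, χ x * (Qa (U x, W x) * pd2 U i i x + Qb (U x, W x) * pd2 W i i x +
      (Qaa (U x, W x) * pd U i x ^ 2 + 2 * Qab (U x, W x) * pd U i x * pd W i x
        + Qbb (U x, W x) * pd W i x ^ 2)) = ∫ x, pd2 χ i i x * Q (U x, W x) := by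
  have hzc : Continuous fun x => (U x, W x) := hU.continuous.prodMk hW.continuous
  have cQ : ∀ {R : ℝ × ℝ → ℝ}, ContinuousOn R quad → Continuous fun x => R (U x, W x) :=
    fun hR => hR.comp_continuous hzc hz
  have cQa : ContinuousOn Qa quad := fun z hz => (h2 z hz).continuousAt.continuousWithinAt
  have cQb : ContinuousOn Qb quad := fun z hz => (h3 z hz).continuousAt.continuousWithinAt
  have dβ := fun x => chain_pd (h1 _ (hz x)) (hU x) (hW x)
  have dA := fun x => chain_pd (h2 _ (hz x)) (hU x) (hW x)
  have dB := fun x => chain_pd (h3 _ (hz x)) (hU x) (hW x)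
  have eβ : pd (fun x => Q (U x, W x)) i = fun x => Qa (U x, W x) * pd U i x + Qb (U x, W x) * pd W i x :=
    funext fun x => (dβ x).2 i
  have dBi : Differentiable ℝ (pd (fun x => Q (U x, W x)) i) := by
    rw [eβ]
    exact fun x => ((dA x).1.mul (hU1 x)).add ((dB x).1.mul (hW1 x))
  have e2 : pd (pd (fun x => Q (U x, W x)) i) i = fun x => Qa (U x, W x) * pd2 U i i x + Qb (U x, W x) * pd2 W i i x +
      (Qaa (U x, W x) * pd U i x ^ 2 + 2 * Qab (U x, W x) * pd U i x * pd W i x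
        + Qbb (U x, W x) * pd W i x ^ 2) := by
    rw [eβ]
    funext x
    rw [pd_add ((dA x).1.fun_mul (hU1 x)) ((dB x).1.fun_mul (hW1 x)), pd_mul (dA x).1 (hU1 x), pd_mul (dB x).1 (hW1 x),
      (dA x).2, (dB x).2]
    unfold pd2
    ring
  have c2 : Continuous (pd (pd (fun x => Q (U x, W x)) i) i) := by
    rw [e2]
    have a1 := hU1.continuous
    have a2 := hW1.continuous
    exact (((cQ cQa).mul hU2).add ((cQ cQb).mul hW2)).add ((((cQ hc.1).mul (a1.pow 2)).add
      (((continuous_const.mul (cQ hc.2.1)).mul a1).mul a2)).add ((cQ hc.2.2).mul (a2.pow 2)))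
  have i1 := ibp_cs hχ i dBi c2
  have i2 := ibp_cs (hχ.pd i) i (fun x => (dβ x).1) dBi.continuous
  rw [i2, e2, neg_neg] at i1
  exact i1

lemma int_strip {F : ℝ × EuclideanSpace ℝ (Fin n) → ℝ} (hF : Continuous F) {K : Set (EuclideanSpace ℝ (Fin n))}
    (hK : IsCompact K) (h0 : ∀ z, z.2 ∉ K → F z = 0) (T : ℝ) :
    Integrable F ((volume.restrict (Set.Ioc 0 T)).prod volume) := by
  have h1 : IntegrableOn F (Set.Icc 0 T ×ˢ K) (volume.prod volume) :=
    hF.continuousOn.integrableOn_compact (isCompact_Icc.prod hK)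
  have h2 : IntegrableOn F (Set.Icc 0 T ×ˢ Set.univ) (volume.prod volume) := by
    refine h1.of_forall_sdiff_eq_zero (measurableSet_Icc.prod MeasurableSet.univ) ?_
    rintro z ⟨⟨hz, -⟩, hz2⟩
    exact h0 z fun h => hz2 ⟨hz, h⟩
  have h3 := h2.mono_set (Set.prod_mono_left (t := Set.univ) (Set.Ioc_subset_Icc_self (a := (0:ℝ)) (b := T)))
  unfold IntegrableOn at h3
  rwa [← Measure.prod_restrict, Measure.restrict_univ] at h3

lemma He_zero {f : EuclideanSpace ℝ (Fin n) → ℝ} (hf : Continuous f) (x) : He 0 f x = f x := by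
  rw [He_eq hf]; simp

lemma He_nonneg {f : EuclideanSpace ℝ (Fin n) → ℝ} (hf : ∀ x, 0 ≤ f x) (ρ x) : 0 ≤ He ρ f x :=
  integral_nonneg fun _ => hf _

lemma He_contT {f : EuclideanSpace ℝ (Fin n) → ℝ} (hf : Tst f) :
    Continuous fun z : ℝ × EuclideanSpace ℝ (Fin n) => He z.1 f z.2 := by
  obtain ⟨C, hC⟩ := hf.bdd
  exact He_cont hf.cont hC

lemma He_lap {f : EuclideanSpace ℝ (Fin n) → ℝ} (hf : Tst f) (ρ x) :
    He ρ (lap f) x = ∑ i, He ρ (pd2 f i i) x := by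
  unfold He Av lap
  rw [integral_finsetSum]
  intro i _
  obtain ⟨C, hC⟩ := (hf.pd2 i i).bdd
  exact integrable_of_bdd ((hf.pd2 i i).cont.comp (continuous_const.add continuous_id)) fun y => hC _

end embed

section embed2
variable {n : ℕ}

lemma hess_low {A B C τ : ℝ} (hτ : 0 < τ) (h : ∀ x y : ℝ, τ * x ^ 2 + τ⁻¹ * y ^ 2 ≤
    8 * (A * x ^ 2 + 2 * B * x * y + C * y ^ 2)) (a b : Fin n → ℝ) (i j : Fin n) :
    |a i| * |b j| ≤ 4 * ∑ k, (A * a k ^ 2 + 2 * B * a k * b k + C * b k ^ 2) := by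
  have h1 : ∑ k, (τ * a k ^ 2 + τ⁻¹ * b k ^ 2) ≤ ∑ k, 8 * (A * a k ^ 2 + 2 * B * a k * b k + C * b k ^ 2) :=
    Finset.sum_le_sum fun k _ => h _ _
  rw [← Finset.mul_sum, Finset.sum_add_distrib] at h1
  have h2 := Finset.single_le_sum (f := fun k => τ * a k ^ 2) (fun k _ => by positivity) (Finset.mem_univ i)
  have h3 := Finset.single_le_sum (f := fun k => τ⁻¹ * b k ^ 2) (fun k _ => by positivity) (Finset.mem_univ j)
  have h4 : 0 ≤ τ⁻¹ * (τ * |a i| - |b j|) ^ 2 := by positivity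
  have h5 : τ⁻¹ * (τ * |a i| - |b j|) ^ 2 = τ * a i ^ 2 - 2 * (|a i| * |b j|) + τ⁻¹ * b j ^ 2 := by
    rw [← sq_abs (a i), ← sq_abs (b j)]
    field_simp
    ring
  linarith

/-- localized bilinear estimate -/
lemma embed_loc {p q : ℝ} (hpq : p.HolderConjugate q) (hp : 2 ≤ p) : ∃ M : ℝ, 0 < M ∧
    ∀ (f g χ : EuclideanSpace ℝ (Fin n) → ℝ), Tst f → Tst g → Tst χ →
      (∀ x, 0 ≤ f x) → (∀ x, 0 ≤ g x) → (∀ x, 0 ≤ χ x) → ∀ (i j : Fin n) (ε T : ℝ), 0 < ε → 0 ≤ T →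
      ∫ z : ℝ × EuclideanSpace ℝ (Fin n), z.1 * (χ z.2 * (|He z.1 (pd f i) z.2| * |He z.1 (pd g j) z.2|))
        ∂((volume.restrict (Set.Ioc 0 T)).prod volume) ≤
      M * ((∫ x, χ x * ((f x + ε) ^ p + (g x + ε) ^ q)) +
        ∫ z : ℝ × EuclideanSpace ℝ (Fin n), z.1 * (|lap χ z.2| * ((He z.1 f z.2 + ε) ^ p + (He z.1 g z.2 + ε) ^ q))
        ∂((volume.restrict (Set.Ioc 0 T)).prod volume)) := by
  obtain ⟨M, Q, Qa, Qb, Qaa, Qab, Qbb, hM, hc, h1, h2, h3, hb, hh⟩ := bellman hpq hp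
  refine ⟨4 * M, by positivity, ?_⟩
  intro f g χ hf hg hχ hf0 hg0 hχ0 i j ε T hε hT
  let Z : ℝ × EuclideanSpace ℝ (Fin n) → ℝ × ℝ := fun z => (He z.1 f z.2 + ε, He z.1 g z.2 + ε)
  have hZq : ∀ z, Z z ∈ quad := fun z => ⟨by have := He_nonneg hf0 z.1 z.2; simp only [Z]; linarith,
    by have := He_nonneg hg0 z.1 z.2; simp only [Z]; linarith⟩
  have hZc : Continuous Z := ((He_contT hf).add continuous_const).prodMk ((He_contT hg).add continuous_const)
  have cQ : ∀ {R : ℝ × ℝ → ℝ}, ContinuousOn R quad → Continuous fun z => R (Z z) :=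
    fun hR => hR.comp_continuous hZc hZq
  have cQ0 := cQ (R := Q) fun z hz => (h1 z hz).continuousAt.continuousWithinAt
  have cQa := cQ (R := Qa) fun z hz => (h2 z hz).continuousAt.continuousWithinAt
  have cQb := cQ (R := Qb) fun z hz => (h3 z hz).continuousAt.continuousWithinAt
  have cQaa := cQ hc.1
  have cQab := cQ hc.2.1
  have cQbb := cQ hc.2.2
  have cχ : Continuous fun z : ℝ × EuclideanSpace ℝ (Fin n) => χ z.2 := hχ.cont.comp continuous_snd
  have cLχ : Continuous fun z : ℝ × EuclideanSpace ℝ (Fin n) => lap χ z.2 := hχ.lap.cont.comp continuous_snd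
  have cρ : Continuous fun z : ℝ × EuclideanSpace ℝ (Fin n) => z.1 := continuous_fst
  let Hs : ℝ × EuclideanSpace ℝ (Fin n) → ℝ := fun z => ∑ k, (Qaa (Z z) * He z.1 (pd f k) z.2 ^ 2 +
    2 * Qab (Z z) * He z.1 (pd f k) z.2 * He z.1 (pd g k) z.2 + Qbb (Z z) * He z.1 (pd g k) z.2 ^ 2)
  have cHs : Continuous Hs := by
    refine continuous_finsetSum _ fun k _ => ?_
    exact ((cQaa.mul ((He_contT (hf.pd k)).pow 2)).add (((continuous_const.mul cQab).mul
      (He_contT (hf.pd k))).mul (He_contT (hg.pd k)))).add (cQbb.mul ((He_contT (hg.pd k)).pow 2))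
  let L : ℝ × EuclideanSpace ℝ (Fin n) → ℝ := fun z => Qa (Z z) * He z.1 (lap f) z.2 + Qb (Z z) * He z.1 (lap g) z.2
  have cL : Continuous L := (cQa.mul (He_contT hf.lap)).add (cQb.mul (He_contT hg.lap))
  have out : ∀ x, x ∉ tsupport χ → χ x = 0 := fun x hx => image_eq_zero_of_notMem_tsupport hx
  have outL : ∀ x, x ∉ tsupport (lap χ) → lap χ x = 0 := fun x hx => image_eq_zero_of_notMem_tsupport hx
  have I1 : Integrable (fun z : ℝ × EuclideanSpace ℝ (Fin n) => z.1 * (χ z.2 * L z)) ((volume.restrict (Set.Ioc 0 T)).prod volume) :=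
    int_strip (cρ.mul (cχ.mul cL)) hχ.2 (fun z hz => by simp [out _ hz]) T
  have I2 : Integrable (fun z : ℝ × EuclideanSpace ℝ (Fin n) => z.1 * (χ z.2 * Hs z)) ((volume.restrict (Set.Ioc 0 T)).prod volume) :=
    int_strip (cρ.mul (cχ.mul cHs)) hχ.2 (fun z hz => by simp [out _ hz]) T
  have I3 : Integrable (fun z : ℝ × EuclideanSpace ℝ (Fin n) => z.1 * (lap χ z.2 * Q (Z z))) ((volume.restrict (Set.Ioc 0 T)).prod volume) :=
    int_strip (cρ.mul (cLχ.mul cQ0)) hχ.lap.2 (fun z hz => by simp [outL _ hz]) T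
  -- claim 1
  have E1 : ∫ z, z.1 * (χ z.2 * L z) ∂((volume.restrict (Set.Ioc 0 T)).prod volume)
      = ∫ x, χ x * (Q (Z (T, x)) - Q (Z (0, x))) := by
    rw [integral_prod_symm _ I1]
    congr 1
    funext x
    rw [← intervalIntegral.integral_of_le hT]
    have hd : ∀ ρ : ℝ, HasDerivAt (fun ρ => χ x * Q (Z (ρ, x))) (ρ * (χ x * L (ρ, x))) ρ := by
      intro ρ
      have a1 := (He_deriv hf ρ x).add_const ε
      have a2 := (He_deriv hg ρ x).add_const ε
      have := (HasFDerivAt.comp_hasDerivAt ρ (h1 _ (hZq (ρ, x))) (a1.prodMk a2)).const_mul (χ x)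
      convert! this using 1
      simp [L]
      ring
    rw [intervalIntegral.integral_eq_sub_of_hasDerivAt (fun ρ _ => hd ρ)]
    · ring
    · refine Continuous.intervalIntegrable ?_ _ _
      exact continuous_id.mul (continuous_const.mul (cL.comp (continuous_id.prodMk continuous_const)))
  have E2 : ∫ z, z.1 * (χ z.2 * L z) ∂((volume.restrict (Set.Ioc 0 T)).prod volume)
      + ∫ z, z.1 * (χ z.2 * Hs z) ∂((volume.restrict (Set.Ioc 0 T)).prod volume)
      = ∫ z, z.1 * (lap χ z.2 * Q (Z z)) ∂((volume.restrict (Set.Ioc 0 T)).prod volume) := by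
    rw [← integral_add I1 I2, integral_prod _ (I1.fun_add I2), integral_prod _ I3]
    congr 1
    funext ρ
    have hfun : ∀ x, ρ * (χ x * L (ρ, x)) + ρ * (χ x * Hs (ρ, x)) = ρ * (χ x * (L (ρ, x) + Hs (ρ, x))) :=
      fun x => by ring
    simp only [hfun, integral_const_mul]
    congr 1
    have cx : Continuous fun x : EuclideanSpace ℝ (Fin n) => (ρ, x) := by fun_prop
    have key : ∀ k, ∫ x, χ x * (Qa (Z (ρ, x)) * He ρ (pd2 f k k) x + Qb (Z (ρ, x)) * He ρ (pd2 g k k) x +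
        (Qaa (Z (ρ, x)) * He ρ (pd f k) x ^ 2 + 2 * Qab (Z (ρ, x)) * He ρ (pd f k) x * He ρ (pd g k) x
        + Qbb (Z (ρ, x)) * He ρ (pd g k) x ^ 2)) = ∫ x, pd2 χ k k x * Q (Z (ρ, x)) := by
      intro k
      have pU : ∀ (φ : EuclideanSpace ℝ (Fin n) → ℝ), Tst φ → pd (fun x => He ρ φ x + ε) k = He ρ (pd φ k) := by
        intro φ hφ
        have : pd (fun x => He ρ φ x + ε) k = pd (He ρ φ) k := by
          funext x; unfold pd; rw [fderiv_add_const]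
        rw [this]; exact pd_Av hφ k
      have pU2 : ∀ (φ : EuclideanSpace ℝ (Fin n) → ℝ), Tst φ → pd2 (fun x => He ρ φ x + ε) k k = He ρ (pd2 φ k k) := by
        intro φ hφ
        funext x
        unfold pd2
        rw [pU φ hφ]
        exact congrFun (pd_Av (hφ.pd k) k) x
      have dU : ∀ (φ : EuclideanSpace ℝ (Fin n) → ℝ), Tst φ → Differentiable ℝ (He ρ φ) := fun φ hφ => Av_diff hφ
      have := claim2 (U := fun x => He ρ f x + ε) (W := fun x => He ρ g x + ε) hc h1 h2 h3 hχ k (fun x => hZq (ρ, x))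
        ((dU f hf).add_const ε) ((dU g hg).add_const ε) (by rw [pU f hf]; exact dU _ (hf.pd k))
        (by rw [pU g hg]; exact dU _ (hg.pd k))
        (by rw [pU2 f hf]; exact (dU _ (hf.pd2 k k)).continuous) (by rw [pU2 g hg]; exact (dU _ (hg.pd2 k k)).continuous)
      rw [pU f hf, pU g hg, pU2 f hf, pU2 g hg] at this
      exact this
    have s1 : ∀ x, χ x * (L (ρ, x) + Hs (ρ, x)) = ∑ k, χ x * (Qa (Z (ρ, x)) * He ρ (pd2 f k k) x + Qb (Z (ρ, x)) * He ρ (pd2 g k k) x +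
        (Qaa (Z (ρ, x)) * He ρ (pd f k) x ^ 2 + 2 * Qab (Z (ρ, x)) * He ρ (pd f k) x * He ρ (pd g k) x
        + Qbb (Z (ρ, x)) * He ρ (pd g k) x ^ 2)) := by
      intro x
      simp only [L, Hs, He_lap hf, He_lap hg]
      simp only [Finset.mul_sum, Finset.sum_add_distrib, mul_add]
    have s2 : ∀ x, lap χ x * Q (Z (ρ, x)) = ∑ k, pd2 χ k k x * Q (Z (ρ, x)) := by
      intro x; unfold lap; rw [Finset.sum_mul]
    simp only [s1, s2]
    rw [integral_finsetSum, integral_finsetSum]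
    · exact Finset.sum_congr rfl fun k _ => key k
    · intro k _
      exact ((hχ.pd2 k k).cont.mul (cQ0.comp cx)).integrable_of_hasCompactSupport ((hχ.pd2 k k).2.mul_right)
    · intro k _
      refine Continuous.integrable_of_hasCompactSupport (hχ.cont.mul ?_) hχ.2.mul_right
      have ch : ∀ {φ : EuclideanSpace ℝ (Fin n) → ℝ}, Tst φ → Continuous fun x => He ρ φ x := fun hφ => (He_contT hφ).comp cx
      exact (((cQa.comp cx).mul (ch (hf.pd2 k k))).add ((cQb.comp cx).mul (ch (hg.pd2 k k)))).add
        (((((cQaa.comp cx).mul ((ch (hf.pd k)).pow 2)).add (((continuous_const.mul (cQab.comp cx)).mul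
        (ch (hf.pd k))).mul (ch (hg.pd k))))).add ((cQbb.comp cx).mul ((ch (hg.pd k)).pow 2)))
  have cP : Continuous fun z : ℝ × EuclideanSpace ℝ (Fin n) => (He z.1 f z.2 + ε) ^ p + (He z.1 g z.2 + ε) ^ q :=
    (((He_contT hf).add continuous_const).rpow_const fun z => Or.inr hpq.nonneg).add
      (((He_contT hg).add continuous_const).rpow_const fun z => Or.inr hpq.symm.nonneg)
  have hpos : ∀ᵐ z : ℝ × EuclideanSpace ℝ (Fin n) ∂((volume.restrict (Set.Ioc 0 T)).prod volume), 0 ≤ z.1 := by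
    have : (volume.restrict (Set.Ioc 0 T)).prod (volume : Measure (EuclideanSpace ℝ (Fin n))) =
        (volume.prod volume).restrict (Set.Ioc 0 T ×ˢ Set.univ) := by
      rw [← Measure.prod_restrict, Measure.restrict_univ]
    rw [this]
    filter_upwards [ae_restrict_mem (measurableSet_Ioc.prod MeasurableSet.univ)] with z hz
    exact hz.1.1.le
  have E3 : ∫ z : ℝ × EuclideanSpace ℝ (Fin n), z.1 * (χ z.2 * (|He z.1 (pd f i) z.2| * |He z.1 (pd g j) z.2|))
        ∂((volume.restrict (Set.Ioc 0 T)).prod volume) ≤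
        4 * ∫ z, z.1 * (χ z.2 * Hs z) ∂((volume.restrict (Set.Ioc 0 T)).prod volume) := by
    rw [← integral_const_mul]
    refine integral_mono_ae ?_ (I2.const_mul 4) ?_
    · exact int_strip (cρ.mul (cχ.mul ((He_contT (hf.pd i)).abs.mul (He_contT (hg.pd j)).abs))) hχ.2 (fun z hz => by simp [out _ hz]) T
    · filter_upwards [hpos] with z hz
      obtain ⟨τ, hτ, hq⟩ := hh _ (hZq z)
      have := hess_low hτ hq (fun k => He z.1 (pd f k) z.2) (fun k => He z.1 (pd g k) z.2) i j
      have := mul_le_mul_of_nonneg_left this (mul_nonneg hz (hχ0 z.2))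
      simp only [Hs]
      linarith
  have E4 : ∫ z, z.1 * (lap χ z.2 * Q (Z z)) ∂((volume.restrict (Set.Ioc 0 T)).prod volume) ≤
      M * ∫ z : ℝ × EuclideanSpace ℝ (Fin n), z.1 * (|lap χ z.2| * ((He z.1 f z.2 + ε) ^ p + (He z.1 g z.2 + ε) ^ q))
        ∂((volume.restrict (Set.Ioc 0 T)).prod volume) := by
    rw [← integral_const_mul]
    refine integral_mono_ae I3 (Integrable.const_mul ?_ M) ?_
    · exact int_strip (cρ.mul (cLχ.abs.mul cP)) hχ.lap.2 (fun z hz => by simp [outL _ hz]) T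
    · filter_upwards [hpos] with z hz
      obtain ⟨b0, b1⟩ := hb _ (hZq z)
      have := mul_le_mul (le_abs_self (lap χ z.2)) b1 b0 (abs_nonneg _)
      have := mul_le_mul_of_nonneg_left this hz
      simp only [Z] at this ⊢
      linarith
  have E5 : - (∫ x, χ x * (Q (Z (T, x)) - Q (Z (0, x)))) ≤ M * ∫ x, χ x * ((f x + ε) ^ p + (g x + ε) ^ q) := by
    rw [← integral_const_mul, ← integral_neg]
    have c0 : ∀ t : ℝ, Continuous fun x : EuclideanSpace ℝ (Fin n) => (t, x) := fun t => by fun_prop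
    refine integral_mono ?_ ?_ fun x => ?_
    · exact (Continuous.integrable_of_hasCompactSupport (hχ.cont.mul ((cQ0.comp (c0 T)).sub (cQ0.comp (c0 0)))) hχ.2.mul_right).neg
    · refine Integrable.const_mul (Continuous.integrable_of_hasCompactSupport (hχ.cont.mul ?_) hχ.2.mul_right) M
      have := cP.comp (c0 0)
      simpa [Function.comp_def, He_zero hf.cont, He_zero hg.cont] using this
    · obtain ⟨b0, -⟩ := hb _ (hZq (T, x))
      obtain ⟨-, b1⟩ := hb _ (hZq (0, x))
      have e : Z (0, x) = (f x + ε, g x + ε) := by simp [Z, He_zero hf.cont, He_zero hg.cont]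
      rw [e] at b1
      simp only [e]
      have a1 := mul_le_mul_of_nonneg_left b1 (hχ0 x)
      have a2 := mul_nonneg (hχ0 x) b0
      simp only at a1
      linarith
  linarith

end embed2

section embed3
variable {n : ℕ}

lemma add_rpow_le2 {a b r : ℝ} (ha : 0 ≤ a) (hb : 0 ≤ b) (hr : 0 ≤ r) :
    (a + b) ^ r ≤ 2 ^ r * (a ^ r + b ^ r) := by
  have h1 : (a + b) ^ r ≤ (2 * max a b) ^ r :=
    Real.rpow_le_rpow (by positivity) (by linarith [le_max_left a b, le_max_right a b]) hr
  rw [Real.mul_rpow (by norm_num) (by positivity)] at h1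
  refine h1.trans (mul_le_mul_of_nonneg_left ?_ (by positivity))
  have := Real.rpow_nonneg ha r
  have := Real.rpow_nonneg hb r
  rcases max_choice a b with h | h <;> rw [h] <;> linarith

lemma cutoff (R δ : ℝ) (hδ : 0 < δ) : ∃ χ : EuclideanSpace ℝ (Fin n) → ℝ, Tst χ ∧ (∀ x, 0 ≤ χ x) ∧
    (∀ x, χ x ≤ 1) ∧ (∀ x, ‖x‖ ≤ R → χ x = 1) ∧ ∀ x, |lap χ x| ≤ δ := by
  let b : ContDiffBump (0 : EuclideanSpace ℝ (Fin n)) := ⟨1, 2, by norm_num, by norm_num⟩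
  have hb : Tst (b : EuclideanSpace ℝ (Fin n) → ℝ) := ⟨b.contDiff, b.hasCompactSupport⟩
  obtain ⟨K, hK⟩ := hb.lap.bdd
  have hK0 : 0 ≤ K := (norm_nonneg _).trans (hK 0)
  obtain ⟨c, hc, hc1, hc2⟩ : ∃ c : ℝ, 0 < c ∧ c * R ≤ 1 ∧ c ^ 2 * K ≤ δ := by
    refine ⟨min 1 (min (1 / (|R| + 1)) (δ / (K + 1))), by positivity, ?_, ?_⟩
    · have h1 : min 1 (min (1 / (|R| + 1)) (δ / (K + 1))) ≤ 1 / (|R| + 1) :=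
        (min_le_right _ _).trans (min_le_left _ _)
      have h0 : 0 ≤ min 1 (min (1 / (|R| + 1)) (δ / (K + 1))) := by positivity
      calc _ ≤ min 1 (min (1 / (|R| + 1)) (δ / (K + 1))) * (|R| + 1) :=
            mul_le_mul_of_nonneg_left (by linarith [le_abs_self R]) h0
        _ ≤ 1 / (|R| + 1) * (|R| + 1) := mul_le_mul_of_nonneg_right h1 (by positivity)
        _ = 1 := by field_simp
    · have h1 : min 1 (min (1 / (|R| + 1)) (δ / (K + 1))) ≤ δ / (K + 1) :=
        (min_le_right _ _).trans (min_le_right _ _)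
      have h2 : min 1 (min (1 / (|R| + 1)) (δ / (K + 1))) ≤ 1 := min_le_left _ _
      have h0 : 0 ≤ min 1 (min (1 / (|R| + 1)) (δ / (K + 1))) := by positivity
      set c := min 1 (min (1 / (|R| + 1)) (δ / (K + 1)))
      calc c ^ 2 * K ≤ c * (K + 1) := by nlinarith [mul_nonneg h0 hK0]
        _ ≤ δ / (K + 1) * (K + 1) := mul_le_mul_of_nonneg_right h1 (by positivity)
        _ = δ := by field_simp
  have hs : ∀ (φ : EuclideanSpace ℝ (Fin n) → ℝ) (i : Fin n), pd (fun x => φ (c • x)) i = fun x => c * pd φ i (c • x) := by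
    intro φ i
    funext x
    unfold pd
    rw [fderiv_comp_smul]; simp
  have hs2 : ∀ (φ : EuclideanSpace ℝ (Fin n) → ℝ) (i : Fin n), pd (fun x => c * φ x) i = fun x => c * pd φ i x := by
    intro φ i
    funext x
    unfold pd
    have := congrFun (fderiv_const_smul_field (𝕜 := ℝ) (f := φ) c) x
    have h : fderiv ℝ (fun x => c * φ x) x = c • fderiv ℝ φ x := this
    rw [h]; simp
  refine ⟨fun x => b (c • x), ⟨b.contDiff.comp (contDiff_const_smul c), ?_⟩, fun x => b.nonneg, fun x => b.le_one, ?_, ?_⟩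
  · exact b.hasCompactSupport.comp_homeomorph (Homeomorph.smulOfNeZero c hc.ne')
  · intro x hx
    refine b.one_of_mem_closedBall ?_
    simp only [Metric.mem_closedBall, dist_zero_right, norm_smul, Real.norm_eq_abs, abs_of_pos hc, b]
    calc c * ‖x‖ ≤ c * R := mul_le_mul_of_nonneg_left hx hc.le
      _ ≤ 1 := hc1
  · intro x
    have : lap (fun x => b (c • x)) x = c ^ 2 * lap b (c • x) := by
      unfold lap
      rw [Finset.mul_sum]
      refine Finset.sum_congr rfl fun i _ => ?_
      unfold pd2
      rw [hs, hs2 (fun x => pd b i (c • x)), hs]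
      ring
    rw [this, abs_mul, abs_of_pos (by positivity)]
    exact (mul_le_mul_of_nonneg_left (hK _) (by positivity)).trans hc2

lemma ae_pos_strip (s : Set ℝ) (hs : MeasurableSet s) (h0 : ∀ x ∈ s, 0 ≤ x) : ∀ᵐ z : ℝ × EuclideanSpace ℝ (Fin n)
    ∂((volume.restrict s).prod volume), 0 ≤ z.1 := by
  have : (volume.restrict s).prod (volume : Measure (EuclideanSpace ℝ (Fin n))) =
      (volume.prod volume).restrict (s ×ˢ Set.univ) := by
    rw [← Measure.prod_restrict, Measure.restrict_univ]
  rw [this]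
  filter_upwards [ae_restrict_mem (hs.prod MeasurableSet.univ)] with z hz
  exact h0 _ hz.1

lemma embed_eps {p q : ℝ} (hpq : p.HolderConjugate q) (hp : 2 ≤ p) : ∃ M : ℝ, 0 < M ∧
    ∀ (f g χ : EuclideanSpace ℝ (Fin n) → ℝ), Tst f → Tst g → Tst χ →
      (∀ x, 0 ≤ f x) → (∀ x, 0 ≤ g x) → (∀ x, 0 ≤ χ x) → (∀ x, χ x ≤ 1) → ∀ (i j : Fin n) (T δ : ℝ), 0 ≤ T →
      (∀ x, |lap χ x| ≤ δ) → T ^ 2 * δ ≤ 1 →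
      ∫ z : ℝ × EuclideanSpace ℝ (Fin n), z.1 * (χ z.2 * (|He z.1 (pd f i) z.2| * |He z.1 (pd g j) z.2|))
        ∂((volume.restrict (Set.Ioc 0 T)).prod volume) ≤
      M * ((∫ x, |f x| ^ p) + ∫ x, |g x| ^ q) := by
  obtain ⟨M, hM, H⟩ := embed_loc (n := n) hpq hp
  refine ⟨M * ((2 ^ p + 2 ^ q) * 2), by positivity, ?_⟩
  intro f g χ hf hg hχ hf0 hg0 hχ0 hχ1 i j T δ hT hδ hTδ
  set A := (∫ x, |f x| ^ p) + ∫ x, |g x| ^ q with hA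
  have hA0 : 0 ≤ A := add_nonneg (integral_nonneg fun x => by positivity) (integral_nonneg fun x => by positivity)
  have hδ0 : 0 ≤ δ := (abs_nonneg _).trans (hδ 0)
  set S : ℝ := 2 ^ p + 2 ^ q with hS
  have hS0 : 0 < S := by positivity
  have hp0 : 0 < p := hpq.pos
  have hq0 : 0 < q := hpq.symm.pos
  have hp1 : 1 ≤ p := hpq.lt.le
  have hq1 : 1 ≤ q := hpq.symm.lt.le
  have pw : ∀ a b ε : ℝ, 0 ≤ a → 0 ≤ b → 0 < ε → (a + ε) ^ p + (b + ε) ^ q ≤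
      S * ((|a| ^ p + |b| ^ q) + (ε ^ p + ε ^ q)) := by
    intro a b ε ha hb hε
    have h1 := add_rpow_le2 ha hε.le hp0.le
    have h2 := add_rpow_le2 hb hε.le hq0.le
    rw [abs_of_nonneg ha, abs_of_nonneg hb]
    have h3 : 0 ≤ (2 : ℝ) ^ p * (b ^ q + ε ^ q) := by positivity
    have h4 : 0 ≤ (2 : ℝ) ^ q * (a ^ p + ε ^ p) := by positivity
    rw [hS]
    linarith
  let N1 := ∫ x, χ x
  let N2 := ∫ x, |lap χ x|
  have key : ∀ ε : ℝ, 0 < ε → ∫ z : ℝ × EuclideanSpace ℝ (Fin n), z.1 * (χ z.2 * (|He z.1 (pd f i) z.2| * |He z.1 (pd g j) z.2|))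
        ∂((volume.restrict (Set.Ioc 0 T)).prod volume) ≤ M * (S * (A + (ε ^ p + ε ^ q) * N1) + S * (A + (ε ^ p + ε ^ q) * (T ^ 2 * N2))) := by
    intro ε hε
    refine (H f g χ hf hg hχ hf0 hg0 hχ0 i j ε T hε hT).trans (mul_le_mul_of_nonneg_left (add_le_add ?_ ?_) hM.le)
    · have iA := (hf.integrable_rpow hp0).fun_add (hg.integrable_rpow hq0)
      have e : S * (A + (ε ^ p + ε ^ q) * N1) = ∫ x, S * ((|f x| ^ p + |g x| ^ q) + (ε ^ p + ε ^ q) * χ x) := by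
        rw [integral_const_mul, integral_add iA (hχ.integrable.const_mul _), integral_add (hf.integrable_rpow hp0) (hg.integrable_rpow hq0),
          integral_const_mul]
      rw [e]
      refine integral_mono ?_ ((Integrable.fun_add iA (hχ.integrable.const_mul _)).const_mul S) fun x => ?_
      · refine Continuous.integrable_of_hasCompactSupport (hχ.cont.mul ?_) hχ.2.mul_right
        exact ((hf.cont.add continuous_const).rpow_const fun z => Or.inr hp0.le).add
          ((hg.cont.add continuous_const).rpow_const fun z => Or.inr hq0.le)
      · have h1 := mul_le_mul_of_nonneg_left (pw _ _ ε (hf0 x) (hg0 x) hε) (hχ0 x)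
        have h2 : χ x * (S * (|f x| ^ p + |g x| ^ q)) ≤ 1 * (S * (|f x| ^ p + |g x| ^ q)) :=
          mul_le_mul_of_nonneg_right (hχ1 x) (by positivity)
        simp only
        linarith
    · have cP : Continuous fun z : ℝ × EuclideanSpace ℝ (Fin n) => (He z.1 f z.2 + ε) ^ p + (He z.1 g z.2 + ε) ^ q :=
        (((He_contT hf).add continuous_const).rpow_const fun z => Or.inr hp0.le).add
          (((He_contT hg).add continuous_const).rpow_const fun z => Or.inr hq0.le)
      have cLχ : Continuous fun z : ℝ × EuclideanSpace ℝ (Fin n) => lap χ z.2 := hχ.lap.cont.comp continuous_snd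
      have I : Integrable (fun z : ℝ × EuclideanSpace ℝ (Fin n) => z.1 * (|lap χ z.2| * ((He z.1 f z.2 + ε) ^ p + (He z.1 g z.2 + ε) ^ q)))
          ((volume.restrict (Set.Ioc 0 T)).prod volume) :=
        int_strip (continuous_fst.mul (cLχ.abs.mul cP)) hχ.lap.2
          (fun z hz => by simp [image_eq_zero_of_notMem_tsupport hz]) T
      rw [integral_prod _ I]
      have hN2 : 0 ≤ N2 := integral_nonneg fun x => abs_nonneg _
      have b1 : ∀ ρ ∈ Set.Ioc 0 T, ‖∫ x, ρ * (|lap χ x| * ((He ρ f x + ε) ^ p + (He ρ g x + ε) ^ q))‖ ≤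
          T * (S * (δ * A + (ε ^ p + ε ^ q) * N2)) := by
        intro ρ hρ
        have hpos : ∀ x, 0 ≤ |lap χ x| * ((He ρ f x + ε) ^ p + (He ρ g x + ε) ^ q) := fun x => by
          have := He_nonneg hf0 ρ x
          have := He_nonneg hg0 ρ x
          positivity
        rw [integral_const_mul, norm_mul, Real.norm_of_nonneg hρ.1.le, Real.norm_of_nonneg (integral_nonneg hpos)]
        refine mul_le_mul hρ.2 ?_ (integral_nonneg hpos) hT
        obtain ⟨if1, if2⟩ := Av_Lp (μ := gam n ρ) hf hp1
        obtain ⟨ig1, ig2⟩ := Av_Lp (μ := gam n ρ) hg hq1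
        change Integrable (fun x => |He ρ f x| ^ p) at if1
        change Integrable (fun x => |He ρ g x| ^ q) at ig1
        change ∫ x, |He ρ f x| ^ p ≤ _ at if2
        change ∫ x, |He ρ g x| ^ q ≤ _ at ig2
        have iA := if1.fun_add ig1
        have e : S * (δ * ((∫ x, |He ρ f x| ^ p) + ∫ x, |He ρ g x| ^ q) + (ε ^ p + ε ^ q) * N2)
            = ∫ x, S * (δ * (|He ρ f x| ^ p + |He ρ g x| ^ q) + (ε ^ p + ε ^ q) * |lap χ x|) := by
          rw [integral_const_mul, integral_add (iA.const_mul δ) (hχ.lap.integrable.abs.const_mul _), integral_const_mul,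
            integral_add if1 ig1, integral_const_mul]
        have e2 : S * (δ * ((∫ x, |He ρ f x| ^ p) + ∫ x, |He ρ g x| ^ q) + (ε ^ p + ε ^ q) * N2) ≤
            S * (δ * A + (ε ^ p + ε ^ q) * N2) := by
          have := mul_le_mul_of_nonneg_left (add_le_add if2 ig2) hδ0
          exact mul_le_mul_of_nonneg_left (by linarith) hS0.le
        refine le_trans ?_ e2
        rw [e]
        refine integral_mono ?_ ((Integrable.fun_add (iA.const_mul δ) (hχ.lap.integrable.abs.const_mul _)).const_mul S) fun x => ?_
        · exact Continuous.integrable_of_hasCompactSupport (hχ.lap.cont.abs.mul (cP.comp (by fun_prop : Continuous fun x => (ρ, x))))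
            (HasCompactSupport.mul_right (hχ.lap.2.comp_left (g := fun t : ℝ => |t|) (by simp)))
        · have h1 := mul_le_mul_of_nonneg_left (pw _ _ ε (He_nonneg hf0 ρ x) (He_nonneg hg0 ρ x) hε) (abs_nonneg (lap χ x))
          have h2 : |lap χ x| * (S * (|He ρ f x| ^ p + |He ρ g x| ^ q)) ≤ δ * (S * (|He ρ f x| ^ p + |He ρ g x| ^ q)) :=
            mul_le_mul_of_nonneg_right (hδ x) (by positivity)
          simp only
          linarith
      have b2 := norm_setIntegral_le_of_norm_le_const (μ := volume) (s := Set.Ioc 0 T) (by simp) b1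
      refine ((le_abs_self _).trans b2).trans ?_
      simp only [Measure.real, Real.volume_Ioc, sub_zero, ENNReal.toReal_ofReal hT]
      have := mul_le_mul_of_nonneg_right hTδ (mul_nonneg hS0.le hA0)
      linarith
  have lim : Filter.Tendsto (fun ε : ℝ => M * (S * (A + (ε ^ p + ε ^ q) * N1) + S * (A + (ε ^ p + ε ^ q) * (T ^ 2 * N2))))
      (nhdsWithin 0 (Set.Ioi 0)) (nhds (M * (S * (A + ((0:ℝ) ^ p + (0:ℝ) ^ q) * N1) + S * (A + ((0:ℝ) ^ p + (0:ℝ) ^ q) * (T ^ 2 * N2))))) := by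
    refine (Continuous.tendsto ?_ 0).mono_left nhdsWithin_le_nhds
    have c1 : Continuous fun ε : ℝ => ε ^ p := continuous_id.rpow_const fun z => Or.inr hp0.le
    have c2 : Continuous fun ε : ℝ => ε ^ q := continuous_id.rpow_const fun z => Or.inr hq0.le
    fun_prop
  have := ge_of_tendsto lim (by filter_upwards [self_mem_nhdsWithin] with ε hε using key ε hε)
  rw [Real.zero_rpow hp0.ne', Real.zero_rpow hq0.ne'] at this
  linarith

lemma embed_lim {p q : ℝ} (hpq : p.HolderConjugate q) (hp : 2 ≤ p) : ∃ M : ℝ, 0 < M ∧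
    ∀ (f g : EuclideanSpace ℝ (Fin n) → ℝ), Tst f → Tst g →
      (∀ x, 0 ≤ f x) → (∀ x, 0 ≤ g x) → ∀ (i j : Fin n),
      Integrable (fun z : ℝ × EuclideanSpace ℝ (Fin n) => z.1 * (|He z.1 (pd f i) z.2| * |He z.1 (pd g j) z.2|))
        ((volume.restrict (Set.Ioi 0)).prod volume) ∧
      ∫ z : ℝ × EuclideanSpace ℝ (Fin n), z.1 * (|He z.1 (pd f i) z.2| * |He z.1 (pd g j) z.2|)
        ∂((volume.restrict (Set.Ioi 0)).prod volume) ≤ M * ((∫ x, |f x| ^ p) + ∫ x, |g x| ^ q) := by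
  obtain ⟨M, hM, H⟩ := embed_eps (n := n) hpq hp
  refine ⟨M, hM, ?_⟩
  intro f g hf hg hf0 hg0 i j
  set ν := (volume.restrict (Set.Ioi (0:ℝ))).prod (volume : Measure (EuclideanSpace ℝ (Fin n)))
  let φ : ℕ → Set (ℝ × EuclideanSpace ℝ (Fin n)) := fun k => Set.Iic (k : ℝ) ×ˢ Metric.ball 0 k
  have hφ : AECover ν Filter.atTop φ := by
    refine ⟨Filter.Eventually.of_forall fun z => ?_, fun k => measurableSet_Iic.prod measurableSet_ball⟩
    obtain ⟨N, hN⟩ := exists_nat_gt (max z.1 ‖z.2‖)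
    filter_upwards [Filter.eventually_ge_atTop N] with k hk
    have hk' : (N : ℝ) ≤ k := by exact_mod_cast hk
    refine ⟨?_, ?_⟩
    · simp only [Set.mem_Iic]; linarith [le_max_left z.1 ‖z.2‖]
    · simp only [Metric.mem_ball, dist_zero_right]; linarith [le_max_right z.1 ‖z.2‖]
  have hr : ∀ k : ℕ, ν.restrict (φ k) = ((volume.restrict (Set.Ioc (0:ℝ) k)).prod
      (volume : Measure (EuclideanSpace ℝ (Fin n)))).restrict (Set.univ ×ˢ Metric.ball 0 (k:ℝ)) := by
    intro k
    simp only [ν, φ]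
    rw [← Measure.restrict_univ (μ := (volume : Measure (EuclideanSpace ℝ (Fin n)))), ← Measure.prod_restrict]
    rw [← Measure.prod_restrict]
    simp only [Measure.restrict_univ, Measure.restrict_restrict measurableSet_Iic]
    congr 2
    ext x; simp [and_comm]
  let G : ℝ × EuclideanSpace ℝ (Fin n) → ℝ := fun z => z.1 * (|He z.1 (pd f i) z.2| * |He z.1 (pd g j) z.2|)
  have cG : Continuous G := continuous_fst.mul ((He_contT (hf.pd i)).abs.mul (He_contT (hg.pd j)).abs)
  have hG0 : ∀ᵐ z ∂ν, 0 ≤ G z := by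
    filter_upwards [ae_pos_strip (n := n) (Set.Ioi 0) measurableSet_Ioi fun x hx => le_of_lt hx] with z hz
    simp only [G]
    positivity
  have step : ∀ k : ℕ, IntegrableOn G (φ k) ν ∧ ∫ z in φ k, G z ∂ν ≤ M * ((∫ x, |f x| ^ p) + ∫ x, |g x| ^ q) := by
    intro k
    obtain ⟨χ, hχ, h0, h1, hR, hδ⟩ := cutoff (n := n) k (1 / ((k:ℝ) ^ 2 + 1)) (by positivity)
    have := H f g χ hf hg hχ hf0 hg0 h0 h1 i j k _ (Nat.cast_nonneg k) hδ (by
      rw [mul_one_div, div_le_one (by positivity)]; linarith)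
    have Iχ : Integrable (fun z : ℝ × EuclideanSpace ℝ (Fin n) => z.1 * (χ z.2 * (|He z.1 (pd f i) z.2| * |He z.1 (pd g j) z.2|)))
        ((volume.restrict (Set.Ioc (0:ℝ) k)).prod volume) :=
      int_strip (continuous_fst.mul ((hχ.cont.comp continuous_snd).mul ((He_contT (hf.pd i)).abs.mul (He_contT (hg.pd j)).abs)))
        hχ.2 (fun z hz => by simp [image_eq_zero_of_notMem_tsupport hz]) k
    have hms : MeasurableSet (Set.univ ×ˢ Metric.ball 0 (k:ℝ) : Set (ℝ × EuclideanSpace ℝ (Fin n))) :=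
      MeasurableSet.univ.prod measurableSet_ball
    have heq : Set.EqOn (fun z : ℝ × EuclideanSpace ℝ (Fin n) => z.1 * (χ z.2 * (|He z.1 (pd f i) z.2| * |He z.1 (pd g j) z.2|))) G
        (Set.univ ×ˢ Metric.ball 0 (k:ℝ)) := by
      rintro z ⟨-, hz⟩
      simp only [Metric.mem_ball, dist_zero_right] at hz
      simp [G, hR z.2 hz.le]
    constructor
    · unfold IntegrableOn
      rw [hr k]
      exact (Iχ.integrableOn (s := Set.univ ×ˢ Metric.ball 0 (k:ℝ))).congr_fun heq hms
    · rw [hr k]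
      rw [← setIntegral_congr_fun hms heq]
      refine le_trans (setIntegral_le_integral Iχ ?_) this
      filter_upwards [ae_pos_strip (n := n) (Set.Ioc 0 k) measurableSet_Ioc fun x hx => le_of_lt hx.1] with z hz
      have := h0 z.2
      simp only [Pi.zero_apply]
      positivity
  have hI : Integrable G ν := by
    refine hφ.integrable_of_integral_norm_bounded (M * ((∫ x, |f x| ^ p) + ∫ x, |g x| ^ q)) (fun k => (step k).1) (Filter.Eventually.of_forall fun k => ?_)
    refine le_trans (le_of_eq ?_) (step k).2
    refine integral_congr_ae ?_
    filter_upwards [ae_restrict_of_ae hG0] with z hz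
    exact Real.norm_of_nonneg hz
  exact ⟨hI, le_of_tendsto (hφ.integral_tendsto_of_countably_generated hI) (Filter.Eventually.of_forall fun k => (step k).2)⟩

end embed3

section embed4
variable {n : ℕ}

lemma pd_cmul {f : EuclideanSpace ℝ (Fin n) → ℝ} (hf : Tst f) (c : ℝ) (i : Fin n) :
    pd (fun x => c * f x) i = fun x => c * pd f i x := by
  funext x
  unfold pd
  rw [fderiv_const_mul (hf.diff x)]
  simp

lemma Tst.cmul {f : EuclideanSpace ℝ (Fin n) → ℝ} (hf : Tst f) (c : ℝ) : Tst (fun x => c * f x) :=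
  ⟨contDiff_const.mul hf.1, hf.2.mul_left⟩

lemma He_cmul (f : EuclideanSpace ℝ (Fin n) → ℝ) (ρ c : ℝ) (x) :
    He ρ (fun x => c * f x) x = c * He ρ f x := by
  unfold He Av
  exact integral_const_mul _ _

lemma embed_all {p q : ℝ} (hpq : p.HolderConjugate q) : ∃ M : ℝ, 0 < M ∧
    ∀ f g : EuclideanSpace ℝ (Fin n) → ℝ, Tst f → Tst g → (∀ x, 0 ≤ f x) → (∀ x, 0 ≤ g x) → ∀ i j,
      Integrable (fun z : ℝ × EuclideanSpace ℝ (Fin n) => z.1 * (|He z.1 (pd f i) z.2| * |He z.1 (pd g j) z.2|))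
        ((volume.restrict (Set.Ioi 0)).prod volume) ∧
      ∫ z : ℝ × EuclideanSpace ℝ (Fin n), z.1 * (|He z.1 (pd f i) z.2| * |He z.1 (pd g j) z.2|)
        ∂((volume.restrict (Set.Ioi 0)).prod volume) ≤ M * ((∫ x, |f x| ^ p) + ∫ x, |g x| ^ q) := by
  by_cases h2 : 2 ≤ p
  · exact embed_lim hpq h2
  · have hq : 2 ≤ q := by
      have h := hpq.mul_eq_add
      have := hpq.lt
      push Not at h2
      nlinarith
    obtain ⟨M, hM, H⟩ := embed_lim (n := n) hpq.symm hq
    refine ⟨M, hM, fun f g hf hg hf0 hg0 i j => ?_⟩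
    have := H g f hg hf hg0 hf0 j i
    simp only [mul_comm |He _ (pd f i) _|]
    rw [add_comm (∫ x, |f x| ^ p)]
    exact this

lemma embed_bil {p q : ℝ} (hpq : p.HolderConjugate q) : ∃ M : ℝ, 0 < M ∧
    ∀ f g : EuclideanSpace ℝ (Fin n) → ℝ, Tst f → Tst g → (∀ x, 0 ≤ f x) → (∀ x, 0 ≤ g x) → ∀ i j,
      Integrable (fun z : ℝ × EuclideanSpace ℝ (Fin n) => z.1 * (|He z.1 (pd f i) z.2| * |He z.1 (pd g j) z.2|))
        ((volume.restrict (Set.Ioi 0)).prod volume) ∧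
      ∫ z : ℝ × EuclideanSpace ℝ (Fin n), z.1 * (|He z.1 (pd f i) z.2| * |He z.1 (pd g j) z.2|)
        ∂((volume.restrict (Set.Ioi 0)).prod volume) ≤
          M * ((∫ x, |f x| ^ p) ^ (1/p) * (∫ x, |g x| ^ q) ^ (1/q)) := by
  obtain ⟨M, hM, H⟩ := embed_all (n := n) hpq
  refine ⟨2 * M, by positivity, fun f g hf hg hf0 hg0 i j => ⟨(H f g hf hg hf0 hg0 i j).1, ?_⟩⟩
  set I := ∫ z : ℝ × EuclideanSpace ℝ (Fin n), z.1 * (|He z.1 (pd f i) z.2| * |He z.1 (pd g j) z.2|)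
        ∂((volume.restrict (Set.Ioi 0)).prod volume) with hI
  have key : ∀ (r : ℝ) (hr : 0 < r) (f : EuclideanSpace ℝ (Fin n) → ℝ) (s : ℝ), (∫ x, |f x| ^ r) ^ (1/r) < s → 0 < s →
      ∫ x, |s⁻¹ * f x| ^ r ≤ 1 := by
    intro r hr f s h1 hs
    have h0 : 0 ≤ ∫ x, |f x| ^ r := integral_nonneg fun x => by positivity
    have : (∫ x, |f x| ^ r) ≤ s ^ r := by
      have := Real.rpow_le_rpow (by positivity) h1.le hr.le
      rwa [← Real.rpow_mul h0, one_div, inv_mul_cancel₀ hr.ne', Real.rpow_one] at this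
    simp_rw [abs_mul, abs_of_pos (inv_pos.2 hs), Real.mul_rpow (inv_pos.2 hs).le (abs_nonneg _)]
    rw [integral_const_mul, Real.inv_rpow hs.le]
    have := Real.rpow_pos_of_pos hs r
    rw [inv_mul_le_iff₀ this]; linarith
  set α := (∫ x, |f x| ^ p) ^ (1/p) with hα
  set β := (∫ x, |g x| ^ q) ^ (1/q) with hβ
  have hα0 : 0 ≤ α := by have : 0 ≤ ∫ x, |f x| ^ p := integral_nonneg fun x => by positivity
                         positivity
  have hβ0 : 0 ≤ β := by have : 0 ≤ ∫ x, |g x| ^ q := integral_nonneg fun x => by positivity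
                         positivity
  have main : ∀ ε : ℝ, 0 < ε → I ≤ 2 * M * ((α + ε) * (β + ε)) := by
    intro ε hε
    have hs : 0 < α + ε := by positivity
    have ht : 0 < β + ε := by positivity
    have h := (H _ _ (hf.cmul (α+ε)⁻¹) (hg.cmul (β+ε)⁻¹) (fun x => mul_nonneg (by positivity) (hf0 x))
      (fun x => mul_nonneg (by positivity) (hg0 x)) i j).2
    have k1 := key p hpq.pos f (α+ε) (by linarith) hs
    have k2 := key q hpq.symm.pos g (β+ε) (by linarith) ht
    have e : ∀ z : ℝ × EuclideanSpace ℝ (Fin n), z.1 * (|He z.1 (pd (fun x => (α+ε)⁻¹ * f x) i) z.2| * |He z.1 (pd (fun x => (β+ε)⁻¹ * g x) j) z.2|)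
       = ((α+ε)⁻¹ * (β+ε)⁻¹) * (z.1 * (|He z.1 (pd f i) z.2| * |He z.1 (pd g j) z.2|)) := by
      intro z
      rw [pd_cmul hf, pd_cmul hg, He_cmul, He_cmul, abs_mul, abs_mul, abs_of_pos (inv_pos.2 hs), abs_of_pos (inv_pos.2 ht)]
      ring
    simp only [e] at h
    rw [integral_const_mul, ← hI] at h
    have h' : (α+ε)⁻¹ * (β+ε)⁻¹ * I ≤ M * 2 := h.trans (by gcongr; linarith)
    rw [← mul_inv, inv_mul_le_iff₀ (by positivity)] at h'
    linarith
  have ht : Filter.Tendsto (fun ε : ℝ => 2 * M * ((α + ε) * (β + ε))) (nhdsWithin 0 (Set.Ioi 0)) (nhds (2 * M * ((α + 0) * (β + 0)))) := by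
    apply tendsto_nhdsWithin_of_tendsto_nhds
    exact Continuous.tendsto (by fun_prop) 0
  have := ge_of_tendsto ht (Filter.eventually_of_mem self_mem_nhdsWithin fun ε hε => main ε hε)
  simpa using this
end embed4

section resolv
variable {n : ℕ}

noncomputable def kd (ρ : ℝ) : ℝ := 2 * ρ * Real.exp (-ρ ^ 2)

lemma kd_cont : Continuous kd := by unfold kd; fun_prop

lemma kd_deriv (ρ : ℝ) : HasDerivAt (fun ρ : ℝ => - Real.exp (-ρ ^ 2)) (kd ρ) ρ := by
  have h : HasDerivAt (fun ρ : ℝ => -ρ^2) (-(2 * ρ)) ρ := by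
    have := (hasDerivAt_pow 2 ρ).fun_neg
    convert! this using 1
    norm_num
  have := h.exp.neg
  convert! this using 1
  unfold kd; ring

lemma exp_sq_tendsto : Filter.Tendsto (fun ρ : ℝ => Real.exp (-ρ ^ 2)) Filter.atTop (nhds 0) := by
  refine Real.tendsto_exp_neg_atTop_nhds_zero.comp ?_
  exact Filter.tendsto_pow_atTop two_ne_zero

lemma kd_nonneg {ρ : ℝ} (h : ρ ∈ Set.Ioi (0:ℝ)) : 0 ≤ kd ρ := by
  have : 0 < ρ := h
  unfold kd; positivity

lemma kd_int : IntegrableOn kd (Set.Ioi 0) :=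
  integrableOn_Ioi_deriv_of_nonneg' (fun x _ => kd_deriv x) (fun _ h => kd_nonneg h)
    (l := 0) (by simpa using exp_sq_tendsto.neg)

lemma kd_integral : ∫ ρ in Set.Ioi 0, kd ρ = 1 := by
  rw [integral_Ioi_of_hasDerivAt_of_nonneg' (fun x _ => kd_deriv x) (fun _ h => kd_nonneg h)
    (l := 0) (by simpa using exp_sq_tendsto.neg)]
  simp

noncomputable def kap : Measure ℝ := (volume.restrict (Set.Ioi 0)).withDensity (fun ρ => ENNReal.ofReal (kd ρ))

instance : IsProbabilityMeasure kap := by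
  constructor
  unfold kap
  rw [withDensity_apply _ MeasurableSet.univ, Measure.restrict_univ, ← ofReal_integral_eq_lintegral_ofReal kd_int, kd_integral]
  · simp
  · filter_upwards [ae_restrict_mem measurableSet_Ioi] with x hx using kd_nonneg hx

lemma integral_kap (F : ℝ → ℝ) : ∫ ρ, F ρ ∂kap = ∫ ρ in Set.Ioi 0, kd ρ * F ρ := by
  unfold kap
  rw [integral_withDensity_eq_integral_toReal_smul kd_cont.measurable.ennreal_ofReal (by simp)]
  refine setIntegral_congr_fun measurableSet_Ioi fun x hx => ?_
  simp [ENNReal.toReal_ofReal (kd_nonneg hx)]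

noncomputable def res (n : ℕ) : Measure (EuclideanSpace ℝ (Fin n)) :=
  (kap.prod ((gm n).prod (gm n))).map (fun ω => ω.1 • (ω.2.1 + ω.2.2))

lemma res_cont : Continuous (fun ω : ℝ × (EuclideanSpace ℝ (Fin n) × EuclideanSpace ℝ (Fin n)) => ω.1 • (ω.2.1 + ω.2.2)) := by
  fun_prop

instance : IsProbabilityMeasure (res n) :=
  Measure.isProbabilityMeasure_map res_cont.measurable.aemeasurable

lemma Av_res {ψ : EuclideanSpace ℝ (Fin n) → ℝ} (hψ : Tst ψ) (x) :
    Av (res n) ψ x = ∫ ρ in Set.Ioi 0, kd ρ * He ρ (He ρ ψ) x := by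
  unfold Av res
  have hc : Continuous fun y => ψ (x + y) := hψ.cont.comp (continuous_const.add continuous_id)
  obtain ⟨D, hD⟩ := hψ.bdd
  rw [integral_map res_cont.measurable.aemeasurable hc.aestronglyMeasurable, integral_prod, integral_kap]
  · simp only [HeHe_eq hψ]
  · exact integrable_of_bdd (hc.comp res_cont) (fun _ => hD _)

lemma HeHe_cont {ψ : EuclideanSpace ℝ (Fin n) → ℝ} (hψ : Tst ψ) :
    Continuous (fun z : ℝ × EuclideanSpace ℝ (Fin n) => He z.1 (He z.1 ψ) z.2) := by
  simp only [HeHe_eq hψ]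
  obtain ⟨D, hD⟩ := hψ.bdd
  refine continuous_of_dominated (bound := fun _ => D) ?_ ?_ (integrable_const _) ?_
  · intro z; exact (hψ.cont.comp (by fun_prop)).aestronglyMeasurable
  · intro z; exact Filter.Eventually.of_forall fun _ => hD _
  · exact Filter.Eventually.of_forall fun _ => hψ.cont.comp (by fun_prop)

lemma HeHe_bdd {ψ : EuclideanSpace ℝ (Fin n) → ℝ} {D : ℝ} (hD : ∀ x, ‖ψ x‖ ≤ D) (ρ x) :
    ‖He ρ (He ρ ψ) x‖ ≤ D := Av_bdd (fun y => Av_bdd hD y) x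

lemma kd_mul_int {ψ : EuclideanSpace ℝ (Fin n) → ℝ} (hψ : Tst ψ) (x) :
    IntegrableOn (fun ρ => kd ρ * He ρ (He ρ ψ) x) (Set.Ioi 0) := by
  obtain ⟨D, hD⟩ := hψ.bdd
  refine Integrable.mul_bdd (c := D) kd_int ?_ ?_
  · exact ((HeHe_cont hψ).comp (Continuous.prodMk continuous_id continuous_const)).aestronglyMeasurable
  · exact Filter.Eventually.of_forall fun ρ => HeHe_bdd hD ρ x

lemma res_id {ψ : EuclideanSpace ℝ (Fin n) → ℝ} (hψ : Tst ψ) (x) :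
    ψ x = Av (res n) ψ x - Av (res n) (lap ψ) x := by
  rw [Av_res hψ, Av_res hψ.lap, ← integral_sub (kd_mul_int hψ x) (kd_mul_int hψ.lap x)]
  obtain ⟨D, hD⟩ := hψ.bdd
  have h := integral_Ioi_of_hasDerivAt_of_tendsto' (a := 0) (m := 0)
    (f := fun ρ => - Real.exp (-ρ ^ 2) * He ρ (He ρ ψ) x)
    (f' := fun ρ => kd ρ * He ρ (He ρ ψ) x - kd ρ * He ρ (He ρ (lap ψ)) x) ?_ ((kd_mul_int hψ x).sub (kd_mul_int hψ.lap x)) ?_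
  · rw [h]
    rw [He_zero (f := He 0 ψ) (Av_cont hψ.cont hD), He_zero hψ.cont]
    simp
  · intro ρ _
    have := (kd_deriv ρ).fun_mul (HeHe_deriv hψ ρ x)
    convert! this using 1
    unfold kd; ring
  · have h1 : Filter.Tendsto (fun ρ : ℝ => Real.exp (-ρ ^ 2) * D) Filter.atTop (nhds 0) := by
      simpa using exp_sq_tendsto.mul_const D
    refine squeeze_zero_norm (fun ρ => ?_) h1
    rw [norm_mul, norm_neg, Real.norm_of_nonneg (Real.exp_pos _).le]
    exact mul_le_mul_of_nonneg_left (HeHe_bdd hD ρ x) (Real.exp_pos _).le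

lemma HeHe_pd {g : EuclideanSpace ℝ (Fin n) → ℝ} (hg : Tst g) (i) (ρ : ℝ) :
    He ρ (He ρ (pd g i)) = pd (He ρ (He ρ g)) i ∧ Differentiable ℝ (He ρ (He ρ g)) := by
  let μ2 : Measure (EuclideanSpace ℝ (Fin n)) := ((gm n).prod (gm n)).map (fun ω => ρ • (ω.1 + ω.2))
  have hm : Continuous (fun ω : EuclideanSpace ℝ (Fin n) × EuclideanSpace ℝ (Fin n) => ρ • (ω.1 + ω.2)) := by fun_prop
  have : IsProbabilityMeasure μ2 := Measure.isProbabilityMeasure_map hm.measurable.aemeasurable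
  have e : ∀ {f : EuclideanSpace ℝ (Fin n) → ℝ}, Tst f → He ρ (He ρ f) = Av μ2 f := by
    intro f hf
    funext x
    have hc : Continuous fun y => f (x + y) := hf.cont.comp (continuous_const.add continuous_id)
    rw [HeHe_eq hf]
    unfold Av
    rw [integral_map hm.measurable.aemeasurable hc.aestronglyMeasurable]
  rw [e (hg.pd i), e hg]
  exact ⟨(pd_Av hg i).symm, Av_diff hg⟩

lemma slice_eq {h g : EuclideanSpace ℝ (Fin n) → ℝ} (hh : Tst h) (hg : Tst g) (i j) (ρ : ℝ) :
    ∫ x, h x * He ρ (He ρ (pd2 g i j)) x = - ∫ x, He ρ (pd h i) x * He ρ (pd g j) x := by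
  obtain ⟨D, hD⟩ := (hg.pd j).bdd
  obtain ⟨D', hD'⟩ := ((hg.pd j).pd i).bdd
  have e : He ρ (He ρ (pd2 g i j)) = pd (He ρ (He ρ (pd g j))) i := (HeHe_pd (hg.pd j) i ρ).1
  rw [e, ibp_cs hh i (HeHe_pd (hg.pd j) i ρ).2, He_symm (hh.pd i) (φ := He ρ (pd g j)) (Av_cont (hg.pd j).cont hD) (fun x => Av_bdd hD x)]
  rw [← e]
  exact (HeHe_cont (hg.pd2 i j)).comp (Continuous.prodMk continuous_const continuous_id)

lemma res_bil {p q : ℝ} (hpq : p.HolderConjugate q) : ∃ M : ℝ, 0 < M ∧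
    ∀ h g : EuclideanSpace ℝ (Fin n) → ℝ, Tst h → Tst g → (∀ x, 0 ≤ h x) → (∀ x, 0 ≤ g x) → ∀ i j,
      |∫ x, h x * Av (res n) (pd2 g i j) x| ≤ M * ((∫ x, |h x| ^ p) ^ (1/p) * (∫ x, |g x| ^ q) ^ (1/q)) := by
  obtain ⟨M, hM, H⟩ := embed_bil (n := n) hpq
  refine ⟨2 * M, by positivity, fun h g hh hg hh0 hg0 i j => ?_⟩
  obtain ⟨HI, HB⟩ := H h g hh hg hh0 hg0 i j
  obtain ⟨D, hD⟩ := (hg.pd2 i j).bdd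
  have e1 : ∫ x, h x * Av (res n) (pd2 g i j) x = ∫ x, ∫ ρ in Set.Ioi 0, h x * (kd ρ * He ρ (He ρ (pd2 g i j)) x) := by
    congr 1; funext x
    rw [Av_res (hg.pd2 i j), integral_const_mul]
  have hint : Integrable (fun z : EuclideanSpace ℝ (Fin n) × ℝ => h z.1 * (kd z.2 * He z.2 (He z.2 (pd2 g i j)) z.1))
      (volume.prod (volume.restrict (Set.Ioi 0))) := by
    have h1 : Integrable (fun z : EuclideanSpace ℝ (Fin n) × ℝ => h z.1 * kd z.2) (volume.prod (volume.restrict (Set.Ioi 0))) :=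
      hh.integrable.mul_prod kd_int
    have h2 := h1.mul_bdd (c := D) (g := fun z : EuclideanSpace ℝ (Fin n) × ℝ => He z.2 (He z.2 (pd2 g i j)) z.1)
      (((HeHe_cont (hg.pd2 i j)).comp continuous_swap).aestronglyMeasurable)
      (Filter.Eventually.of_forall fun z => HeHe_bdd hD z.2 z.1)
    refine h2.congr (Filter.Eventually.of_forall fun z => ?_)
    simp only; ring
  rw [e1, integral_integral_swap (f := fun x ρ => h x * (kd ρ * He ρ (He ρ (pd2 g i j)) x)) hint]
  have hGI := HI.integral_prod_left
  rw [integral_prod _ HI] at HB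
  have hb := norm_integral_le_of_norm_le (μ := volume.restrict (Set.Ioi (0:ℝ)))
    (f := fun ρ => ∫ x, h x * (kd ρ * He ρ (He ρ (pd2 g i j)) x)) (hGI.const_mul 2) ?_
  · rw [integral_const_mul] at hb
    rw [← Real.norm_eq_abs]
    linarith
  · filter_upwards [ae_restrict_mem measurableSet_Ioi] with ρ hρ
    have hρ0 : 0 < ρ := hρ
    have e2 : ∫ x, h x * (kd ρ * He ρ (He ρ (pd2 g i j)) x) = kd ρ * (- ∫ x, He ρ (pd h i) x * He ρ (pd g j) x) := by
      rw [← slice_eq hh hg, ← integral_const_mul]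
      congr 1; funext x; ring
    rw [e2, norm_mul, norm_neg, Real.norm_of_nonneg (kd_nonneg hρ), integral_const_mul, ← mul_assoc]
    refine mul_le_mul ?_ ?_ (norm_nonneg _) (by positivity)
    · unfold kd
      have : Real.exp (-ρ^2) ≤ 1 := Real.exp_le_one_iff.2 (by nlinarith)
      nlinarith
    · refine (norm_integral_le_integral_norm _).trans (le_of_eq ?_)
      congr 1; funext x
      rw [norm_mul]; rfl

end resolv

section dual
variable {n : ℕ}

lemma dual_ext {p : ℝ} (hp : 1 < p) {V : EuclideanSpace ℝ (Fin n) → ℝ} (hV : Continuous V) {M : ℝ}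
    (H : ∀ F : EuclideanSpace ℝ (Fin n) → ℝ, Tst F → (∀ x, 0 ≤ F x) → ∫ x, F x * V x ≤ M * (∫ x, |F x| ^ p) ^ (1/p))
    {F : EuclideanSpace ℝ (Fin n) → ℝ} (hF : Continuous F) (hFc : HasCompactSupport F) (hF0 : ∀ x, 0 ≤ F x) :
    ∫ x, F x * V x ≤ M * (∫ x, |F x| ^ p) ^ (1/p) := by
  obtain ⟨R, hR⟩ := hFc.isCompact.isBounded.subset_closedBall 0
  obtain ⟨χ, hχ, hχ0, hχ1, hχR, -⟩ := cutoff (n := n) R 1 one_pos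
  have hχF : ∀ x, χ x * F x = F x := by
    intro x
    by_cases hx : x ∈ tsupport F
    · rw [hχR x (by simpa using hR hx), one_mul]
    · rw [image_eq_zero_of_notMem_tsupport hx, mul_zero]
  obtain ⟨B, hB⟩ := hFc.exists_bound_of_continuous hF
  have hu : UniformContinuous F := hFc.uniformContinuous_of_continuous hF
  have hε : ∀ k : ℕ, (0:ℝ) < 1 / (k + 1) := fun k => by positivity
  have hε1 : ∀ k : ℕ, (1:ℝ) / (k + 1) ≤ 1 := fun k => by
    rw [div_le_one (by positivity)]; linarith [(Nat.cast_nonneg k : (0:ℝ) ≤ k)]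
  choose G hG1 hG2 using fun k : ℕ => hu.exists_contDiff_dist_le (hε k)
  let Fk : ℕ → EuclideanSpace ℝ (Fin n) → ℝ := fun k x => χ x * (G k x + 1 / (k + 1))
  have hFk : ∀ k, Tst (Fk k) := fun k => ⟨hχ.1.mul ((hG1 k).add contDiff_const), hχ.2.mul_right⟩
  have hG3 : ∀ k x, |G k x - F x| < 1 / (k + 1) := fun k x => by simpa [Real.dist_eq] using hG2 k x
  have hFk0 : ∀ k x, 0 ≤ Fk k x := fun k x => by
    have := abs_lt.1 (hG3 k x)
    exact mul_nonneg (hχ0 x) (by linarith [hF0 x])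
  have hd : ∀ k x, |Fk k x - F x| ≤ 2 * (1 / (k + 1)) := fun k x => by
    have h1 := abs_lt.1 (hG3 k x)
    have : Fk k x - F x = χ x * (G k x + 1 / (k + 1) - F x) := by
      simp only [Fk]; nth_rw 1 [← hχF x]; ring
    rw [this, abs_mul, abs_of_nonneg (hχ0 x)]
    calc χ x * |G k x + 1 / (k + 1) - F x| ≤ 1 * |G k x + 1 / (k + 1) - F x| := by gcongr; exact hχ1 x
      _ ≤ _ := by rw [one_mul, abs_le]; constructor <;> linarith [h1.1, h1.2]
  have hle : ∀ k x, Fk k x ≤ χ x * (B + 2) := fun k x => by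
    have h1 := abs_lt.1 (hG3 k x)
    have h2 := (abs_le.1 (hB x)).2
    exact mul_le_mul_of_nonneg_left (by linarith [hε1 k]) (hχ0 x)
  have hlim : ∀ x, Filter.Tendsto (fun k => Fk k x) Filter.atTop (nhds (F x)) := fun x => by
    rw [tendsto_iff_dist_tendsto_zero]
    refine squeeze_zero (fun _ => dist_nonneg) (g := fun k : ℕ => 2 * (1 / ((k:ℝ) + 1))) (fun k => hd k x) ?_
    simpa using (tendsto_one_div_add_atTop_nhds_zero_nat (𝕜 := ℝ)).const_mul 2
  have T1 : Filter.Tendsto (fun k => ∫ x, Fk k x * V x) Filter.atTop (nhds (∫ x, F x * V x)) := by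
    refine tendsto_integral_of_dominated_convergence (fun x => χ x * ((B+2) * |V x|)) (fun k => ((hFk k).cont.mul hV).aestronglyMeasurable) ?_ ?_ ?_
    · exact (hχ.cont.mul (continuous_const.mul hV.abs)).integrable_of_hasCompactSupport hχ.2.mul_right
    · intro k; refine Filter.Eventually.of_forall fun x => ?_
      rw [norm_mul, Real.norm_of_nonneg (hFk0 k x), Real.norm_eq_abs, ← mul_assoc]
      exact mul_le_mul_of_nonneg_right (hle k x) (abs_nonneg _)
    · exact Filter.Eventually.of_forall fun x => (hlim x).mul_const _
  have hp0 : 0 < p := by linarith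
  have T2 : Filter.Tendsto (fun k => ∫ x, |Fk k x| ^ p) Filter.atTop (nhds (∫ x, |F x| ^ p)) := by
    refine tendsto_integral_of_dominated_convergence (fun x => |χ x * (B+2)| ^ p) (fun k => (cont_abs_rpow (hFk k).cont hp0).aestronglyMeasurable) ?_ ?_ ?_
    · exact (cont_abs_rpow (hχ.cont.mul continuous_const) hp0).integrable_of_hasCompactSupport (cs_abs_rpow hχ.2.mul_right hp0)
    · intro k; refine Filter.Eventually.of_forall fun x => ?_
      rw [Real.norm_of_nonneg (by positivity)]
      refine Real.rpow_le_rpow (abs_nonneg _) ?_ hp0.le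
      exact abs_le_abs_of_nonneg (hFk0 k x) (hle k x)
    · exact Filter.Eventually.of_forall fun x => ((hlim x).abs).rpow_const (Or.inr hp0.le)
  refine le_of_tendsto_of_tendsto T1 ((T2.rpow_const (Or.inr (by positivity))).const_mul M) (Filter.Eventually.of_forall fun k => ?_)
  exact H (Fk k) (hFk k) (hFk0 k)

lemma dual_pos {p q : ℝ} (hpq : p.HolderConjugate q) {V : EuclideanSpace ℝ (Fin n) → ℝ} (hV : Continuous V) {M : ℝ} (hM : 0 ≤ M)
    (H : ∀ F : EuclideanSpace ℝ (Fin n) → ℝ, Tst F → (∀ x, 0 ≤ F x) → ∫ x, F x * V x ≤ M * (∫ x, |F x| ^ p) ^ (1/p)) :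
    Integrable (fun x => (max (V x) 0) ^ q) ∧ ∫ x, (max (V x) 0) ^ q ≤ M ^ q := by
  have hp := hpq.lt
  have hq := hpq.symm.lt
  have hq0 : 0 < q := hpq.symm.pos
  let W : EuclideanSpace ℝ (Fin n) → ℝ := fun x => max (V x) 0
  have hW : Continuous W := hV.max continuous_const
  have hW0 : ∀ x, 0 ≤ W x := fun x => le_max_right _ _
  have hWq : Continuous fun x => W x ^ q := hW.rpow_const fun x => Or.inr hq0.le
  have hWq1 : Continuous fun x => W x ^ (q-1) := hW.rpow_const fun x => Or.inr (by linarith)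
  have hVW : ∀ x, W x ^ (q-1) * V x = W x ^ q := by
    intro x
    rcases le_or_gt (V x) 0 with h | h
    · have : W x = 0 := max_eq_right h
      rw [this, Real.zero_rpow (by linarith), Real.zero_rpow hq0.ne', zero_mul]
    · have : W x = V x := max_eq_left h.le
      rw [this, Real.rpow_sub_one h.ne']; field_simp
  have step : ∀ k : ℕ, ∫ x in Metric.ball 0 (k:ℝ), W x ^ q ≤ M ^ q := by
    intro k
    obtain ⟨χ, hχ, hχ0, hχ1, hχR, -⟩ := cutoff (n := n) (k:ℝ) 1 one_pos
    have hI : Integrable fun x => χ x * W x ^ q := (hχ.cont.mul hWq).integrable_of_hasCompactSupport hχ.2.mul_right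
    set A := ∫ x, χ x * W x ^ q with hA
    have hA0 : 0 ≤ A := integral_nonneg fun x => mul_nonneg (hχ0 x) (Real.rpow_nonneg (hW0 x) _)
    have h1 := dual_ext hp hV H (F := fun x => χ x * W x ^ (q-1)) (hχ.cont.mul hWq1) hχ.2.mul_right
      (fun x => mul_nonneg (hχ0 x) (Real.rpow_nonneg (hW0 x) _))
    have e1 : ∫ x, χ x * W x ^ (q-1) * V x = A := by
      simp only [mul_assoc, hVW]; rfl
    have e2 : ∫ x, |χ x * W x ^ (q-1)| ^ p ≤ A := by
      refine integral_mono_of_nonneg (Filter.Eventually.of_forall fun x => by positivity) hI (Filter.Eventually.of_forall fun x => ?_)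
      simp only
      rw [abs_of_nonneg (mul_nonneg (hχ0 x) (Real.rpow_nonneg (hW0 x) _)), Real.mul_rpow (hχ0 x) (Real.rpow_nonneg (hW0 x) _),
        ← Real.rpow_mul (hW0 x)]
      have : (q - 1) * p = q := by have := hpq.mul_eq_add; linarith
      rw [this]
      refine mul_le_mul_of_nonneg_right ?_ (Real.rpow_nonneg (hW0 x) _)
      calc χ x ^ p ≤ χ x ^ (1:ℝ) := Real.rpow_le_rpow_of_exponent_ge' (hχ0 x) (hχ1 x) zero_le_one hp.le
        _ = χ x := Real.rpow_one _
    have h2 : A ≤ M * A ^ (1/p) := by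
      rw [e1] at h1
      refine h1.trans (mul_le_mul_of_nonneg_left (Real.rpow_le_rpow (integral_nonneg fun x => by positivity) e2 (by have := hpq.pos; positivity)) hM)
    have h3 : A ≤ M ^ q := by
      rcases hA0.eq_or_lt with h | h
      · rw [← h]; positivity
      · have h4 : A ^ (1/q) ≤ M := by
          have e : A = A ^ (1/q) * A ^ (1/p) := by
            rw [← Real.rpow_add h]
            have := hpq.inv_add_inv_eq_one
            rw [one_div, one_div, add_comm, this, Real.rpow_one]
          have h2' := e.symm.le.trans h2
          exact le_of_mul_le_mul_right h2' (Real.rpow_pos_of_pos h (1/p))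
        have := Real.rpow_le_rpow (by positivity) h4 hq0.le
        rwa [← Real.rpow_mul hA0, one_div, inv_mul_cancel₀ hq0.ne', Real.rpow_one] at this
    refine le_trans ?_ h3
    have heq : Set.EqOn (fun x => χ x * W x ^ q) (fun x => W x ^ q) (Metric.ball 0 (k:ℝ)) := by
      intro x hx
      simp only [Metric.mem_ball, dist_zero_right] at hx
      simp [hχR x hx.le]
    rw [← setIntegral_congr_fun measurableSet_ball heq]
    exact setIntegral_le_integral hI (Filter.Eventually.of_forall fun x => mul_nonneg (hχ0 x) (Real.rpow_nonneg (hW0 x) _))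
  have hφ : AECover (volume : Measure (EuclideanSpace ℝ (Fin n))) Filter.atTop (fun k : ℕ => Metric.ball (0 : EuclideanSpace ℝ (Fin n)) (k:ℝ)) :=
    aecover_ball tendsto_natCast_atTop_atTop
  have hI : Integrable fun x => W x ^ q := by
    refine hφ.integrable_of_integral_norm_bounded (M ^ q) (fun k => ?_) (Filter.Eventually.of_forall fun k => ?_)
    · exact (hWq.continuousOn.integrableOn_compact (isCompact_closedBall 0 (k:ℝ))).mono_set Metric.ball_subset_closedBall
    · refine le_trans (le_of_eq ?_) (step k)
      congr 1; funext x
      exact Real.norm_of_nonneg (Real.rpow_nonneg (hW0 x) _)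
  exact ⟨hI, le_of_tendsto (hφ.integral_tendsto_of_countably_generated hI) (Filter.Eventually.of_forall step)⟩

lemma dual_D {p q : ℝ} (hpq : p.HolderConjugate q) {V : EuclideanSpace ℝ (Fin n) → ℝ} (hV : Continuous V) {M : ℝ} (hM : 0 ≤ M)
    (H : ∀ F : EuclideanSpace ℝ (Fin n) → ℝ, Tst F → (∀ x, 0 ≤ F x) → |∫ x, F x * V x| ≤ M * (∫ x, |F x| ^ p) ^ (1/p)) :
    Integrable (fun x => |V x| ^ q) ∧ (∫ x, |V x| ^ q) ^ (1/q) ≤ 2 * M := by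
  have hq := hpq.symm.lt
  have hq0 : 0 < q := hpq.symm.pos
  have h1 := dual_pos hpq hV hM (fun F hF hF0 => (le_abs_self _).trans (H F hF hF0))
  have h2 := dual_pos hpq (V := fun x => - V x) hV.neg hM (fun F hF hF0 => by
    simp only [mul_neg, integral_neg]
    exact (neg_le_abs _).trans (H F hF hF0))
  have e : ∀ x, |V x| ^ q = (max (V x) 0) ^ q + (max (- V x) 0) ^ q := by
    intro x
    rcases le_total (V x) 0 with h | h
    · rw [abs_of_nonpos h, max_eq_right h, max_eq_left (by linarith), Real.zero_rpow hq0.ne', zero_add]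
    · rw [abs_of_nonneg h, max_eq_left h, max_eq_right (by linarith), Real.zero_rpow hq0.ne', add_zero]
  simp only [e]
  refine ⟨h1.1.fun_add h2.1, ?_⟩
  rw [integral_add h1.1 h2.1]
  have h3 : 0 ≤ ∫ x, (max (V x) 0) ^ q := integral_nonneg fun x => by positivity
  have h4 : 0 ≤ ∫ x, (max (- V x) 0) ^ q := integral_nonneg fun x => by positivity
  calc _ ≤ ((2 * M) ^ q) ^ (1/q) := by
        refine Real.rpow_le_rpow (by positivity) ?_ (by positivity)
        rw [Real.mul_rpow (by norm_num) hM]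
        have : (2:ℝ) ≤ 2 ^ q := by
          calc (2:ℝ) = 2 ^ (1:ℝ) := (Real.rpow_one _).symm
            _ ≤ _ := Real.rpow_le_rpow_of_exponent_le (by norm_num) hq.le
        have : 2 * M ^ q ≤ 2 ^ q * M ^ q := mul_le_mul_of_nonneg_right this (by positivity)
        linarith [h1.2, h2.2]
    _ = 2 * M := by
        rw [← Real.rpow_mul (by positivity), one_div, mul_inv_cancel₀ hq0.ne', Real.rpow_one]

end dual

section hess
variable {n : ℕ}

lemma holder_c {p q : ℝ} (hpq : p.HolderConjugate q) {f g : EuclideanSpace ℝ (Fin n) → ℝ}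
    (hf : Continuous f) (hg : Continuous g) (hfp : Integrable fun x => |f x| ^ p) (hgq : Integrable fun x => |g x| ^ q) :
    Integrable (fun x => f x * g x) ∧ |∫ x, f x * g x| ≤ (∫ x, |f x| ^ p) ^ (1/p) * (∫ x, |g x| ^ q) ^ (1/q) := by
  have mf : MemLp f (ENNReal.ofReal p) := by
    rw [← integrable_norm_rpow_iff hf.aestronglyMeasurable (by simpa using hpq.pos) (by simp), ENNReal.toReal_ofReal hpq.pos.le]
    exact hfp
  have mg : MemLp g (ENNReal.ofReal q) := by
    rw [← integrable_norm_rpow_iff hg.aestronglyMeasurable (by simpa using hpq.symm.pos) (by simp), ENNReal.toReal_ofReal hpq.symm.pos.le]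
    exact hgq
  constructor
  · refine ((hfp.div_const p).add (hgq.div_const q)).mono' (hf.mul hg).aestronglyMeasurable (Filter.Eventually.of_forall fun z => ?_)
    rw [Real.norm_eq_abs, abs_mul]
    simpa using Real.young_inequality_of_nonneg (abs_nonneg (f z)) (abs_nonneg (g z)) hpq
  · have h := integral_mul_norm_le_Lp_mul_Lq hpq mf mg
    refine le_trans ?_ h
    rw [← Real.norm_eq_abs]
    refine (norm_integral_le_integral_norm (fun x => f x * g x)).trans (le_of_eq ?_)
    simp only [norm_mul]

lemma hess_est {p q : ℝ} (hpq : p.HolderConjugate q) : ∃ C : ℝ, 0 < C ∧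
    ∀ u : EuclideanSpace ℝ (Fin n) → ℝ, ContDiff ℝ (⊤ : ℕ∞) u → Integrable (fun x => |u x| ^ p) →
      Integrable (fun x => |lap u x| ^ p) → ∀ i j, Integrable (fun x => |pd2 u i j x| ^ p) ∧
      (∫ x, |pd2 u i j x| ^ p) ^ (1/p) ≤ C * ((∫ x, |u x| ^ p) ^ (1/p) + (∫ x, |lap u x| ^ p) ^ (1/p)) := by
  obtain ⟨M, hM, H⟩ := res_bil (n := n) hpq
  refine ⟨2 * (2 * M), by positivity, fun u hu hup hfp i j => ?_⟩
  set A := (∫ x, |u x| ^ p) ^ (1/p) with hA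
  set B := (∫ x, |lap u x| ^ p) ^ (1/p) with hB
  have hA0 : 0 ≤ A := Real.rpow_nonneg (integral_nonneg fun x => by positivity) _
  have hB0 : 0 ≤ B := Real.rpow_nonneg (integral_nonneg fun x => by positivity) _
  have := dual_D hpq.symm (V := pd2 u i j) (M := 2 * M * (A + B)) (smooth_pd2 hu i j).continuous (by positivity) ?_
  · refine ⟨this.1, this.2.trans (le_of_eq (by ring))⟩
  intro F hF hF0
  rw [ibp_pd2 hF i j hu]
  have hψ : Tst (pd2 F j i) := hF.pd2 j i
  obtain ⟨D, hD⟩ := hψ.bdd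
  obtain ⟨D', hD'⟩ := hψ.lap.bdd
  have hq1 := hpq.symm.lt.le
  set N := (∫ x, |F x| ^ q) ^ (1/q) with hN
  have hN0 : 0 ≤ N := Real.rpow_nonneg (integral_nonneg fun x => by positivity) _
  have cV : Continuous (Av (res n) (pd2 F j i)) := Av_cont hψ.cont hD
  have cV' : Continuous (Av (res n) (lap (pd2 F j i))) := Av_cont hψ.lap.cont hD'
  have hV := dual_D hpq (V := Av (res n) (pd2 F j i)) (M := M * N) cV (by positivity) (fun h hh hh0 => by
    refine (H h F hh hF hh0 hF0 j i).trans (le_of_eq ?_)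
    rw [← hN]; ring)
  have k1 := holder_c hpq hu.continuous cV hup hV.1
  have k2 := holder_c hpq (smooth_lap hu).continuous cV hfp hV.1
  have k3 := holder_c hpq hu.continuous cV' hup (Av_Lp hψ.lap hq1).1
  have e : ∫ x, pd2 F j i x * u x = (∫ x, u x * Av (res n) (pd2 F j i) x) - ∫ x, lap u x * Av (res n) (pd2 F j i) x := by
    rw [← Av_dual hu hpq hup hfp hψ, ← integral_sub k1.1 k3.1]
    congr 1; funext x
    nth_rw 1 [res_id hψ x]; ring
  rw [e]
  calc _ ≤ _ := abs_sub _ _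
    _ ≤ A * (2 * (M * N)) + B * (2 * (M * N)) := by
      refine add_le_add (k1.2.trans ?_) (k2.2.trans ?_)
      · exact mul_le_mul_of_nonneg_left hV.2 hA0
      · exact mul_le_mul_of_nonneg_left hV.2 hB0
    _ = _ := by ring

lemma line_pd {u : EuclideanSpace ℝ (Fin n) → ℝ} (hu : Differentiable ℝ u) (i : Fin n) (x) (s : ℝ) :
    HasDerivAt (fun s : ℝ => u (x + s • EuclideanSpace.single i 1)) (pd u i (x + s • EuclideanSpace.single i 1)) s := by
  unfold pd
  have h1 : HasDerivAt (fun s : ℝ => x + s • (EuclideanSpace.single i 1 : EuclideanSpace ℝ (Fin n))) (EuclideanSpace.single i 1) s := by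
    simpa using ((hasDerivAt_id s).smul_const (EuclideanSpace.single i 1 : EuclideanSpace ℝ (Fin n))).const_add x
  exact (hu _).hasFDerivAt.comp_hasDerivAt s h1

lemma taylor1 {u : EuclideanSpace ℝ (Fin n) → ℝ} (hu : ContDiff ℝ (⊤ : ℕ∞) u) (i : Fin n) (x) :
    pd u i x = u (x + EuclideanSpace.single i 1) - u x -
      ∫ s in (0:ℝ)..1, (1 - s) * pd2 u i i (x + s • EuclideanSpace.single i 1) := by
  have hl : Continuous (fun s : ℝ => x + s • (EuclideanSpace.single i 1 : EuclideanSpace ℝ (Fin n))) := by fun_prop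
  have h := intervalIntegral.integral_eq_sub_of_hasDerivAt (a := 0) (b := 1)
    (f := fun s : ℝ => (1 - s) * pd u i (x + s • EuclideanSpace.single i 1) + u (x + s • EuclideanSpace.single i 1))
    (f' := fun s : ℝ => (1 - s) * pd2 u i i (x + s • EuclideanSpace.single i 1)) ?_ ?_
  · rw [h]; simp
  · intro s _
    have h1 := line_pd (hu.differentiable (by norm_num)) i x s
    have h2 := line_pd ((smooth_pd hu i).differentiable (by norm_num)) i x s
    have h3 : HasDerivAt (fun s : ℝ => 1 - s) (-1) s := by simpa using (hasDerivAt_id s).const_sub 1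
    have := (h3.fun_mul h2).fun_add h1
    convert! this using 1
    unfold pd2; ring
  · exact ((continuous_const.sub continuous_id).mul ((smooth_pd2 hu i i).continuous.comp hl)).intervalIntegrable _ _

noncomputable def seg (n : ℕ) (i : Fin n) : Measure (EuclideanSpace ℝ (Fin n)) :=
  (volume.restrict (Set.Ioc (0:ℝ) 1)).map (fun s => s • EuclideanSpace.single i 1)

instance unit_prob : IsProbabilityMeasure (volume.restrict (Set.Ioc (0:ℝ) 1)) := ⟨by simp⟩

instance seg_prob (i : Fin n) : IsProbabilityMeasure (seg n i) :=
  Measure.isProbabilityMeasure_map (by fun_prop)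

lemma tay_rem {v : EuclideanSpace ℝ (Fin n) → ℝ} (hv : Continuous v) {p : ℝ} (hp : 1 ≤ p) (i : Fin n) (x) :
    |∫ s in (0:ℝ)..1, (1 - s) * v (x + s • EuclideanSpace.single i 1)| ^ p ≤ ∫ y, |v (x + y)| ^ p ∂(seg n i) := by
  have hp0 : 0 < p := by linarith
  have hl : Continuous (fun s : ℝ => x + s • (EuclideanSpace.single i 1 : EuclideanSpace ℝ (Fin n))) := by fun_prop
  have hvc := hv.comp hl
  have e : ∫ y, |v (x + y)| ^ p ∂(seg n i) = ∫ s in Set.Ioc (0:ℝ) 1, |v (x + s • EuclideanSpace.single i 1)| ^ p := by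
    unfold seg
    have hc : Continuous fun y => |v (x + y)| ^ p := (cont_abs_rpow hv hp0).comp (continuous_const.add continuous_id)
    rw [integral_map (by fun_prop) hc.aestronglyMeasurable]
  have hcp : Continuous fun s : ℝ => |v (x + s • EuclideanSpace.single i 1)| ^ p := (cont_abs_rpow hv hp0).comp hl
  rw [e, intervalIntegral.integral_of_le zero_le_one]
  have h1 : |∫ s in Set.Ioc (0:ℝ) 1, (1 - s) * v (x + s • EuclideanSpace.single i 1)| ≤ ∫ s in Set.Ioc (0:ℝ) 1, |v (x + s • EuclideanSpace.single i 1)| := by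
    rw [← Real.norm_eq_abs]
    refine norm_integral_le_of_norm_le (g := fun s => |v (x + s • EuclideanSpace.single i 1)|) (hvc.abs.integrableOn_Ioc) ?_
    filter_upwards [ae_restrict_mem measurableSet_Ioc] with s hs
    rw [norm_mul, Real.norm_eq_abs, Real.norm_eq_abs, abs_of_nonneg (by linarith [hs.2])]
    have := abs_nonneg (v (x + s • EuclideanSpace.single i 1))
    have := hs.1
    nlinarith
  have h2 := (convexOn_rpow hp).map_integral_le (μ := volume.restrict (Set.Ioc (0:ℝ) 1)) (f := fun s => |v (x + s • EuclideanSpace.single i 1)|)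
    (by exact (continuous_id.rpow_const fun _ => Or.inr (by linarith)).continuousOn) isClosed_Ici
    (Filter.Eventually.of_forall fun y => Set.mem_Ici.2 (abs_nonneg _))
    hvc.abs.integrableOn_Ioc hcp.integrableOn_Ioc
  exact (Real.rpow_le_rpow (abs_nonneg _) h1 (by linarith)).trans h2

lemma grad_est {p : ℝ} (hp : 1 < p) {u : EuclideanSpace ℝ (Fin n) → ℝ} (hu : ContDiff ℝ (⊤ : ℕ∞) u)
    (hup : Integrable (fun x => |u x| ^ p)) (i : Fin n) (hii : Integrable (fun x => |pd2 u i i x| ^ p)) :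
    Integrable (fun x => |pd u i x| ^ p) ∧
    (∫ x, |pd u i x| ^ p) ^ (1/p) ≤ 24 * ((∫ x, |u x| ^ p) ^ (1/p) + (∫ x, |pd2 u i i x| ^ p) ^ (1/p)) := by
  have hp0 : 0 < p := by linarith
  have hc2 := (smooth_pd2 hu i i).continuous
  have hI := (int_shift (μ := seg n i) (cont_abs_rpow hc2 hp0) hii).integral_prod_left
  have hE := integral_int_shift (μ := seg n i) (cont_abs_rpow hc2 hp0) hii
  have hs := hup.comp_add_right (EuclideanSpace.single i 1)
  have pt : ∀ x, |pd u i x| ^ p ≤ 4 ^ p * (|u (x + EuclideanSpace.single i 1)| ^ p + (|u x| ^ p + ∫ y, |pd2 u i i (x + y)| ^ p ∂(seg n i))) := by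
    intro x
    set T := ∫ s in (0:ℝ)..1, (1 - s) * pd2 u i i (x + s • EuclideanSpace.single i 1) with hT
    have hTe : |T| ^ p ≤ _ := tay_rem hc2 hp.le i x
    have h1 : |pd u i x| ≤ |u (x + EuclideanSpace.single i 1)| + (|u x| + |T|) := by
      rw [taylor1 hu i x, ← hT]
      have h1 := abs_sub (u (x + EuclideanSpace.single i 1) - u x) T
      have h2 := abs_sub (u (x + EuclideanSpace.single i 1)) (u x)
      linarith
    have h2 := Real.rpow_le_rpow (abs_nonneg _) h1 hp0.le
    have h3 := add_rpow_le2 (abs_nonneg (u (x + EuclideanSpace.single i 1))) (b := |u x| + |T|) (by positivity) hp0.le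
    have h4 := add_rpow_le2 (abs_nonneg (u x)) (abs_nonneg T) hp0.le
    have h5 : (4:ℝ) ^ p = 2 ^ p * 2 ^ p := by rw [← Real.mul_rpow (by norm_num) (by norm_num)]; norm_num
    have h6 : (1:ℝ) ≤ 2 ^ p := Real.one_le_rpow (by norm_num) hp0.le
    rw [h5]
    calc _ ≤ _ := h2
      _ ≤ _ := h3
      _ ≤ 2 ^ p * (2 ^ p * |u (x + EuclideanSpace.single i 1)| ^ p + 2 ^ p * (|u x| ^ p + ∫ y, |pd2 u i i (x + y)| ^ p ∂(seg n i))) := by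
        gcongr
        · exact le_mul_of_one_le_left (by positivity) h6
        · exact h4.trans (by gcongr)
      _ = _ := by ring
  have hR : Integrable (fun x => 4 ^ p * (|u (x + EuclideanSpace.single i 1)| ^ p + (|u x| ^ p + ∫ y, |pd2 u i i (x + y)| ^ p ∂(seg n i)))) :=
    (hs.fun_add (hup.fun_add hI)).const_mul _
  have h1 : Integrable (fun x => |pd u i x| ^ p) := by
    refine hR.mono' (cont_abs_rpow (smooth_pd hu i).continuous hp0).aestronglyMeasurable (Filter.Eventually.of_forall fun x => ?_)
    rw [Real.norm_of_nonneg (by positivity)]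
    exact pt x
  refine ⟨h1, ?_⟩
  have h2 := integral_mono h1 hR pt
  rw [integral_const_mul, integral_add hs (hup.fun_add hI), integral_add hup hI, hE,
    integral_add_right_eq_self (fun x => |u x| ^ p)] at h2
  have a0 : 0 ≤ ∫ x, |u x| ^ p := integral_nonneg fun x => by positivity
  have b0 : 0 ≤ ∫ x, |pd2 u i i x| ^ p := integral_nonneg fun x => by positivity
  have c0 : 0 ≤ ∫ x, |pd u i x| ^ p := integral_nonneg fun x => by positivity
  set a := ∫ x, |u x| ^ p
  set b := ∫ x, |pd2 u i i x| ^ p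
  have hr : (0:ℝ) ≤ 1/p := by positivity
  have hr1 : 1/p ≤ 1 := by rw [div_le_one hp0]; exact hp.le
  have h3 := Real.rpow_le_rpow c0 h2 hr
  rw [Real.mul_rpow (by positivity) (by positivity), ← Real.rpow_mul (by norm_num), mul_one_div_cancel hp0.ne', Real.rpow_one] at h3
  have h4 := add_rpow_le2 a0 (add_nonneg a0 b0) hr
  have h5 := add_rpow_le2 a0 b0 hr
  have h6 : (2:ℝ) ^ (1/p) ≤ 2 := by
    calc (2:ℝ) ^ (1/p) ≤ 2 ^ (1:ℝ) := Real.rpow_le_rpow_of_exponent_le (by norm_num) hr1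
      _ = 2 := Real.rpow_one _
  have ha := Real.rpow_nonneg a0 (1/p)
  have hb := Real.rpow_nonneg b0 (1/p)
  have h7 : (a + b) ^ (1/p) ≤ 2 * (a ^ (1/p) + b ^ (1/p)) := h5.trans (by gcongr)
  have h8 : (a + (a + b)) ^ (1/p) ≤ 2 * (a ^ (1/p) + (a + b) ^ (1/p)) := h4.trans (by gcongr)
  have : 4 * (a + (a + b)) ^ (1/p) ≤ 4 * (2 * (a ^ (1/p) + 2 * (a ^ (1/p) + b ^ (1/p)))) := by gcongr; linarith
  linarith

end hess

section asm
variable {n : ℕ}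

lemma sum_est {ι : Type*} [Fintype ι] {p : ℝ} (hp : 1 < p) {w : ι → EuclideanSpace ℝ (Fin n) → ℝ}
    {g : EuclideanSpace ℝ (Fin n) → ℝ} (hg : Continuous g) {K : ℝ} (hK : 0 ≤ K)
    (hw : ∀ k, Integrable fun x => |w k x| ^ p) (hwK : ∀ k, (∫ x, |w k x| ^ p) ^ (1/p) ≤ K)
    (hgw : ∀ x, |g x| ≤ ∑ k, |w k x|) :
    Integrable (fun x => |g x| ^ p) ∧ (∫ x, |g x| ^ p) ^ (1/p) ≤ (Fintype.card ι + 1) * K := by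
  have hp0 : 0 < p := by linarith
  set c : ℝ := (Fintype.card ι : ℝ)
  have hc0 : 0 ≤ c := Nat.cast_nonneg _
  have pt : ∀ x, |g x| ^ p ≤ (c + 1) ^ (p - 1) * ∑ k, |w k x| ^ p := fun x => by
    refine (Real.rpow_le_rpow (abs_nonneg _) (hgw x) hp0.le).trans ?_
    refine (Real.rpow_sum_le_const_mul_sum_rpow Finset.univ (fun k => w k x) hp.le).trans ?_
    refine mul_le_mul_of_nonneg_right ?_ (Finset.sum_nonneg fun k _ => by positivity)
    rw [Finset.card_univ]
    exact Real.rpow_le_rpow hc0 (by linarith) (by linarith)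
  have hR : Integrable fun x => (c + 1) ^ (p - 1) * ∑ k, |w k x| ^ p :=
    (integrable_finsetSum _ fun k _ => hw k).const_mul _
  have h1 : Integrable fun x => |g x| ^ p := by
    refine hR.mono' (cont_abs_rpow hg hp0).aestronglyMeasurable (Filter.Eventually.of_forall fun x => ?_)
    rw [Real.norm_of_nonneg (by positivity)]
    exact pt x
  refine ⟨h1, ?_⟩
  have h2 := integral_mono h1 hR pt
  rw [integral_const_mul, integral_finsetSum _ fun k _ => hw k] at h2
  have h3 : ∀ k, ∫ x, |w k x| ^ p ≤ K ^ p := fun k => by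
    have h0 : 0 ≤ ∫ x, |w k x| ^ p := integral_nonneg fun x => by positivity
    have := Real.rpow_le_rpow (by positivity) (hwK k) hp0.le
    rwa [← Real.rpow_mul h0, one_div, inv_mul_cancel₀ hp0.ne', Real.rpow_one] at this
  have h4 : ∑ k, ∫ x, |w k x| ^ p ≤ (c + 1) * K ^ p := by
    refine (Finset.sum_le_sum fun k _ => h3 k).trans ?_
    rw [Finset.sum_const, Finset.card_univ, nsmul_eq_mul]
    have : 0 ≤ K ^ p := by positivity
    nlinarith
  have h5 : ∫ x, |g x| ^ p ≤ ((c + 1) * K) ^ p := by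
    refine h2.trans ((mul_le_mul_of_nonneg_left h4 (by positivity)).trans (le_of_eq ?_))
    rw [Real.mul_rpow (by positivity) hK, ← mul_assoc, Real.rpow_sub_one (by positivity)]
    field_simp
  have h6 := Real.rpow_le_rpow (integral_nonneg fun x => by positivity) h5 (by positivity : 0 ≤ 1/p)
  rwa [← Real.rpow_mul (by positivity), mul_one_div_cancel hp0.ne', Real.rpow_one] at h6

lemma sqrt_le_sum {ι : Type*} [Fintype ι] (a : ι → ℝ) : |Real.sqrt (∑ k, a k ^ 2)| ≤ ∑ k, |a k| := by
  rw [abs_of_nonneg (Real.sqrt_nonneg _)]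
  refine Real.sqrt_le_iff.2 ⟨Finset.sum_nonneg fun k _ => abs_nonneg _, ?_⟩
  simp_rw [← sq_abs (a _)]
  exact Finset.sum_sq_le_sq_sum_of_nonneg fun k _ => abs_nonneg _

end asm

/-- Global `W^{2,p}` regularity: for `n ≥ 1` and `1 < p < ∞` there is `C = C(n,p) > 0`
such that every smooth solution of `Δu = f` with `u, f ∈ L^p(ℝⁿ)` satisfies
`|∇u|, |Hess u| ∈ L^p` and `‖∇u‖_p + ‖Hess u‖_p ≤ C(‖u‖_p + ‖f‖_p)`. -/
theorem global_W2p_regularity (n : ℕ) (hn : 1 ≤ n) (p : ℝ) (hp : 1 < p) :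
    ∃ C : ℝ, 0 < C ∧ ∀ u f : EuclideanSpace ℝ (Fin n) → ℝ,
      ContDiff ℝ (⊤ : ℕ∞) u → (∀ x, lap u x = f x) →
      Integrable (fun x => |u x| ^ p) → Integrable (fun x => |f x| ^ p) →
      Integrable (fun x => |gradNorm u x| ^ p) ∧
        Integrable (fun x => |hessNorm u x| ^ p) ∧
        lpNorm p (gradNorm u) + lpNorm p (hessNorm u) ≤ C * (lpNorm p u + lpNorm p f) := by
  obtain ⟨C, hC, H⟩ := hess_est (n := n) (Real.HolderConjugate.conjExponent hp)
  refine ⟨(n + 1) * (24 * (1 + C)) + (n * n + 1) * C, by positivity, fun u f hu hf hup hfp => ?_⟩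
  have : f = lap u := funext fun x => (hf x).symm
  subst this
  have Hu := H u hu hup hfp
  unfold _root_.lpNorm
  set A := (∫ x, |u x| ^ p) ^ (1/p) with hA
  set B := (∫ x, |lap u x| ^ p) ^ (1/p) with hB
  have hA0 : 0 ≤ A := Real.rpow_nonneg (integral_nonneg fun x => by positivity) _
  have hB0 : 0 ≤ B := Real.rpow_nonneg (integral_nonneg fun x => by positivity) _
  have hg : ∀ i, Integrable (fun x => |pd u i x| ^ p) ∧ (∫ x, |pd u i x| ^ p) ^ (1/p) ≤ 24 * (1 + C) * (A + B) := by
    intro i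
    have h := grad_est hp hu hup i (Hu i i).1
    refine ⟨h.1, h.2.trans ?_⟩
    have := (Hu i i).2
    rw [← hA]
    nlinarith
  have cg : Continuous (gradNorm u) := by
    unfold gradNorm
    exact Real.continuous_sqrt.comp (continuous_finsetSum _ fun i _ => (smooth_pd hu i).continuous.pow 2)
  have ch : Continuous (hessNorm u) := by
    unfold hessNorm
    exact Real.continuous_sqrt.comp (continuous_finsetSum _ fun i _ => continuous_finsetSum _ fun j _ => (smooth_pd2 hu i j).continuous.pow 2)
  have G := sum_est hp cg (w := fun i => pd u i) (K := 24 * (1 + C) * (A + B)) (by positivity) (fun i => (hg i).1) (fun i => (hg i).2)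
    (fun x => sqrt_le_sum fun i => pd u i x)
  have Hs := sum_est hp ch (w := fun ij : Fin n × Fin n => pd2 u ij.1 ij.2) (K := C * (A + B)) (by positivity) (fun i => (Hu i.1 i.2).1) (fun i => (Hu i.1 i.2).2)
    (fun x => by
      have := sqrt_le_sum fun ij : Fin n × Fin n => pd2 u ij.1 ij.2 x
      rw [Fintype.sum_prod_type] at this
      exact this)
  refine ⟨G.1, Hs.1, ?_⟩
  have h1 := G.2
  have h2 := Hs.2
  simp only [Fintype.card_fin, Fintype.card_prod, Nat.cast_mul] at h1 h2
  refine (add_le_add h1 h2).trans (le_of_eq ?_)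
  ring
end
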